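/- arXiv:1103.0319 — 2 statements merged into one kernel-verified Lean document; each statement's English description precedes it below -/
import Mathlib

section
/- Main Theorem: Fix k ≥ 2 in the definition of φ*. For any rook placement P on a Ferrers board F, the sequence of partitions along the right/up border of F produced by the modified growth diagram algorithm GDA_k applied to P equals the sequence produced by Fomin's growth diagram algorithm GDA applied to φ*(P); that is, seq_k(P,F) = seq(φ*(P),F). -/
open scoped Classical

/-- A cell (square) of the grid: `(column, row)`, both `≥ 1` for genuine cells. -/
abbrev Cell : Type := ℕ × ℕ

/-- The rectangle `R(a,b)` consisting of all cells `(i,j)` with `1 ≤ i ≤ a`, `1 ≤ j ≤ b`. -/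
def Rect (a b : ℕ) : Finset Cell := Finset.Icc 1 a ×ˢ Finset.Icc 1 b

/-- A Ferrers board (French notation): a down-left closed finite set of cells with
positive coordinates. -/
def IsFerrers (F : Finset Cell) : Prop :=
  ∀ p ∈ F, 1 ≤ p.1 ∧ 1 ≤ p.2 ∧
    ∀ q : Cell, 1 ≤ q.1 → 1 ≤ q.2 → q.1 ≤ p.1 → q.2 ≤ p.2 → q ∈ F

/-- A rook placement on a board `F`: a subset of `F` with at most one cell in each
column and at most one cell in each row. -/
def IsPlacement (F P : Finset Cell) : Prop :=
  P ⊆ F ∧ (∀ p ∈ P, ∀ q ∈ P, p.1 = q.1 → p = q) ∧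
    (∀ p ∈ P, ∀ q ∈ P, p.2 = q.2 → p = q)

/-- A decreasing sequence in `P`: columns strictly increase, rows strictly decrease. -/
def IsDecSeq (P : Finset Cell) (k : ℕ) (S : Fin k → Cell) : Prop :=
  (∀ i, S i ∈ P) ∧ ∀ i j : Fin k, i < j → (S i).1 < (S j).1 ∧ (S j).2 < (S i).2

/-- An increasing sequence in `P`: columns and rows both strictly increase. -/
def IsIncSeq (P : Finset Cell) (k : ℕ) (S : Fin k → Cell) : Prop :=
  (∀ i, S i ∈ P) ∧ ∀ i j : Fin k, i < j → (S i).1 < (S j).1 ∧ (S i).2 < (S j).2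

/-- Lexicographic comparison of two sequences of cells by their rows (values),
entry by entry from the left. -/
def rowLexLE (k : ℕ) (S T : Fin k → Cell) : Prop :=
  (∀ i, (S i).2 = (T i).2) ∨
    ∃ i : Fin k, (S i).2 < (T i).2 ∧ ∀ j : Fin k, j < i → (S j).2 = (T j).2

/-- An occurrence of the decreasing pattern `k…1` in the placement `P` on the board `F`:
a decreasing sequence of cells of `P`, all lying in a common rectangle contained in `F`. -/
def IsDecOcc (F P : Finset Cell) (k : ℕ) (D : Fin k → Cell) : Prop :=
  IsDecSeq P k D ∧ ∃ a b : ℕ, Rect a b ⊆ F ∧ ∀ i, D i ∈ Rect a b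

/-- `D` is the lexicographically value-smallest occurrence of `k…1` in `P`. -/
def IsMinOcc (F P : Finset Cell) (k : ℕ) (D : Fin k → Cell) : Prop :=
  IsDecOcc F P k D ∧ ∀ S : Fin k → Cell, IsDecOcc F P k S → rowLexLE k D S

/-- Cyclic successor on `Fin k`. -/
def cyc (k : ℕ) (i : Fin k) : Fin k :=
  ⟨(i.1 + 1) % k, Nat.mod_lt _ (Nat.lt_of_le_of_lt (Nat.zero_le _) i.isLt)⟩

/-- The action of `φ` on `P`, given the occurrence `D = D₁…D_k` of `k…1`: the columns of
`D₁,…,D_k` receive markers at the rows of `D₂,…,D_k,D₁` respectively; other cells are fixed. -/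
def phiStep (k : ℕ) (D : Fin k → Cell) (P : Finset Cell) : Finset Cell :=
  (P \ Finset.image D Finset.univ) ∪
    Finset.image (fun i : Fin k => ((D i).1, (D (cyc k i)).2)) Finset.univ

/-- The map `φ`: act on the value-smallest occurrence of `k…1` if one exists,
otherwise do nothing. -/
noncomputable def phi (F : Finset Cell) (k : ℕ) (P : Finset Cell) : Finset Cell :=
  if h : ∃ D : Fin k → Cell, IsMinOcc F P k D then phiStep k h.choose P else P

/-- `Q` is the result `φ*(P)` of iterating `φ` on `P` until no occurrence
of `k…1` remains. -/
def IsPhiStar (F : Finset Cell) (k : ℕ) (P Q : Finset Cell) : Prop :=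
  (∃ n : ℕ, (phi F k)^[n] P = Q) ∧ ¬ ∃ D : Fin k → Cell, IsDecOcc F Q k D

/-- The (least) index at which two partitions (written as functions `ℕ → ℕ`,
`0`-indexed entries) differ. -/
noncomputable def diffIdx (f g : ℕ → ℕ) : ℕ := sInf {n | f n ≠ g n}

/-- Fomin's local growth rule, computing the `NE` partition from `NW`, `SW`, `SE` and
whether the square holds a marker. Partitions are functions `ℕ → ℕ` (entry `n+1` is `f n`). -/
noncomputable def gdaRule (NW SW SE : ℕ → ℕ) (marked : Bool) : ℕ → ℕ :=
  if NW ≠ SE then fun n => max (NW n) (SE n)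
  else if SW ≠ NW then fun n => NW n + if n = diffIdx SW NW + 1 then 1 else 0
  else if marked then fun n => SW n + if n = 0 then 1 else 0
  else SW

/-- The modified local growth rule of `GDA_k`: rule (2) is applied with the proviso that
if it produces a partition with `k` nonzero entries, the last entry is deleted and the
first entry is increased by `1`. -/
noncomputable def gdakRule (k : ℕ) (NW SW SE : ℕ → ℕ) (marked : Bool) : ℕ → ℕ :=
  if NW ≠ SE then fun n => max (NW n) (SE n)
  else if SW ≠ NW then
    let NE : ℕ → ℕ := fun n => NW n + if n = diffIdx SW NW + 1 then 1 else 0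
    if (∀ n, n < k → NE n ≠ 0) ∧ (∀ n, k ≤ n → NE n = 0) then
      fun n => if n = 0 then NE 0 + 1 else if n = k - 1 then 0 else NE n
    else NE
  else if marked then fun n => SW n + if n = 0 then 1 else 0
  else SW

/-- The growth diagram of a placement `P` under a given local rule: `gda rule P i j` is
the partition assigned to the lattice point `(i,j)`, i.e. the NE corner of square `(i,j)`.
Corners on the left edge (`i = 0`) and bottom edge (`j = 0`) get the empty partition. -/
noncomputable def gda (rule : (ℕ → ℕ) → (ℕ → ℕ) → (ℕ → ℕ) → Bool → (ℕ → ℕ))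
    (P : Finset Cell) : ℕ → ℕ → (ℕ → ℕ)
  | 0, _ => fun _ => 0
  | _ + 1, 0 => fun _ => 0
  | i + 1, j + 1 =>
      rule (gda rule P i (j + 1)) (gda rule P i j) (gda rule P (i + 1) j)
        (decide ((i + 1, j + 1) ∈ P))
termination_by i j => (i, j)

/-- A lattice point on the right/up border of the board `F`: the NE corner of a square of
`F` which is not an interior corner (excluding the bottom and left edges of `F`). -/
def BorderCorner (F : Finset Cell) (c : Cell) : Prop :=
  c ∈ F ∧ (c.1 + 1, c.2 + 1) ∉ F

/-- The first row of the growth diagram: the length of the longest increasing sequence of `A`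
in the rectangle `R(i,j)` when `A` is a rook placement. -/
noncomputable def lis (A : Set Cell) : ℕ → ℕ → ℕ
  | 0, _ => 0
  | _ + 1, 0 => 0
  | i + 1, j + 1 =>
      if (i + 1, j + 1) ∈ A then lis A i j + 1 else max (lis A i (j + 1)) (lis A (i + 1) j)
termination_by i j => (i, j)

/-- Viennot's skeleton of `A`: the cells where two lines of the first row meet. -/
def skel (A : Set Cell) : Set Cell :=
  {p | ∃ i j, p = (i + 1, j + 1) ∧ lis A i (j + 1) = lis A i j + 1 ∧
    lis A (i + 1) j = lis A i j + 1}

/-- The growth diagram assembled from the first rows of the iterated skeletons. -/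
noncomputable def skelShape (A : Set Cell) (i j n : ℕ) : ℕ := lis (skel^[n] A) i j

/-- A (possibly infinite) rook placement in the positive quadrant. -/
structure Rook (A : Set Cell) : Prop where
  pos : ∀ x y, (x, y) ∈ A → 1 ≤ x ∧ 1 ≤ y
  col : ∀ x y y', (x, y) ∈ A → (x, y') ∈ A → y = y'
  row : ∀ x x' y, (x, y) ∈ A → (x', y) ∈ A → x = x'

section lis

variable {A : Set Cell}

@[simp] lemma lis_zero_left (j : ℕ) : lis A 0 j = 0 := by simp [lis]

@[simp] lemma lis_zero_right (i : ℕ) : lis A i 0 = 0 := by cases i <;> simp [lis]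

lemma lis_succ_of_mem {i j : ℕ} (h : (i + 1, j + 1) ∈ A) :
    lis A (i + 1) (j + 1) = lis A i j + 1 := by
  rw [lis, if_pos h]

lemma lis_succ_of_notMem {i j : ℕ} (h : (i + 1, j + 1) ∉ A) :
    lis A (i + 1) (j + 1) = max (lis A i (j + 1)) (lis A (i + 1) j) := by
  rw [lis, if_neg h]

lemma mem_skel {i j : ℕ} : (i + 1, j + 1) ∈ skel A ↔
    lis A i (j + 1) = lis A i j + 1 ∧ lis A (i + 1) j = lis A i j + 1 := by
  constructor
  · rintro ⟨i', j', h, h'⟩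
    simp only [Prod.mk.injEq, Nat.add_right_cancel_iff] at h
    obtain ⟨rfl, rfl⟩ := h
    exact h'
  · exact fun h => ⟨i, j, rfl, h⟩

lemma skel_pos {x y : ℕ} (h : (x, y) ∈ skel A) : ∃ i j, x = i + 1 ∧ y = j + 1 := by
  obtain ⟨i, j, h, -⟩ := h
  exact ⟨i, j, by simpa using h⟩

lemma lis_swap (A : Set Cell) (i j : ℕ) : lis (Prod.swap ⁻¹' A) i j = lis A j i := by
  induction i generalizing j with
  | zero => simp
  | succ i ih =>
    induction j with
    | zero => simp
    | succ j ihj =>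
      by_cases h : (j + 1, i + 1) ∈ A
      · rw [lis_succ_of_mem h, lis_succ_of_mem (A := Prod.swap ⁻¹' A) h, ih]
      · rw [lis_succ_of_notMem h, lis_succ_of_notMem (A := Prod.swap ⁻¹' A) h, ih, ihj, max_comm]

lemma skel_swap (A : Set Cell) : skel (Prod.swap ⁻¹' A) = Prod.swap ⁻¹' (skel A) := by
  ext ⟨x, y⟩
  rcases x with _ | x
  · constructor
    · rintro ⟨_, _, h, -⟩; simp at h
    · rintro ⟨_, _, h, -⟩; simp at h
  rcases y with _ | y
  · constructor
    · rintro ⟨_, _, h, -⟩; simp at h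
    · rintro ⟨_, _, h, -⟩; simp at h
  rw [mem_skel, Set.mem_preimage, Prod.swap_prod_mk, mem_skel]
  simp only [lis_swap]
  tauto

lemma skelShape_swap (A : Set Cell) (i j : ℕ) :
    skelShape (Prod.swap ⁻¹' A) i j = skelShape A j i := by
  ext n
  have : ∀ n, ∀ A : Set Cell, skel^[n] (Prod.swap ⁻¹' A) = Prod.swap ⁻¹' (skel^[n] A) := by
    intro n
    induction n with
    | zero => simp
    | succ n ih => intro A; simp only [Function.iterate_succ, Function.comp_apply, skel_swap, ih]
  rw [skelShape, this, lis_swap, skelShape]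

lemma Rook.swap (h : Rook A) : Rook (Prod.swap ⁻¹' A) :=
  ⟨fun _ _ h' => (h.pos _ _ h').symm, fun _ _ _ h₁ h₂ => h.row _ _ _ h₁ h₂,
    fun _ _ _ h₁ h₂ => h.col _ _ _ h₁ h₂⟩

lemma lis_step (A : Set Cell) (i j : ℕ) :
    (lis A i j ≤ lis A (i + 1) j ∧ lis A (i + 1) j ≤ lis A i j + 1) ∧
      lis A i j ≤ lis A i (j + 1) ∧ lis A i (j + 1) ≤ lis A i j + 1 := by
  induction i generalizing j with
  | zero =>
    refine ⟨?_, by simp⟩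
    induction j with
    | zero => simp
    | succ j ih =>
      by_cases h : (1, j + 1) ∈ A
      · simp [lis_succ_of_mem (i := 0) h]
      · rw [lis_succ_of_notMem (i := 0) h]
        simp at ih ⊢; exact ih
  | succ i ih =>
    have key : ∀ j, (lis A (i + 1) j ≤ lis A (i + 2) j ∧ lis A (i + 2) j ≤ lis A (i + 1) j + 1) →
        lis A (i + 1) j ≤ lis A (i + 1) (j + 1) ∧ lis A (i + 1) (j + 1) ≤ lis A (i + 1) j + 1 := by
      intro j _
      have := ih j
      have := ih (j + 1)
      by_cases h : (i + 1, j + 1) ∈ A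
      · rw [lis_succ_of_mem h]; omega
      · rw [lis_succ_of_notMem h]; omega
    induction j with
    | zero => exact ⟨by simp, key 0 (by simp)⟩
    | succ j ihj =>
      have : lis A (i + 1) (j + 1) ≤ lis A (i + 2) (j + 1) ∧
          lis A (i + 2) (j + 1) ≤ lis A (i + 1) (j + 1) + 1 := by
        by_cases h : (i + 1 + 1, j + 1) ∈ A
        · rw [lis_succ_of_mem h]; omega
        · rw [lis_succ_of_notMem h]; omega
      exact ⟨this, key _ this⟩

lemma lis_le_of_le {i i' j j' : ℕ} (hi : i ≤ i') (hj : j ≤ j') : lis A i j ≤ lis A i' j' :=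
  (monotone_nat_of_le_succ (fun i => (lis_step A i j).1.1) hi).trans
    (monotone_nat_of_le_succ (fun j => (lis_step A i' j).2.1) hj)

lemma lis_eq_of_col_empty {i j : ℕ} (h : ∀ y ≤ j, (i + 1, y) ∉ A) :
    lis A (i + 1) j = lis A i j := by
  induction j with
  | zero => simp
  | succ j ih =>
    rw [lis_succ_of_notMem (h _ le_rfl), ih fun y hy => h y (by omega)]
    have := lis_step A i j
    omega

lemma lis_eq_of_row_empty {i j : ℕ} (h : ∀ x ≤ i, (x, j + 1) ∉ A) :
    lis A i (j + 1) = lis A i j := by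
  have := lis_eq_of_col_empty (A := Prod.swap ⁻¹' A) (i := j) (j := i) h
  simpa only [lis_swap] using this

/-- A vertical line present at height `j'` is present at each lower height above its marker. -/
lemma col_line_down {i j j' : ℕ} (hj : j ≤ j') (h : ∀ y, j < y → y ≤ j' → (i + 1, y) ∉ A)
    (h' : lis A (i + 1) j' = lis A i j' + 1) : lis A (i + 1) j = lis A i j + 1 := by
  induction j', hj using Nat.le_induction with
  | base => exact h'
  | succ j' hj ih =>
    apply ih fun y h₁ h₂ => h y h₁ (by omega)
    rw [lis_succ_of_notMem (h _ (by omega) le_rfl)] at h'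
    have := lis_step A i j'
    omega

lemma row_line_down {i i' j : ℕ} (hi : i ≤ i') (h : ∀ x, i < x → x ≤ i' → (x, j + 1) ∉ A)
    (h' : lis A i' (j + 1) = lis A i' j + 1) : lis A i (j + 1) = lis A i j + 1 := by
  have := col_line_down (A := Prod.swap ⁻¹' A) (i := j) hi h (by simpa only [lis_swap] using h')
  simpa only [lis_swap] using this

/-- A vertical line continues upwards until it meets a cell of the skeleton. -/
lemma col_line_up {i j j' : ℕ} (hj : j ≤ j') (h : ∀ y, j < y → y ≤ j' → (i + 1, y) ∉ A)
    (hs : ∀ y, j < y → y ≤ j' → (i + 1, y) ∉ skel A)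
    (h' : lis A (i + 1) j = lis A i j + 1) : lis A (i + 1) j' = lis A i j' + 1 := by
  induction j', hj using Nat.le_induction with
  | base => exact h'
  | succ j' hj ih =>
    have := ih (fun y h₁ h₂ => h y h₁ (by omega)) (fun y h₁ h₂ => hs y h₁ (by omega))
    rw [lis_succ_of_notMem (h _ (by omega) le_rfl)]
    have h₂ := hs (j' + 1) (by omega) le_rfl
    rw [mem_skel] at h₂
    have := lis_step A i j'
    omega

lemma exists_mem_of_col_line {i j : ℕ} (h : lis A (i + 1) j ≠ lis A i j) :
    ∃ y ≤ j, (i + 1, y) ∈ A := by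
  by_contra! h'
  exact h (lis_eq_of_col_empty h')

lemma exists_mem_of_row_line {i j : ℕ} (h : lis A i (j + 1) ≠ lis A i j) :
    ∃ x ≤ i, (x, j + 1) ∈ A := by
  by_contra! h'
  exact h (lis_eq_of_row_empty h')

lemma exists_col_of_mem_skel {x y : ℕ} (h : (x, y) ∈ skel A) : ∃ y' < y, (x, y') ∈ A := by
  obtain ⟨i, j, rfl, rfl⟩ := skel_pos h
  rw [mem_skel] at h
  obtain ⟨y', h', h''⟩ := exists_mem_of_col_line (A := A) (i := i) (j := j) (by omega)
  exact ⟨y', by omega, h''⟩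

lemma exists_row_of_mem_skel {x y : ℕ} (h : (x, y) ∈ skel A) : ∃ x' < x, (x', y) ∈ A :=
  exists_col_of_mem_skel (A := Prod.swap ⁻¹' A) (x := y) (y := x) (by rwa [skel_swap])

lemma Rook.skel_col (hA : Rook A) {x y y' : ℕ} (h : (x, y) ∈ skel A) (h' : (x, y') ∈ skel A) :
    y ≤ y' := by
  by_contra! hlt
  obtain ⟨i, j, rfl, rfl⟩ := skel_pos h
  obtain ⟨i', j', hi, rfl⟩ := skel_pos h'
  obtain rfl : i = i' := by omega
  obtain ⟨z, hz, hzA⟩ := exists_col_of_mem_skel h'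
  have hne : ∀ y, j' < y → (i + 1, y) ∉ A := fun y hy hyA => by
    have := hA.col _ _ _ hyA hzA; omega
  rw [mem_skel] at h h'
  have := col_line_down (A := A) (i := i) (j := j' + 1) (j' := j) (by omega)
    (fun y h₁ _ => hne y (by omega)) h.2
  rw [lis_succ_of_notMem (hne _ (by omega))] at this
  omega

lemma Rook.rook_skel (hA : Rook A) : Rook (skel A) where
  pos x y h := by obtain ⟨i, j, rfl, rfl⟩ := skel_pos h; omega
  col _ _ _ h h' := le_antisymm (hA.skel_col h h') (hA.skel_col h' h)
  row x x' y h h' := by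
    have h₁ : (y, x) ∈ skel (Prod.swap ⁻¹' A) := by rwa [skel_swap]
    have h₂ : (y, x') ∈ skel (Prod.swap ⁻¹' A) := by rwa [skel_swap]
    exact le_antisymm (hA.swap.skel_col h₁ h₂) (hA.swap.skel_col h₂ h₁)

lemma lis_congr {A B : Set Cell} {i j : ℕ}
    (h : ∀ x y, 1 ≤ x → x ≤ i → 1 ≤ y → y ≤ j → ((x, y) ∈ A ↔ (x, y) ∈ B)) :
    lis A i j = lis B i j := by
  induction i generalizing j with
  | zero => simp
  | succ i ih =>
    induction j with
    | zero => simp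
    | succ j ihj =>
      have h₁ := ih (j := j) fun x y _ _ _ _ => h x y (by omega) (by omega) (by omega) (by omega)
      have h₂ := ih (j := j + 1) fun x y _ _ _ _ =>
        h x y (by omega) (by omega) (by omega) (by omega)
      have h₃ := ihj fun x y _ _ _ _ => h x y (by omega) (by omega) (by omega) (by omega)
      have h₀ := h (i + 1) (j + 1) (by omega) le_rfl (by omega) le_rfl
      by_cases hm : (i + 1, j + 1) ∈ A
      · rw [lis_succ_of_mem hm, lis_succ_of_mem (h₀.1 hm), h₁]
      · rw [lis_succ_of_notMem hm, lis_succ_of_notMem (fun h' => hm (h₀.2 h')), h₂, h₃]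

lemma skelShape_congr {A B : Set Cell} {i j : ℕ}
    (h : ∀ x y, 1 ≤ x → x ≤ i → 1 ≤ y → y ≤ j → ((x, y) ∈ A ↔ (x, y) ∈ B)) :
    skelShape A i j = skelShape B i j := by
  ext n
  induction n generalizing A B with
  | zero => exact lis_congr h
  | succ n ih =>
    refine ih fun x y hx hxi hy hyj => ?_
    obtain ⟨x, rfl⟩ := Nat.exists_eq_add_of_le' hx
    obtain ⟨y, rfl⟩ := Nat.exists_eq_add_of_le' hy
    have key : ∀ i' j', i' ≤ i → j' ≤ j → lis A i' j' = lis B i' j' := fun i' j' _ _ =>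
      lis_congr fun x y _ _ _ _ => h x y (by omega) (by omega) (by omega) (by omega)
    rw [mem_skel, mem_skel, key _ _ (by omega) hyj, key _ _ (by omega) (by omega),
      key _ _ hxi (by omega)]

lemma skelShape_zero (A : Set Cell) (i j : ℕ) : skelShape A i j 0 = lis A i j := rfl

lemma skelShape_succ (A : Set Cell) (i j n : ℕ) :
    skelShape A i j (n + 1) = skelShape (skel A) i j n := rfl

lemma skelShape_le_of_le {i i' j j' : ℕ} (hi : i ≤ i') (hj : j ≤ j') (n : ℕ) :
    skelShape A i j n ≤ skelShape A i' j' n := lis_le_of_le hi hj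

end lis

section gda

variable {A : Set Cell}

lemma Rook.iterate_skel (hA : Rook A) (n : ℕ) : Rook (skel^[n] A) := by
  induction n with
  | zero => exact hA
  | succ n ih => rw [Function.iterate_succ_apply']; exact ih.rook_skel

lemma exists_col_of_mem_iterate_skel {n m x y : ℕ} (h : (x, y) ∈ skel^[n + m] A) :
    ∃ y' ≤ y, (x, y') ∈ skel^[n] A := by
  induction m generalizing y with
  | zero => exact ⟨y, le_rfl, h⟩
  | succ m ih =>
    rw [← add_assoc, Function.iterate_succ_apply'] at h
    obtain ⟨y', h₁, h₂⟩ := exists_col_of_mem_skel h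
    obtain ⟨y'', h₃, h₄⟩ := ih h₂
    exact ⟨y'', by omega, h₄⟩

/-- Adjacent shapes differ in at most one row. -/
lemma Rook.skelShape_ne_unique (hA : Rook A) {i j n m : ℕ}
    (hn : skelShape A (i + 1) j n ≠ skelShape A i j n)
    (hm : skelShape A (i + 1) j m ≠ skelShape A i j m) : n = m := by
  by_contra hne
  wlog hlt : n < m generalizing n m
  · exact this hm hn (Ne.symm hne) (by omega)
  obtain ⟨y, hy, hyA⟩ := exists_mem_of_col_line hm
  obtain ⟨l, rfl⟩ := Nat.exists_eq_add_of_lt hlt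
  rw [show n + l + 1 = (n + 1) + l by omega] at hyA
  obtain ⟨y', hy', h'⟩ := exists_col_of_mem_iterate_skel hyA
  rw [Function.iterate_succ_apply'] at h'
  obtain ⟨y₀, hy₀, h₀⟩ := exists_col_of_mem_skel h'
  have hR := hA.iterate_skel n
  have hfree : ∀ y, y₀ < y → (i + 1, y) ∉ skel^[n] A := fun y hlt hy => by
    have := hR.col _ _ _ h₀ hy; omega
  obtain ⟨i', j', hi, rfl⟩ := skel_pos h'
  have hst := (lis_step (skel^[n] A) i j).1
  unfold skelShape at hn
  have hline := col_line_down (A := skel^[n] A) (i := i) (j := j' + 1) (j' := j) (by omega)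
    (fun y h₁ _ => hfree y (by omega)) (by omega)
  rw [mem_skel] at h'
  rw [lis_succ_of_notMem (hfree _ (by omega))] at hline
  omega

lemma Rook.skelShape_col_eq_of_mem (hA : Rook A) {i j : ℕ} (h : (i + 1, j + 1) ∈ A) :
    skelShape A (i + 1) j = skelShape A i j := by
  ext n
  apply lis_eq_of_col_empty
  intro y hy hmem
  obtain ⟨y', h₁, h₂⟩ := exists_col_of_mem_iterate_skel (n := 0) (m := n) (by simpa using hmem)
  have := hA.col _ _ _ h h₂
  omega

lemma Rook.skelShape_row_eq_of_mem (hA : Rook A) {i j : ℕ} (h : (i + 1, j + 1) ∈ A) :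
    skelShape A i (j + 1) = skelShape A i j := by
  have := hA.swap.skelShape_col_eq_of_mem (i := j) (j := i) h
  simpa only [skelShape_swap] using this

lemma diffIdx_eq {f g : ℕ → ℕ} {p : ℕ} (hp : f p ≠ g p) (h : ∀ n, n ≠ p → f n = g n) :
    diffIdx f g = p := by
  have : {n | f n ≠ g n} = {p} := by
    ext n
    exact ⟨fun hn => by_contra fun hnp => hn (h n hnp), fun hn => by rw [hn]; exact hp⟩
  rw [diffIdx, this, csInf_singleton]

lemma mem_iterate_skel_succ {i j n : ℕ} : (i + 1, j + 1) ∈ skel^[n + 1] A ↔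
    skelShape A i (j + 1) n = skelShape A i j n + 1 ∧
      skelShape A (i + 1) j n = skelShape A i j n + 1 := by
  rw [Function.iterate_succ_apply', mem_skel]
  rfl

lemma skelShape_succ_succ {i j n : ℕ} : skelShape A (i + 1) (j + 1) n =
    if (i + 1, j + 1) ∈ skel^[n] A then skelShape A i j n + 1
    else max (skelShape A i (j + 1) n) (skelShape A (i + 1) j n) := by
  unfold skelShape
  rw [lis]

/-- The shapes assembled from iterated skeletons satisfy Fomin's local rule. -/
lemma Rook.skelShape_rule (hA : Rook A) (i j : ℕ) : skelShape A (i + 1) (j + 1) =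
    gdaRule (skelShape A i (j + 1)) (skelShape A i j) (skelShape A (i + 1) j)
      (decide ((i + 1, j + 1) ∈ A)) := by
  have hsw : ∀ n, skelShape A i j n ≤ skelShape A i (j + 1) n ∧
      skelShape A i (j + 1) n ≤ skelShape A i j n + 1 := fun n => (lis_step _ i j).2
  by_cases hm : (i + 1, j + 1) ∈ A
  · have h₁ := hA.skelShape_col_eq_of_mem hm
    have h₂ := hA.skelShape_row_eq_of_mem hm
    simp only [gdaRule, h₁, h₂, hm, ne_eq, not_true_eq_false, if_false, decide_true, if_true]
    ext n
    rw [skelShape_succ_succ, h₁, h₂, max_self]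
    rcases n with _ | n
    · simp [hm]
    · rw [mem_iterate_skel_succ, h₂]
      simp
  simp only [hm, decide_false]
  by_cases hne : skelShape A i (j + 1) = skelShape A (i + 1) j
  · by_cases hSW : skelShape A i j = skelShape A i (j + 1)
    · simp only [gdaRule, hne, hSW, ne_eq, not_true_eq_false, if_false, Bool.false_eq_true]
      ext n
      rw [skelShape_succ_succ, ← hne, ← hSW, max_self]
      rcases n with _ | n
      · simp [hm]
      · rw [mem_iterate_skel_succ, ← hSW]
        simp
    · obtain ⟨p, hp⟩ := Function.ne_iff.1 hSW
      have huniq : ∀ n, n ≠ p → skelShape A i j n = skelShape A i (j + 1) n := by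
        intro n hnp
        by_contra hn
        refine hnp (hA.skelShape_ne_unique (i := i) (j := j) ?_ ?_) <;>
          rw [← hne] <;> exact Ne.symm ‹_›
      simp only [gdaRule, ← hne, ne_eq, not_true_eq_false, if_false, hSW, not_false_eq_true,
        if_true, diffIdx_eq hp huniq]
      ext n
      rw [skelShape_succ_succ, ← hne, max_self]
      rcases n with _ | n
      · simp [hm]
      · rw [mem_iterate_skel_succ, ← hne, and_self]
        by_cases hnp : n = p
        · subst hnp
          have h' := huniq (n + 1) (by omega)
          have := hsw n
          rw [if_pos (by omega), if_pos rfl, h']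
        · rw [if_neg (by rw [← huniq n hnp]; omega), if_neg (by omega)]
          rfl
  · simp only [gdaRule, ne_eq, hne, not_false_eq_true, if_true]
    ext n
    rw [skelShape_succ_succ]
    rcases n with _ | n
    · simp [hm]
    · rw [if_neg]
      rw [mem_iterate_skel_succ]
      rintro ⟨h₁, h₂⟩
      apply hne
      ext m
      by_cases hmn : m = n
      · rw [hmn]; omega
      · have e₁ : skelShape A (i + 1) j m = skelShape A i j m := by
          by_contra hc
          exact hmn (hA.skelShape_ne_unique hc (by omega))
        have e₂ : skelShape A i (j + 1) m = skelShape A i j m := by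
          by_contra hc
          refine hmn (hA.swap.skelShape_ne_unique (i := j) (j := i) ?_ ?_) <;>
            simp only [skelShape_swap] <;> omega
        rw [e₁, e₂]

lemma skelShape_zero_left (j : ℕ) : skelShape A 0 j = fun _ => 0 := by
  ext n; exact lis_zero_left j

lemma skelShape_zero_right (i : ℕ) : skelShape A i 0 = fun _ => 0 := by
  ext n; exact lis_zero_right i

lemma gda_eq_skelShape {P : Finset Cell} (hP : Rook (P : Set Cell)) (i j : ℕ) :
    gda gdaRule P i j = skelShape (P : Set Cell) i j := by
  induction i generalizing j with
  | zero => rw [skelShape_zero_left, gda]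
  | succ i ih =>
    induction j with
    | zero => rw [skelShape_zero_right, gda]
    | succ j ihj =>
      rw [gda, hP.skelShape_rule, ih, ih, ihj]
      simp only [Finset.mem_coe]

lemma gdakRule_eq_gdaRule {k : ℕ} {f g h : ℕ → ℕ} {b : Bool} (hk : 1 ≤ k)
    (h0 : gdaRule f g h b (k - 1) = 0) : gdakRule k f g h b = gdaRule f g h b := by
  unfold gdakRule gdaRule at *
  dsimp only
  by_cases h₁ : f ≠ h
  · rw [if_pos h₁, if_pos h₁]
  rw [if_neg h₁] at h0 ⊢
  rw [if_neg h₁]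
  by_cases h₂ : g ≠ f
  · rw [if_pos h₂] at h0 ⊢
    rw [if_pos h₂, if_neg fun h₃ => h₃.1 (k - 1) (by omega) h0]
  · rw [if_neg h₂, if_neg h₂]

lemma gdak_eq_skelShape {k : ℕ} (hk : 1 ≤ k) {P : Finset Cell} (hP : Rook (P : Set Cell))
    (i j : ℕ) (h0 : skelShape (P : Set Cell) i j (k - 1) = 0) :
    gda (gdakRule k) P i j = skelShape (P : Set Cell) i j := by
  induction i generalizing j with
  | zero => rw [skelShape_zero_left, gda]
  | succ i ih =>
    induction j with
    | zero => rw [skelShape_zero_right, gda]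
    | succ j ihj =>
      have key : ∀ i' j', i' ≤ i + 1 → j' ≤ j + 1 →
          skelShape (P : Set Cell) i' j' (k - 1) = 0 := fun i' j' hi hj =>
        Nat.le_zero.1 (h0 ▸ skelShape_le_of_le hi hj (k - 1))
      rw [gda, ih _ (key _ _ (by omega) le_rfl), ih _ (key _ _ (by omega) (by omega)),
        ihj (key _ _ le_rfl (by omega)), hP.skelShape_rule]
      simp only [Finset.mem_coe]
      apply gdakRule_eq_gdaRule hk
      rw [hP.skelShape_rule] at h0
      simpa only [Finset.mem_coe] using h0

end gda

section chain

variable {A : Set Cell}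

/-- `(x 0, y 0), …, (x (s - 1), y (s - 1))` is a decreasing sequence of cells of `A`. -/
def Chain (A : Set Cell) (s : ℕ) (x y : ℕ → ℕ) : Prop :=
  (∀ j < s, (x j, y j) ∈ A) ∧ ∀ j, j + 1 < s → x j < x (j + 1) ∧ y (j + 1) < y j

lemma Chain.lt {s : ℕ} {x y : ℕ → ℕ} (h : Chain A s x y) {i j : ℕ} (hij : i < j) (hj : j < s) :
    x i < x j ∧ y j < y i := by
  induction j, hij using Nat.le_induction with
  | base => exact h.2 i hj
  | succ j hij ih =>
    have := ih (by omega)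
    have := h.2 j hj
    omega

lemma Chain.le {s : ℕ} {x y : ℕ → ℕ} (h : Chain A s x y) {i j : ℕ} (hij : i ≤ j) (hj : j < s) :
    x i ≤ x j ∧ y j ≤ y i := by
  rcases hij.eq_or_lt with rfl | hij
  · simp
  · have := h.lt hij hj; omega

/-- Two chains spliced at position `m`. -/
lemma Chain.splice {s t m : ℕ} {x y u v : ℕ → ℕ} (h : Chain A s x y) (h' : Chain A t u v)
    {l : ℕ} (hm : 1 ≤ m) (hms : m ≤ s) (hx : x (m - 1) < u l) (hy : v l < y (m - 1)) :
    Chain A (m + (t - l)) (fun j => if j < m then x j else u (j - m + l))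
      (fun j => if j < m then y j else v (j - m + l)) := by
  refine ⟨fun j hj => ?_, fun j hj => ?_⟩
  · by_cases hjm : j < m
    · simp only [if_pos hjm]; exact h.1 j (by omega)
    · simp only [if_neg hjm]; exact h'.1 _ (by omega)
  · rcases lt_trichotomy (j + 1) m with hjm | hjm | hjm
    · simp only [if_pos hjm, if_pos (show j < m by omega)]; exact h.2 j (by omega)
    · subst hjm
      simp only [if_pos (show j < j + 1 by omega), lt_irrefl, if_false, Nat.sub_self, zero_add]
      exact ⟨hx, hy⟩
    · simp only [if_neg (show ¬ j + 1 < m by omega), if_neg (show ¬ j < m by omega)]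
      have := h'.2 (j - m + l) (by omega)
      rwa [show j + 1 - m + l = j - m + l + 1 by omega]

lemma Chain.mono {B : Set Cell} {s : ℕ} {x y : ℕ → ℕ} (h : Chain A s x y)
    (hAB : ∀ j < s, (x j, y j) ∈ A → (x j, y j) ∈ B) : Chain B s x y :=
  ⟨fun j hj => hAB j hj (h.1 j hj), h.2⟩

lemma Chain.drop {s : ℕ} {x y : ℕ → ℕ} (h : Chain A (s + 1) x y) :
    Chain A s (fun j => x (j + 1)) fun j => y (j + 1) :=
  ⟨fun j hj => h.1 (j + 1) (by omega), fun j hj => h.2 (j + 1) (by omega)⟩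

lemma Chain.cons {s a b : ℕ} {x y : ℕ → ℕ} (h : Chain A s x y) (hab : (a, b) ∈ A)
    (hlt : 0 < s → a < x 0 ∧ y 0 < b) :
    Chain A (s + 1) (fun j => if j = 0 then a else x (j - 1))
      fun j => if j = 0 then b else y (j - 1) := by
  refine ⟨fun j hj => ?_, fun j hj => ?_⟩
  · rcases j with _ | j
    · exact hab
    · exact h.1 j (by omega)
  · rcases j with _ | j
    · exact hlt (by omega)
    · exact h.2 j (by omega)

lemma Chain.snoc {s a b : ℕ} {x y : ℕ → ℕ} (h : Chain A s x y) (hab : (a, b) ∈ A)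
    (hlt : 0 < s → x (s - 1) < a ∧ b < y (s - 1)) :
    Chain A (s + 1) (fun j => if j < s then x j else a) fun j => if j < s then y j else b := by
  refine ⟨fun j hj => ?_, fun j hj => ?_⟩
  · by_cases hjs : j < s
    · simp only [if_pos hjs]; exact h.1 j hjs
    · simp only [if_neg hjs]; exact hab
  · by_cases hjs : j + 1 < s
    · simp only [if_pos hjs, if_pos (show j < s by omega)]; exact h.2 j hjs
    · obtain rfl : s = j + 1 := by omega
      simpa using hlt (by omega)

lemma Rook.exists_of_gap (hA : Rook A) {x y a : ℕ} (h : (x, y) ∈ skel A) (ha : a < x)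
    (hne : ∃ b, (a, b) ∈ A) (hs : ∀ b ≤ y, (a, b) ∉ skel A) :
    ∃ u v, (u, v) ∈ A ∧ a ≤ u ∧ u < x ∧ y ≤ v := by
  obtain ⟨u, hu, huA⟩ := exists_row_of_mem_skel h
  by_cases hau : a ≤ u
  · exact ⟨u, y, huA, hau, hu, le_rfl⟩
  obtain ⟨b, hb⟩ := hne
  by_cases hby : y ≤ b
  · exact ⟨a, b, hb, le_rfl, ha, hby⟩
  exfalso
  obtain ⟨i, j, rfl, rfl⟩ := skel_pos h
  obtain ⟨a, rfl⟩ := Nat.exists_eq_add_of_le' (hA.pos _ _ hb).1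
  obtain ⟨b, rfl⟩ := Nat.exists_eq_add_of_le' (hA.pos _ _ hb).2
  have hfree : ∀ y, b + 1 < y → (a + 1, y) ∉ A := fun y hy hyA => by
    have := hA.col _ _ _ hb hyA; omega
  have h₁ : lis A (a + 1) (b + 1) = lis A a (b + 1) + 1 := by
    rw [lis_succ_of_mem hb, lis_eq_of_row_empty]
    intro x hx hxA
    have := hA.row _ _ _ hb hxA; omega
  have h₂ := col_line_up (A := A) (i := a) (j := b + 1) (j' := j) (by omega)
    (fun y h₁ _ => hfree y h₁) (fun y _ _ => hs y (by omega)) h₁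
  have h₃ := row_line_down (A := A) (i := a) (i' := i) (j := j) (by omega)
    (fun x h₁ _ hx => by have := hA.row _ _ _ huA hx; omega) (mem_skel.1 h).1
  exact hs (j + 1) le_rfl (mem_skel.2 ⟨h₃, h₂⟩)

lemma Rook.exists_between (hA : Rook A) {x₁ y₁ x₂ y₂ : ℕ} (h₁ : (x₁, y₁) ∈ skel A)
    (h₂ : (x₂, y₂) ∈ skel A) (hx : x₁ < x₂) (hy : y₂ < y₁) :
    ∃ u v, (u, v) ∈ A ∧ x₁ ≤ u ∧ u < x₂ ∧ y₂ ≤ v ∧ v < y₁ := by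
  obtain ⟨b, hb, hbA⟩ := exists_col_of_mem_skel h₁
  by_cases hby : y₂ ≤ b
  · exact ⟨x₁, b, hbA, le_rfl, hx, hby, hb⟩
  obtain ⟨u, hu, huA⟩ := exists_row_of_mem_skel h₂
  by_cases hau : x₁ ≤ u
  · exact ⟨u, y₂, huA, hau, hu, le_rfl, hy⟩
  exfalso
  obtain ⟨i₁, j₁, rfl, rfl⟩ := skel_pos h₁
  obtain ⟨i₂, j₂, rfl, rfl⟩ := skel_pos h₂
  have h₃ := row_line_down (A := A) (i := i₁) (i' := i₂) (j := j₂) (by omega)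
    (fun x h₁ _ hx => by have := hA.row _ _ _ huA hx; omega) (mem_skel.1 h₂).1
  have h₄ := col_line_down (A := A) (i := i₁) (j := j₂) (j' := j₁) (by omega)
    (fun x h₁ _ hx => by have := hA.col _ _ _ hbA hx; omega) (mem_skel.1 h₁).2
  have := hA.skel_col h₁ (mem_skel.2 ⟨h₃, h₄⟩)
  omega

/-- A chain of the skeleton lifts to a chain which is longer by one. -/
lemma Rook.lift_chain (hA : Rook A) {s : ℕ} (hs : 1 ≤ s) {x y : ℕ → ℕ} (h : Chain (skel A) s x y)
    {m n : ℕ} (hmn : (m, n) ∈ A) (hm : m < x 0) (hn : y 0 ≤ n) :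
    ∃ u v, Chain A (s + 1) u v ∧ u 0 = m ∧ v 0 = n ∧ (∀ j < s, u j < x j ∧ y j ≤ v j) ∧
      (∀ j < s, x j ≤ u (j + 1) ∧ v (j + 1) < y j) ∧ u s = x (s - 1) := by
  have key : ∀ j, ∃ p : Cell, j ≤ s → p ∈ A ∧ (j = 0 → p = (m, n)) ∧
      (j < s → p.1 < x j ∧ y j ≤ p.2) ∧
      (1 ≤ j → x (j - 1) ≤ p.1 ∧ p.2 < y (j - 1)) ∧ (j = s → p.1 = x (s - 1)) := by
    intro j
    rcases Nat.eq_zero_or_pos j with rfl | hj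
    · exact ⟨(m, n), fun _ => ⟨hmn, fun _ => rfl, fun _ => ⟨hm, hn⟩, by omega, by omega⟩⟩
    obtain ⟨j, rfl⟩ := Nat.exists_eq_add_of_le' hj
    rcases lt_trichotomy (j + 1) s with hjs | hjs | hjs
    · have hlt := h.2 j hjs
      obtain ⟨u, v, huv, h₁, h₂, h₃, h₄⟩ :=
        hA.exists_between (h.1 j (by omega)) (h.1 (j + 1) hjs) hlt.1 hlt.2
      exact ⟨(u, v), fun _ => ⟨huv, by omega, fun _ => ⟨h₂, h₃⟩, fun _ => ⟨h₁, h₄⟩, by omega⟩⟩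
    · obtain ⟨v, hv, hvA⟩ := exists_col_of_mem_skel (h.1 j (by omega))
      exact ⟨(x j, v), fun _ => ⟨hvA, by omega, by omega, fun _ => ⟨le_rfl, hv⟩,
        fun _ => by rw [← hjs]; rfl⟩⟩
    · exact ⟨(0, 0), by omega⟩
  choose p hp using key
  refine ⟨fun j => (p j).1, fun j => (p j).2,
    ⟨fun j hj => (hp j (by omega)).1, fun j hj => ?_⟩, ?_, ?_, ?_, ?_, ?_⟩
  · have h₁ := (hp j (by omega)).2.2.1 (by omega)
    have h₂ := (hp (j + 1) (by omega)).2.2.2.1 (by omega)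
    simp only [Nat.add_sub_cancel] at h₂
    exact ⟨h₁.1.trans_le h₂.1, h₂.2.trans_le h₁.2⟩
  · exact congrArg Prod.fst ((hp 0 (by omega)).2.1 rfl)
  · exact congrArg Prod.snd ((hp 0 (by omega)).2.1 rfl)
  · exact fun j hj => (hp j (by omega)).2.2.1 hj
  · exact fun j hj => (hp (j + 1) (by omega)).2.2.2.1 (by omega)
  · exact (hp s le_rfl).2.2.2.2 rfl

lemma Rook.exists_lift_chain (hA : Rook A) {s : ℕ} (hs : 1 ≤ s) {x y : ℕ → ℕ}
    (h : Chain (skel A) s x y) : ∃ u v, Chain A (s + 1) u v ∧ v 0 = y 0 ∧ u s = x (s - 1) := by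
  obtain ⟨m, hm, hmA⟩ := exists_row_of_mem_skel (h.1 0 (by omega))
  obtain ⟨u, v, huv, -, h₁, -, -, h₂⟩ := hA.lift_chain hs h hmA hm le_rfl
  exact ⟨u, v, huv, h₁, h₂⟩

lemma exists_mem_of_lis_pos {a b : ℕ} (h : 0 < lis A a b) : ∃ x y, x ≤ a ∧ y ≤ b ∧ (x, y) ∈ A := by
  by_contra! hc
  have : lis A a b = lis ∅ a b :=
    lis_congr fun x y _ hx _ hy => iff_of_false (hc x y hx hy) (by simp)
  have h0 : ∀ a b, lis ∅ a b = 0 := by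
    intro a
    induction a with
    | zero => simp
    | succ a ih => intro b; rw [lis_eq_of_col_empty (by simp), ih]
  rw [h0] at this
  omega

lemma Rook.exists_chain_of_skelShape_pos (hA : Rook A) {a b n : ℕ} (h : 0 < skelShape A a b n) :
    ∃ u v, Chain A (n + 1) u v ∧ v 0 ≤ b ∧ u n ≤ a := by
  induction n generalizing A with
  | zero =>
    obtain ⟨x, y, hx, hy, hxy⟩ := exists_mem_of_lis_pos h
    exact ⟨fun _ => x, fun _ => y, ⟨fun _ _ => hxy, by omega⟩, hy, hx⟩
  | succ n ih =>
    obtain ⟨x, y, h₁, h₂, h₃⟩ := ih hA.rook_skel h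
    obtain ⟨u, v, h₄, h₅, h₆⟩ := hA.exists_lift_chain (by omega) h₁
    exact ⟨u, v, h₄, h₅ ▸ h₂, by rw [h₆]; exact h₃⟩

end chain

section shift

variable {A : Set Cell} {r : ℕ} {c d α β : ℕ → ℕ}

/-- The local structure around the value-smallest occurrence of a decreasing pattern: `A` is the
part of the placement left of and below the corner `(c r, d 0)`, the cells `(c (i + 1), d (i + 1))`
form the chain to be moved, and no chain of length `r` to the right of column `c 0` goes below or
to the left of it. -/
structure Shift (r : ℕ) (A : Set Cell) (c d : ℕ → ℕ) : Prop where
  rook : Rook A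
  bound : ∀ x y, (x, y) ∈ A → x ≤ c r ∧ y < d 0
  one_le : 1 ≤ c 0 ∧ 1 ≤ d r
  col_empty : ∀ y, (c 0, y) ∉ A
  step : ∀ i < r, c i < c (i + 1) ∧ d (i + 1) < d i
  mem : ∀ i < r, (c (i + 1), d (i + 1)) ∈ A
  no_chain : ∀ x y, ¬ Chain A (r + 1) x y
  minimal : ∀ x y, Chain A r x y → (0 < r → c 0 < x 0) →
    ∀ i < r, c (i + 1) ≤ x i ∧ d (i + 1) ≤ y i

/-- The result of moving each cell `(c (i + 1), d (i + 1))` horizontally to column `c i`. -/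
def slide (r : ℕ) (A : Set Cell) (c d : ℕ → ℕ) : Set Cell :=
  {p | (p ∈ A ∧ ∀ i < r, p ≠ (c (i + 1), d (i + 1))) ∨ ∃ i < r, p = (c i, d (i + 1))}

namespace Shift

lemma lt (h : Shift r A c d) {i j : ℕ} (hij : i < j) (hj : j ≤ r) : c i < c j ∧ d j < d i := by
  induction j, hij using Nat.le_induction with
  | base => exact h.step i hj
  | succ j hij ih =>
    have := ih (by omega)
    have := h.step j hj
    omega

lemma le (h : Shift r A c d) {i j : ℕ} (hij : i ≤ j) (hj : j ≤ r) : c i ≤ c j ∧ d j ≤ d i := by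
  rcases hij.eq_or_lt with rfl | hij
  · simp
  · have := h.lt hij hj; omega

lemma one_le_c (h : Shift r A c d) {i : ℕ} (hi : i ≤ r) : 1 ≤ c i :=
  h.one_le.1.trans (h.le (Nat.zero_le i) hi).1

lemma one_le_d (h : Shift r A c d) {i : ℕ} (hi : i ≤ r) : 1 ≤ d i :=
  h.one_le.2.trans (h.le hi le_rfl).2

lemma eq_of_c (h : Shift r A c d) {i j x : ℕ} (hi : i < r) (hj : j < r) (h₁ : c i ≤ x)
    (h₂ : x < c (i + 1)) (h₃ : c j ≤ x) (h₄ : x < c (j + 1)) : i = j := by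
  rcases lt_trichotomy i j with hij | hij | hij
  · have := h.le (i := i + 1) (j := j) hij hj.le; omega
  · exact hij
  · have := h.le (i := j + 1) (j := i) hij hi.le; omega

lemma eq_of_d (h : Shift r A c d) {i j y : ℕ} (hi : i < r) (hj : j < r) (h₁ : d (i + 1) ≤ y)
    (h₂ : y < d i) (h₃ : d (j + 1) ≤ y) (h₄ : y < d j) : i = j := by
  rcases lt_trichotomy i j with hij | hij | hij
  · have := h.le (i := i + 1) (j := j) hij hj.le; omega
  · exact hij
  · have := h.le (i := j + 1) (j := i) hij hi.le; omega

lemma not_insert (h : Shift r A c d) {i x y : ℕ} (hi : i < r) (hxy : (x, y) ∈ A)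
    (h₀ : 0 < i → c i < x ∧ y < d i) (h₁ : x < c (i + 1)) (h₂ : d (i + 1) < y) : False := by
  refine h.no_chain (fun j => if j < i then c (j + 1) else if j = i then x else c j)
    (fun j => if j < i then d (j + 1) else if j = i then y else d j)
    ⟨fun j hj => ?_, fun j hj => ?_⟩
  · rcases lt_trichotomy j i with hji | hji | hji
    · simp only [if_pos hji]; exact h.mem j (by omega)
    · subst hji; simpa using hxy
    · simp only [if_neg hji.not_gt, if_neg hji.ne']
      have := h.mem (j - 1) (by omega)
      rwa [Nat.sub_add_cancel (by omega)] at this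
  · rcases lt_trichotomy j i with hji | hji | hji
    · by_cases hji' : j + 1 < i
      · simp only [if_pos hji, if_pos hji']; exact h.step (j + 1) (by omega)
      · obtain rfl : i = j + 1 := by omega
        simpa using h₀ (by omega)
    · subst hji; simpa using ⟨h₁, h₂⟩
    · simp only [if_neg hji.not_gt, if_neg hji.ne', if_neg (show ¬ j + 1 < i by omega),
        if_neg (show j + 1 ≠ i by omega)]
      exact h.step j (by omega)

lemma not_replace (h : Shift r A c d) {i x y : ℕ} (hi : i < r) (hxy : (x, y) ∈ A)
    (h₀ : c i < x) (h₀' : 0 < i → y < d i) (h₁ : x < c (i + 1) ∨ y < d (i + 1))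
    (h₂ : i + 1 < r → x < c (i + 2) ∧ d (i + 2) < y) : False := by
  have := h.minimal (fun j => if j = i then x else c (j + 1))
    (fun j => if j = i then y else d (j + 1)) ⟨fun j hj => ?_, fun j hj => ?_⟩ (fun _ => ?_) i hi
  · simp only [if_true] at this; omega
  · by_cases hji : j = i
    · simp only [if_pos hji]; exact hxy
    · simp only [if_neg hji]; exact h.mem j hj
  · rcases lt_trichotomy j i with hji | hji | hji
    · by_cases hji' : j + 1 = i
      · subst hji'; simpa using ⟨h₀, h₀' (by omega)⟩
      · simp only [if_neg hji.ne, if_neg hji']; exact h.step (j + 1) (by omega)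
    · subst hji; simpa using h₂ hj
    · simp only [if_neg hji.ne', if_neg (show j + 1 ≠ i by omega)]
      exact h.step (j + 1) (by omega)
  · by_cases h0 : 0 = i
    · subst h0; simpa using h₀
    · simp only [if_neg h0]; exact (h.step 0 (by omega)).1

lemma eq_or_eq_of_mem (h : Shift r A c d) {i x y : ℕ} (hi : i < r) (hxy : (x, y) ∈ A)
    (h₁ : c i ≤ x) (h₂ : x ≤ c (i + 1)) (h₃ : d (i + 1) ≤ y) (h₄ : y ≤ d i) :
    (x = c (i + 1) ∧ y = d (i + 1)) ∨ 1 ≤ i ∧ x = c i ∧ y = d i := by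
  have hm := h.mem i hi
  have hm' : 1 ≤ i → (c i, d i) ∈ A := fun h1 => by
    have := h.mem (i - 1) (by omega)
    rwa [Nat.sub_add_cancel h1] at this
  by_cases e₁ : x = c (i + 1)
  · subst e₁; exact Or.inl ⟨rfl, h.rook.col _ _ _ hxy hm⟩
  by_cases e₂ : y = d (i + 1)
  · subst e₂; exact Or.inl ⟨h.rook.row _ _ _ hxy hm, rfl⟩
  by_cases e₃ : x = c i
  · subst e₃
    rcases Nat.eq_zero_or_pos i with rfl | h1
    · exact absurd hxy (h.col_empty y)
    · exact Or.inr ⟨h1, rfl, h.rook.col _ _ _ hxy (hm' h1)⟩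
  by_cases e₄ : y = d i
  · subst e₄
    rcases Nat.eq_zero_or_pos i with rfl | h1
    · have := h.bound _ _ hxy; omega
    · exact Or.inr ⟨h1, h.rook.row _ _ _ hxy (hm' h1), rfl⟩
  exact (h.not_insert hi hxy (fun _ => ⟨by omega, by omega⟩) (by omega) (by omega)).elim

/-- Below its marker the column `c i` is not crossed by a line. -/
lemma lis_col_eq (h : Shift r A c d) {i x y : ℕ} (hi : i ≤ r) (hx : x + 1 = c i)
    (hy : y < d i) : lis A (x + 1) y = lis A x y := by
  refine lis_eq_of_col_empty fun y' hy' hmem => ?_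
  rw [hx] at hmem
  rcases Nat.eq_zero_or_pos i with rfl | h1
  · exact h.col_empty _ hmem
  · obtain ⟨i, rfl⟩ := Nat.exists_eq_add_of_le' (show 1 ≤ i from h1)
    have := h.rook.col _ _ _ hmem (h.mem i (by omega))
    omega

lemma lis_row_eq (h : Shift r A c d) {i x y : ℕ} (hi : i < r) (hy : y + 1 = d (i + 1))
    (hx : x < c (i + 1)) : lis A x (y + 1) = lis A x y := by
  refine lis_eq_of_row_empty fun x' hx' hmem => ?_
  rw [hy] at hmem
  have := h.rook.row _ _ _ hmem (h.mem i hi)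
  omega

end Shift

/-- `(α i, β i)` is the far corner of the largest rectangle based at `(c i, d (i + 1))` on whose
left and bottom sides `lis A` is constant. -/
structure Corners (r : ℕ) (A : Set Cell) (c d α β : ℕ → ℕ) : Prop where
  shift : Shift (r + 1) A c d
  α_lt : ∀ i < r + 1, c i < α i ∧ α i ≤ c (i + 1)
  α_val : ∀ i < r + 1, lis A (α i) (d (i + 1)) = lis A (c i) (d (i + 1)) + 1
  α_const : ∀ i < r + 1, ∀ a, c i ≤ a → a < α i → lis A a (d (i + 1)) = lis A (c i) (d (i + 1))
  β_lt : ∀ i < r + 1, d (i + 1) < β i ∧ β i ≤ d i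
  β_val : ∀ i < r + 1, 0 < i → lis A (c i) (β i) = lis A (c i) (d (i + 1)) + 1
  β_const : ∀ i < r + 1, ∀ b, d (i + 1) ≤ b → b < β i → lis A (c i) b = lis A (c i) (d (i + 1))
  first : β 0 = d 0
  last : α r = c (r + 1)
  node : ∀ i < r, α i = c (i + 1) ∨ β (i + 1) = d (i + 1)

lemma exists_first_jump {f : ℕ → ℕ} {m n : ℕ} (hf : ∀ i, f i ≤ f (i + 1) ∧ f (i + 1) ≤ f i + 1)
    (hmn : m ≤ n) (h : f m < f n) :
    ∃ a, m < a ∧ a ≤ n ∧ f a = f m + 1 ∧ ∀ b, m ≤ b → b < a → f b = f m := by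
  induction n, hmn using Nat.le_induction with
  | base => omega
  | succ n hmn ih =>
    have hmono := monotone_nat_of_le_succ fun i => (hf i).1
    by_cases hlt : f m < f n
    · obtain ⟨a, h₁, h₂, h₃⟩ := ih hlt
      exact ⟨a, h₁, by omega, h₃⟩
    · have := hf n
      have := hmono hmn
      refine ⟨n + 1, by omega, le_rfl, by omega, fun b hb hb' => ?_⟩
      have := hmono hb
      have := hmono (show b ≤ n by omega)
      omega

lemma Shift.exists_corners (h : Shift (r + 1) A c d) : ∃ α β, Corners r A c d α β := by
  have hA := h.rook
  have hα : ∀ i, ∃ a, i < r + 1 → c i < a ∧ a ≤ c (i + 1) ∧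
      lis A a (d (i + 1)) = lis A (c i) (d (i + 1)) + 1 ∧
      ∀ b, c i ≤ b → b < a → lis A b (d (i + 1)) = lis A (c i) (d (i + 1)) := by
    intro i
    by_cases hi : i < r + 1
    · obtain ⟨a, ha⟩ := exists_first_jump (f := fun a => lis A a (d (i + 1)))
        (fun a => (lis_step A a _).1) (h.step i hi).1.le (by
          obtain ⟨x, hx⟩ := Nat.exists_eq_add_of_le' (h.one_le_c (i := i + 1) hi)
          obtain ⟨y, hy⟩ := Nat.exists_eq_add_of_le' (h.one_le_d (i := i + 1) hi)
          have hm := h.mem i hi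
          have := h.step i hi
          have h₁ : lis A (c i) (d (i + 1)) ≤ lis A x (d (i + 1)) := lis_le_of_le (by omega) le_rfl
          have h₂ := h.lis_row_eq (i := i) (x := x) hi hy.symm (by omega)
          rw [hx, hy] at hm
          have h₃ := lis_succ_of_mem hm
          show lis A _ _ < lis A _ _
          rw [hx]
          rw [hy] at h₁ ⊢
          omega)
      exact ⟨a, fun _ => ha⟩
    · exact ⟨0, fun h => absurd h hi⟩
  have hβ : ∀ i, ∃ b, (i = 0 → b = d 0) ∧ (i < r + 1 → 0 < i → d (i + 1) < b ∧ b ≤ d i ∧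
      lis A (c i) b = lis A (c i) (d (i + 1)) + 1 ∧
      ∀ b', d (i + 1) ≤ b' → b' < b → lis A (c i) b' = lis A (c i) (d (i + 1))) := by
    intro i
    rcases Nat.eq_zero_or_pos i with rfl | h1
    · exact ⟨d 0, fun _ => rfl, by omega⟩
    by_cases hi : i < r + 1
    · obtain ⟨a, ha⟩ := exists_first_jump (f := fun b => lis A (c i) b)
        (fun b => (lis_step A _ b).2) (h.step i hi).2.le (by
          obtain ⟨j, rfl⟩ := Nat.exists_eq_add_of_le' (show 1 ≤ i from h1)
          obtain ⟨x, hx⟩ := Nat.exists_eq_add_of_le' (h.one_le_c (i := j + 1) hi.le)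
          obtain ⟨y, hy⟩ := Nat.exists_eq_add_of_le' (h.one_le_d (i := j + 1) hi.le)
          have hm := h.mem j (by omega)
          have := h.step (j + 1) hi
          have h₁ : lis A (c (j + 1)) (d (j + 1 + 1)) ≤ lis A (c (j + 1)) y :=
            lis_le_of_le le_rfl (by omega)
          have h₂ := h.lis_col_eq (i := j + 1) (x := x) (y := y) hi.le hx.symm (by omega)
          rw [hx, hy] at hm
          have h₃ := lis_succ_of_mem hm
          show lis A _ _ < lis A _ (d (j + 1))
          rw [hy]
          rw [hx] at h₁ ⊢
          omega)
      exact ⟨a, by omega, fun _ _ => ha⟩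
    · exact ⟨0, by omega, fun h => absurd h hi⟩
  choose α hα using hα
  choose β hβ using hβ
  have hβ0 := (hβ 0).1 rfl
  refine ⟨α, β, h, fun i hi => ⟨(hα i hi).1, (hα i hi).2.1⟩, fun i hi => (hα i hi).2.2.1,
    fun i hi => (hα i hi).2.2.2, fun i hi => ?_, fun i hi h1 => ((hβ i).2 hi h1).2.2.1,
    fun i hi b hb hb' => ?_, hβ0, ?_, fun i hi => ?_⟩
  · rcases Nat.eq_zero_or_pos i with rfl | h1
    · have := h.step 0 hi; omega
    · have := (hβ i).2 hi h1; omega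
  · rcases Nat.eq_zero_or_pos i with rfl | h1
    · rw [hβ0] at hb'
      induction b, hb using Nat.le_induction with
      | base => rfl
      | succ b hb ih =>
        rw [← ih (by omega)]
        refine lis_eq_of_row_empty fun x hx hmem => ?_
        have := h.step 0 hi
        exact h.not_insert hi hmem (by omega) (by simp only [zero_add] at *; omega) (by simp only [zero_add] at *; omega)
    · exact ((hβ i).2 hi h1).2.2.2 b hb hb'
  · obtain ⟨h₁, h₂, h₃, h₄⟩ := hα r (by omega)
    by_contra hne
    obtain ⟨a, ha⟩ := Nat.exists_eq_add_of_le' (show 1 ≤ α r by omega)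
    rw [ha] at h₁ h₂ h₃ hne
    have h₅ := h₄ a (by omega) (by omega)
    obtain ⟨y, hy, hyA⟩ := exists_mem_of_col_line (A := A) (i := a) (j := d (r + 1)) (by omega)
    have hy' : y ≠ d (r + 1) := fun e => by
      rw [e] at hyA
      exact hne (h.rook.row _ _ _ hyA (h.mem r (by omega)))
    have := h.step r (by omega)
    exact h.not_replace (i := r) (by omega) hyA (by omega) (fun _ => by omega) (by omega) (by omega)
  · by_contra! hne
    obtain ⟨h₁, h₂, h₃, h₄⟩ := hα i (by omega)
    obtain ⟨k₁, k₂, k₃, k₄⟩ := (hβ (i + 1)).2 (by omega) (by omega)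
    obtain ⟨a, ha⟩ := Nat.exists_eq_add_of_le' (show 1 ≤ α i by omega)
    obtain ⟨b, hb⟩ := Nat.exists_eq_add_of_le' (show 1 ≤ β (i + 1) by omega)
    rw [ha] at h₁ h₂ h₃ hne
    rw [hb] at k₁ k₂ k₃ hne
    have h₅ := h₄ a (by omega) (by omega)
    have k₅ := k₄ b (by omega) (by omega)
    obtain ⟨y, hy, hyA⟩ := exists_mem_of_col_line (A := A) (i := a) (j := d (i + 1)) (by omega)
    obtain ⟨x, hx, hxA⟩ := exists_mem_of_row_line (A := A) (i := c (i + 1)) (j := b) (by omega)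
    have hs₁ := h.step i (by omega)
    have hs₂ := h.step (i + 1) (by omega)
    have hy' : y ≠ d (i + 1) := fun e => by
      rw [e] at hyA
      exact hne.1 (h.rook.row _ _ _ hyA (h.mem i (by omega)))
    have hx' : x ≠ c (i + 1) := fun e => by
      rw [e] at hxA
      exact hne.2 (h.rook.col _ _ _ hxA (h.mem i (by omega)))
    have hya : y ≤ d (i + 2) := by
      by_contra! hlt
      exact h.not_replace (i := i) (by omega) hyA (by omega) (fun _ => by omega) (by omega)
        (fun _ => ⟨by simp only [add_assoc, Nat.reduceAdd] at *; omega, hlt⟩)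
    have hxb : x ≤ c i := by
      by_contra! hlt
      exact h.not_replace (i := i) (by omega) hxA hlt (fun _ => by omega) (by omega)
        (fun _ => ⟨by simp only [add_assoc, Nat.reduceAdd] at *; omega, by simp only [add_assoc, Nat.reduceAdd] at *; omega⟩)
    have hcol : ∀ y', y < y' → (a + 1, y') ∉ A := fun y' hlt hmem => by
      have := hA.col _ _ _ hyA hmem; omega
    have hrow : ∀ x', x < x' → (x', b + 1) ∉ A := fun x' hlt hmem => by
      have := hA.row _ _ _ hxA hmem; omega
    simp only [add_assoc, Nat.reduceAdd] at k₁ hs₂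
    have l₁ := col_line_down (A := A) (i := a) (j := b) (j' := d (i + 1)) (by omega)
      (fun y' _ _ => hcol y' (by omega)) (by omega)
    have l₂ := col_line_down (A := A) (i := a) (j := b + 1) (j' := d (i + 1)) (by omega)
      (fun y' _ _ => hcol y' (by omega)) (by omega)
    have l₃ := row_line_down (A := A) (i := a) (i' := c (i + 1)) (j := b) (by omega)
      (fun x' _ _ => hrow x' (by omega)) (by omega)
    have l₄ := lis_succ_of_notMem (hcol (b + 1) (by omega))
    omega

end shift

section corners

variable {A : Set Cell} {r : ℕ} {c d α β : ℕ → ℕ}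

/-- The union of the rectangles `[c i, α i) × [d (i + 1), β i)`, where moving the chain increases
`lis` by one. -/
def Zone (r : ℕ) (c d α β : ℕ → ℕ) (a b : ℕ) : Prop :=
  ∃ i < r + 1, c i ≤ a ∧ a < α i ∧ d (i + 1) ≤ b ∧ b < β i

namespace Corners

lemma eq_of_zone (h : Corners r A c d α β) {i a b : ℕ} (hi : i < r + 1) (h₁ : c i ≤ a)
    (h₂ : a < c (i + 1)) (hz : Zone r c d α β a b) : a < α i ∧ d (i + 1) ≤ b ∧ b < β i := by
  obtain ⟨j, hj, h₃, h₄, h₅⟩ := hz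
  have := h.α_lt j hj
  obtain rfl := h.shift.eq_of_c hi hj h₁ h₂ h₃ (by omega)
  exact ⟨h₄, h₅⟩

lemma eq_of_zone' (h : Corners r A c d α β) {i a b : ℕ} (hi : i < r + 1) (h₁ : d (i + 1) ≤ b)
    (h₂ : b < d i) (hz : Zone r c d α β a b) : c i ≤ a ∧ a < α i ∧ b < β i := by
  obtain ⟨j, hj, h₃, h₄, h₅, h₆⟩ := hz
  have := h.β_lt j hj
  obtain rfl := h.shift.eq_of_d hi hj h₁ h₂ h₅ (by omega)
  exact ⟨h₃, h₄, h₆⟩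

lemma not_zone_last (h : Corners r A c d α β) (b : ℕ) : ¬ Zone r c d α β (c (r + 1)) b := by
  rintro ⟨j, hj, h₃, h₄, h₅⟩
  have := h.α_lt j hj
  have := h.shift.le (i := j + 1) (j := r + 1) hj le_rfl
  omega

lemma lis_eq (h : Corners r A c d α β) {i a b : ℕ} (hi : i < r + 1) (h₁ : c i ≤ a)
    (h₂ : a < α i) (h₃ : d (i + 1) ≤ b) (h₄ : b < β i) :
    lis A a b = lis A (c i) (d (i + 1)) := by
  induction a, h₁ using Nat.le_induction generalizing b with
  | base => exact h.β_const i hi b h₃ h₄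
  | succ a h₁ iha =>
    induction b, h₃ using Nat.le_induction with
    | base => exact h.α_const i hi _ (by omega) h₂
    | succ b h₃ ihb =>
      rw [lis_succ_of_notMem, iha (by omega) (by omega) h₄, ihb (by omega), max_self]
      intro hmem
      have hα := h.α_lt i hi
      have hβ := h.β_lt i hi
      have := h.shift.eq_or_eq_of_mem hi hmem (by omega) (by omega) (by omega) (by omega)
      omega

lemma lis_slide (h : Corners r A c d α β) {a b : ℕ} (hb : b < d 0) :
    lis (slide (r + 1) A c d) a b = lis A a b + if Zone r c d α β a b then 1 else 0 := by
  have hS := h.shift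
  induction a generalizing b with
  | zero =>
    rw [lis_zero_left, lis_zero_left, if_neg]
    rintro ⟨i, hi, h₁, -⟩
    have := hS.one_le_c (i := i) (by omega)
    omega
  | succ a iha =>
  induction b with
  | zero =>
    rw [lis_zero_right, lis_zero_right, if_neg]
    rintro ⟨i, hi, -, -, h₁, -⟩
    have := hS.one_le_d (i := i + 1) (by omega)
    omega
  | succ b ihb =>
  have hsw := iha (b := b) (by omega)
  have hnw := iha hb
  have hse := ihb (by omega)
  clear iha ihb
  by_cases hnew : ∃ i < r + 1, (a + 1, b + 1) = (c i, d (i + 1))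
  · rw [lis_succ_of_mem (Or.inr hnew), hsw]
    obtain ⟨i, hi, he⟩ := hnew
    obtain ⟨hac, hbd⟩ := Prod.mk.inj he
    have hα := h.α_lt i hi
    have hβ := h.β_lt i hi
    rw [if_neg, if_pos ⟨i, hi, by omega⟩, hS.lis_col_eq hi.le hac (by omega),
      hS.lis_row_eq hi hbd (by omega)]
    rintro ⟨j, hj, h₁, h₂, h₃, h₄⟩
    have := h.β_lt j hj
    rcases lt_trichotomy i j with hij | rfl | hij
    · have := hS.lt hij (by omega); omega
    · omega
    · have := hS.le (i := j + 1) (j := i + 1) (by omega) (by omega); omega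
  by_cases hA : (a + 1, b + 1) ∈ A
  · by_cases hD : ∃ i < r + 1, (a + 1, b + 1) = (c (i + 1), d (i + 1))
    · have hB : (a + 1, b + 1) ∉ slide (r + 1) A c d := by
        rintro (⟨-, hB⟩ | hB)
        · obtain ⟨i, hi, he⟩ := hD; exact hB i hi he
        · exact hnew hB
      rw [lis_succ_of_notMem hB, hnw, hse, lis_succ_of_mem hA]
      obtain ⟨i, hi, he⟩ := hD
      obtain ⟨hac, hbd⟩ := Prod.mk.inj he
      have hα := h.α_lt i hi
      have hNE : ¬ Zone r c d α β (a + 1) (b + 1) := by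
        intro hz
        have := h.eq_of_zone' hi hbd.ge (by have := hS.step i hi; omega) hz
        omega
      have hz : Zone r c d α β a (b + 1) ∨ Zone r c d α β (a + 1) b := by
        have hor : α i = c (i + 1) ∨ i + 1 < r + 1 ∧ β (i + 1) = d (i + 1) := by
          by_cases hir : i = r
          · exact Or.inl (hir ▸ h.last)
          · exact (h.node i (by omega)).imp_right fun h => ⟨by omega, h⟩
        rcases hor with hor | ⟨hi', hor⟩
        · have := h.β_lt i hi
          exact Or.inl ⟨i, hi, by omega⟩
        · have := h.β_lt (i + 1) hi'
          have := h.α_lt (i + 1) hi'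
          exact Or.inr ⟨i + 1, hi', by omega⟩
      rw [hS.lis_row_eq hi hbd (by omega), hS.lis_col_eq (i := i + 1) (by omega) hac (by omega),
        if_neg hNE]
      rcases hz with hz | hz <;> rw [if_pos hz] <;> split_ifs <;> omega
    · have hB : (a + 1, b + 1) ∈ slide (r + 1) A c d :=
        Or.inl ⟨hA, fun i hi he => hD ⟨i, hi, he⟩⟩
      have hD' : ∀ i, i ≤ r + 1 → 0 < i → ¬ (a + 1 = c i ∧ b + 1 = d i) := by
        rintro i hi h1 ⟨h₁, h₂⟩
        obtain ⟨i, rfl⟩ := Nat.exists_eq_add_of_le' (show 1 ≤ i from h1)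
        exact hD ⟨i, by omega, by rw [h₁, h₂]⟩
      rw [lis_succ_of_mem hB, lis_succ_of_mem hA, hsw, if_neg, if_neg]
      · rintro ⟨i, hi, h₁, h₂, h₃, h₄⟩
        have hα := h.α_lt i hi
        have hβ := h.β_lt i hi
        have := hS.eq_or_eq_of_mem hi hA (by omega) (by omega) (by omega) (by omega)
        have := hD' i (by omega)
        have := hD' (i + 1) (by omega)
        omega
      · rintro ⟨i, hi, h₁, h₂, h₃, h₄⟩
        have hα := h.α_lt i hi
        have hβ := h.β_lt i hi
        have := hS.eq_or_eq_of_mem hi hA (by omega) (by omega) (by omega) (by omega)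
        have := hD' i (by omega)
        have := hD' (i + 1) (by omega)
        omega
  · have hB : (a + 1, b + 1) ∉ slide (r + 1) A c d := by
      rintro (⟨hB, -⟩ | hB)
      · exact hA hB
      · exact hnew hB
    have hstep := lis_step A a (b + 1)
    have hstep' := lis_step A (a + 1) b
    have hmax := lis_succ_of_notMem hA
    rw [lis_succ_of_notMem hB, hnw, hse]
    by_cases hz : Zone r c d α β (a + 1) (b + 1)
    · rw [if_pos hz]
      obtain ⟨i, hi, h₁, h₂, h₃, h₄⟩ := hz
      have he := h.lis_eq hi h₁ h₂ h₃ h₄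
      have hor : c i ≤ a ∨ d (i + 1) ≤ b := by
        by_contra! hlt
        exact hnew ⟨i, hi, Prod.ext (by simp only; omega) (by simp only; omega)⟩
      rcases hor with hor | hor
      · rw [if_pos (show Zone r c d α β a (b + 1) from ⟨i, hi, by omega⟩)]
        have := h.lis_eq (a := a) (b := b + 1) hi hor (by omega) h₃ h₄
        split_ifs <;> omega
      · rw [if_pos (show Zone r c d α β (a + 1) b from ⟨i, hi, by omega⟩)]
        have := h.lis_eq (a := a + 1) (b := b) hi h₁ h₂ hor (by omega)
        split_ifs <;> omega
    · rw [if_neg hz]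
      have k₁ : Zone r c d α β a (b + 1) → lis A a (b + 1) + 1 ≤ lis A (a + 1) (b + 1) := by
        rintro ⟨i, hi, h₁, h₂, h₃, h₄⟩
        have he : a + 1 = α i := by
          by_contra hne; exact hz ⟨i, hi, by omega⟩
        rw [h.lis_eq hi h₁ h₂ h₃ h₄, ← h.α_val i hi, he]
        exact lis_le_of_le le_rfl h₃
      have k₂ : Zone r c d α β (a + 1) b → lis A (a + 1) b + 1 ≤ lis A (a + 1) (b + 1) := by
        rintro ⟨i, hi, h₁, h₂, h₃, h₄⟩
        have he : b + 1 = β i := by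
          by_contra hne; exact hz ⟨i, hi, by omega⟩
        have hi0 : 0 < i := by
          by_contra h0
          have h0 : i = 0 := by omega
          rw [h0, h.first] at he; omega
        rw [h.lis_eq hi h₁ h₂ h₃ h₄, ← h.β_val i hi hi0, he]
        exact lis_le_of_le h₁ le_rfl
      split_ifs with hz₁ hz₂ hz₂
      · have := k₁ hz₁; have := k₂ hz₂; omega
      · have := k₁ hz₁; omega
      · have := k₂ hz₂; omega
      · omega

lemma mem_skel_slide (h : Corners r A c d α β) {a b : ℕ} (hb : b + 1 < d 0) :
    (a + 1, b + 1) ∈ skel (slide (r + 1) A c d) ↔ (a + 1, b + 1) ∈ slide r (skel A) α β := by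
  have hS := h.shift
  have hrhs : (a + 1, b + 1) ∈ slide r (skel A) α β ↔
      (((lis A a (b + 1) = lis A a b + 1 ∧ lis A (a + 1) b = lis A a b + 1) ∧
        ∀ i < r, ¬ (a + 1 = α (i + 1) ∧ b + 1 = β (i + 1))) ∨
        ∃ i < r, a + 1 = α i ∧ b + 1 = β (i + 1)) := by
    simp only [slide, Set.mem_ofPred_eq, mem_skel, ne_eq, Prod.mk.injEq]
  rw [hrhs, mem_skel, h.lis_slide hb, h.lis_slide (a := a) (b := b) (by omega),
    h.lis_slide (a := a + 1) (b := b) (by omega)]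
  have hsw := lis_step A a b
  by_cases z : Zone r c d α β a b
  · rw [if_pos z]
    obtain ⟨i, hi, h₁, h₂, h₃, h₄⟩ := z
    have hα := h.α_lt i hi
    have hβ := h.β_lt i hi
    have e := h.lis_eq hi h₁ h₂ h₃ h₄
    have e₁ : b + 1 < β i → lis A a (b + 1) = lis A a b := fun hlt => by
      rw [e, h.lis_eq hi h₁ h₂ (by omega) hlt]
    have e₂ : a + 1 < α i → lis A (a + 1) b = lis A a b := fun hlt => by
      rw [e, h.lis_eq hi (by omega) hlt h₃ h₄]
    refine iff_of_false ?_ ?_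
    · rintro ⟨h₅, -⟩
      split_ifs at h₅ with hz
      · have := h.eq_of_zone hi h₁ (by omega) hz
        have := e₁ this.2.2
        omega
      · omega
    · rintro (⟨⟨h₅, h₆⟩, h₇⟩ | ⟨j, hj, h₅, h₆⟩)
      · have hi0 : 0 < i := by
          by_contra h0
          have h0 : i = 0 := by omega
          have := h.first
          rw [h0] at e₁; omega
        have := h₇ (i - 1) (by omega)
        rw [Nat.sub_add_cancel hi0] at this
        omega
      · have hj' := h.α_lt j (by omega)
        obtain rfl := hS.eq_of_c (x := a) hi (by omega) h₁ (by omega)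
          (show c j ≤ a by omega) (by omega)
        have := h.β_lt (i + 1) (by omega)
        omega
  rw [if_neg z]
  by_cases z₁ : Zone r c d α β a (b + 1)
  · rw [if_pos z₁]
    obtain ⟨i, hi, h₁, h₂, h₃, h₄⟩ := z₁
    have hα := h.α_lt i hi
    have hβ := h.β_lt i hi
    have hbd : b + 1 = d (i + 1) := by
      by_contra hne; exact z ⟨i, hi, by omega⟩
    have e := h.lis_eq hi h₁ h₂ h₃ h₄
    have e₁ := hS.lis_row_eq hi hbd (x := a) (by omega)
    have hmono : lis A (a + 1) b ≤ lis A (a + 1) (b + 1) := lis_le_of_le le_rfl (by omega)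
    have hidx : ∀ j < r, a + 1 = α j → j = i := fun j hj he => by
      have := h.α_lt j (by omega)
      exact hS.eq_of_c (x := a) (by omega) hi (by omega) (by omega) h₁ (by omega)
    by_cases ha : a + 1 = α i
    · by_cases hac : α i = c (i + 1)
      · have e₂ := hS.lis_col_eq (i := i + 1) (x := a) (y := b) (by omega) (by omega) (by omega)
        have hz : Zone r c d α β (a + 1) b ↔ i < r ∧ β (i + 1) = d (i + 1) := by
          constructor
          · intro hz
            have hir : i ≠ r := by
              rintro rfl
              rw [ha, hac] at hz
              exact h.not_zone_last _ hz
            have := hS.step (i + 1) (by omega)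
            have := h.eq_of_zone (i := i + 1) (by omega) (by omega) (by omega) hz
            have := h.β_lt (i + 1) (by omega)
            exact ⟨by omega, by omega⟩
          · rintro ⟨hir, he⟩
            have := h.α_lt (i + 1) (by omega)
            have := h.β_lt (i + 1) (by omega)
            exact ⟨i + 1, by omega, by omega⟩
        constructor
        · rintro ⟨-, h₅⟩
          right
          have : Zone r c d α β (a + 1) b := by
            by_contra hn; rw [if_neg hn] at h₅; omega
          have := hz.1 this
          exact ⟨i, this.1, ha, by omega⟩
        · rintro (⟨⟨h₅, -⟩, -⟩ | ⟨j, hj, h₅, h₆⟩)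
          · omega
          · obtain rfl := hidx j hj h₅
            rcases h.node j hj with hn | hn
            · have : Zone r c d α β (a + 1) b := by
                by_contra hn'
                have := h.β_lt (j + 1) (by omega)
                exact hn' (hz.2 ⟨hj, by omega⟩)
              rw [if_pos this]; omega
            · rw [if_pos (hz.2 ⟨hj, hn⟩)]; omega
      · have hir : i < r := by
          by_contra hn
          obtain rfl : i = r := by omega
          exact hac h.last
        have hn := (h.node i hir).resolve_left hac
        have hA : (a + 1, b + 1) ∉ A := fun hm => by
          rw [hbd] at hm
          have := hS.rook.row _ _ _ hm (hS.mem i hi)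
          omega
        have e₂ := lis_succ_of_notMem hA
        have e₃ := h.α_val i hi
        rw [← ha, ← hbd] at e₃
        rw [← hbd] at e
        have hz : ¬ Zone r c d α β (a + 1) b := fun hz => by
          have := h.eq_of_zone hi (by omega) (by omega) hz
          omega
        rw [if_neg hz]
        exact iff_of_true (by omega) (Or.inr ⟨i, hir, ha, by omega⟩)
    · have e₂ := h.lis_eq (a := a + 1) (b := b + 1) hi (by omega) (by omega) h₃ h₄
      have hz : ¬ Zone r c d α β (a + 1) b := fun hz => by
        have := h.eq_of_zone hi (by omega) (by omega) hz
        omega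
      rw [if_neg hz]
      refine iff_of_false (by omega) ?_
      rintro (⟨⟨h₅, -⟩, -⟩ | ⟨j, hj, h₅, h₆⟩)
      · omega
      · obtain rfl := hidx j hj h₅
        exact ha h₅
  rw [if_neg z₁]
  by_cases z₂ : Zone r c d α β (a + 1) b
  · rw [if_pos z₂]
    obtain ⟨i, hi, h₁, h₂, h₃, h₄⟩ := z₂
    have hα := h.α_lt i hi
    have hβ := h.β_lt i hi
    have hac : a + 1 = c i := by
      by_contra hne; exact z ⟨i, hi, by omega⟩
    have e := h.lis_eq hi h₁ h₂ h₃ h₄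
    have e₁ := hS.lis_col_eq hi.le hac (y := b) (by omega)
    have hidx : ∀ j < r, a + 1 = α j → i = j + 1 := fun j hj he => by
      have := h.α_lt j (by omega)
      exact hS.eq_of_c (x := a + 1) hi (by omega) (by omega) (by omega)
        (show c (j + 1) ≤ a + 1 by
          rcases lt_trichotomy i (j + 1) with hij | rfl | hij
          · have := hS.le (i := i) (j := j) (by omega) (by omega); omega
          · omega
          · have := hS.le (i := j + 1) (j := i) (by omega) (by omega); omega)
        (by have := hS.step (j + 1) (by omega); omega)
    by_cases hbβ : b + 1 = β i
    · have hi0 : 0 < i := by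
        by_contra h0
        have h0 : i = 0 := by omega
        have := h.first
        rw [h0] at hbβ; omega
      obtain ⟨j, rfl⟩ := Nat.exists_eq_add_of_le' (show 1 ≤ i from hi0)
      have hval := h.β_val (j + 1) hi hi0
      by_cases hβd : β (j + 1) = d (j + 1)
      · have e₂ := hS.lis_row_eq (i := j) (x := a) (y := b) (by omega) (by omega) (by omega)
        refine iff_of_false (by omega) ?_
        rintro (⟨⟨h₅, -⟩, -⟩ | ⟨l, hl, h₅, h₆⟩)
        · omega
        · obtain rfl : j = l := by have := hidx l hl h₅; omega
          have := h.α_lt j (by omega)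
          have := h.β_lt j (by omega)
          exact z₁ ⟨j, by omega, by omega⟩
      · have hn := (h.node j (by omega)).resolve_right hβd
        have hA : (a + 1, b + 1) ∉ A := fun hm => by
          rw [hac] at hm
          have := hS.rook.col _ _ _ hm (hS.mem j (by omega))
          omega
        have e₂ := lis_succ_of_notMem hA
        rw [← hac, ← hbβ] at hval
        rw [← hac] at e
        exact iff_of_true (by omega) (Or.inr ⟨j, by omega, by omega, by omega⟩)
    · have e₂ := h.lis_eq (a := a + 1) (b := b + 1) hi (by omega) (by omega) (by omega) (by omega)
      have hmono : lis A a (b + 1) ≤ lis A (a + 1) (b + 1) := lis_le_of_le (by omega) le_rfl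
      refine iff_of_false (by omega) ?_
      rintro (⟨⟨h₅, -⟩, -⟩ | ⟨j, hj, h₅, h₆⟩)
      · omega
      · obtain rfl := hidx j hj h₅
        exact hbβ h₆
  rw [if_neg z₂]
  have hrem : ∀ i < r, ¬ (a + 1 = α (i + 1) ∧ b + 1 = β (i + 1)) := fun i hi he => by
    have := h.α_lt (i + 1) (by omega)
    have := h.β_lt (i + 1) (by omega)
    exact z ⟨i + 1, by omega, by omega⟩
  have hadd : ¬ ∃ i < r, a + 1 = α i ∧ b + 1 = β (i + 1) := by
    rintro ⟨i, hi, he⟩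
    have := h.α_lt i (by omega)
    have := h.β_lt i (by omega)
    have := h.α_lt (i + 1) (by omega)
    have := h.β_lt (i + 1) (by omega)
    rcases h.node i hi with hn | hn
    · exact z₂ ⟨i + 1, by omega, by omega⟩
    · exact z₁ ⟨i, by omega, by omega⟩
  simp only [add_zero]
  exact ⟨fun he => Or.inl ⟨he, hrem⟩, fun he => (he.resolve_right hadd).1⟩

end Corners

end corners

section core

variable {A : Set Cell} {r : ℕ} {c d α β : ℕ → ℕ}

namespace Corners

lemma not_mem_skel_first (h : Corners r A c d α β) (y : ℕ) : (α 0, y) ∉ skel A := by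
  intro hs
  have hS := h.shift
  have hα := h.α_lt 0 (by omega)
  obtain ⟨x, hx, hxA⟩ := exists_row_of_mem_skel hs
  simp only [zero_add] at hα
  rcases lt_or_ge (d 1) y with hy | hy
  · exact hS.not_insert (i := 0) (by omega) hxA (by omega) (by simp only [zero_add]; omega) hy
  obtain ⟨y', hy', hyA⟩ := exists_col_of_mem_skel hs
  obtain ⟨i, j, hi, rfl⟩ := skel_pos hs
  have hv := h.α_val 0 (by omega)
  have hc := h.α_const 0 (by omega) i (by omega) (by omega)
  rw [hi] at hs hyA hv
  have hcol : ∀ y, y' < y → (i + 1, y) ∉ A := fun y hlt hmem => by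
    have := h.shift.rook.col _ _ _ hyA hmem; omega
  have := col_line_down (A := A) (i := i) (j := j + 1) (j' := d 1) hy
    (fun y _ _ => hcol y (by omega)) (by rw [hv, hc])
  rw [lis_succ_of_notMem (hcol _ (by omega))] at this
  rw [mem_skel] at hs
  omega

lemma mem_skel (h : Corners r A c d α β) {i : ℕ} (hi : i < r) :
    (α (i + 1), β (i + 1)) ∈ skel A := by
  have hα := h.α_lt (i + 1) (by omega)
  have hβ := h.β_lt (i + 1) (by omega)
  have hαv := h.α_val (i + 1) (by omega)
  have hβv := h.β_val (i + 1) (by omega) (by omega)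
  obtain ⟨a, ha⟩ := Nat.exists_eq_add_of_le' (show 1 ≤ α (i + 1) by omega)
  obtain ⟨b, hb⟩ := Nat.exists_eq_add_of_le' (show 1 ≤ β (i + 1) by omega)
  have e := h.lis_eq (i := i + 1) (a := a) (b := b) (by omega) (by omega) (by omega) (by omega)
    (by omega)
  rw [ha, hb, _root_.mem_skel]
  rw [ha] at hαv
  rw [hb] at hβv
  have h₁ : lis A (a + 1) (d (i + 1 + 1)) ≤ lis A (a + 1) b := lis_le_of_le le_rfl (by omega)
  have h₂ : lis A (c (i + 1)) (b + 1) ≤ lis A a (b + 1) := lis_le_of_le (by omega) le_rfl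
  have := lis_step A a b
  omega

lemma shift_skel (h : Corners r A c d α β) : Shift r (skel A) α β := by
  have hS := h.shift
  have hA := hS.rook
  have hno : ∀ x y, ¬ Chain (skel A) (r + 1) x y := fun x y hc => by
    obtain ⟨u, v, huv, -⟩ := hA.exists_lift_chain (by omega) hc
    exact hS.no_chain u v huv
  have hstep : ∀ i < r, α i < α (i + 1) ∧ β (i + 1) < β i := fun i hi => by
    have := h.α_lt i (by omega)
    have := h.β_lt i (by omega)
    have := h.α_lt (i + 1) (by omega)
    have := h.β_lt (i + 1) (by omega)
    omega
  refine ⟨hA.rook_skel, fun x y hs => ?_, ⟨?_, ?_⟩, h.not_mem_skel_first, hstep,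
    fun i hi => h.mem_skel hi, hno, fun x y hxy hlt i hi => ?_⟩
  · obtain ⟨y', -, h₁⟩ := exists_col_of_mem_skel hs
    obtain ⟨x', -, h₂⟩ := exists_row_of_mem_skel hs
    rw [h.last, h.first]
    exact ⟨(hS.bound _ _ h₁).1, (hS.bound _ _ h₂).2⟩
  · have := h.α_lt 0 (by omega); omega
  · have := h.β_lt r (by omega); omega
  have hD : Chain (skel A) r (fun j => α (j + 1)) fun j => β (j + 1) :=
    ⟨fun j hj => h.mem_skel hj, fun j hj => hstep (j + 1) hj⟩
  have hcomp₁ : ¬ (x i < α (i + 1) ∧ β (i + 1) < y i) := fun ⟨h₁, h₂⟩ => by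
    have := hxy.splice hD (m := i + 1) (l := i) (by omega) hi h₁ h₂
    rw [show i + 1 + (r - i) = r + 1 by omega] at this
    exact hno _ _ this
  have hcomp₂ : ¬ (α (i + 1) < x i ∧ y i < β (i + 1)) := fun ⟨h₁, h₂⟩ => by
    have := hD.splice hxy (m := i + 1) (l := i) (by omega) hi h₁ h₂
    rw [show i + 1 + (r - i) = r + 1 by omega] at this
    exact hno _ _ this
  have hα0 := h.α_lt 0 (by omega)
  have hne : ∃ b, (α 0, b) ∈ A := by
    obtain ⟨a, ha⟩ := Nat.exists_eq_add_of_le' (show 1 ≤ α 0 by omega)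
    have h₁ := h.α_val 0 (by omega)
    have h₂ := h.α_const 0 (by omega) a (by omega) (by omega)
    rw [ha] at h₁ ⊢
    obtain ⟨y, -, hy⟩ := exists_mem_of_col_line (A := A) (i := a) (j := d (0 + 1)) (by omega)
    exact ⟨y, hy⟩
  obtain ⟨m, n, hmn, h₁, h₂, h₃⟩ := hA.exists_of_gap (hxy.1 0 (by omega)) (hlt (by omega)) hne
    fun b _ => h.not_mem_skel_first b
  obtain ⟨u, v, huv, hu0, -, h₄, h₅, -⟩ := hA.lift_chain (by omega) hxy hmn h₂ h₃
  have hmin := hS.minimal u v huv (fun _ => by omega)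
  have hxc : c (i + 1) < x i := (hmin i (by omega)).1.trans_lt (h₄ i hi).1
  have hyd : d (i + 1 + 1) < y i := (hmin (i + 1) (by omega)).2.trans_lt (h₅ i hi).2
  have hα := h.α_lt (i + 1) (by omega)
  have hβ := h.β_lt (i + 1) (by omega)
  have hxα : α (i + 1) ≤ x i := by
    by_contra! hlt
    have hs := hxy.1 i hi
    obtain ⟨y', hy', hyA⟩ := exists_col_of_mem_skel hs
    obtain ⟨a, b, ha, hb⟩ := skel_pos hs
    rw [ha, hb] at hs
    have hyd' : d (i + 1 + 1) < y' := by
      by_contra! hle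
      have e₁ := h.α_const (i + 1) (by omega) a (by omega) (by omega)
      have e₂ := h.α_const (i + 1) (by omega) (a + 1) (by omega) (by omega)
      have := col_line_down (A := A) (i := a) (j := d (i + 1 + 1)) (j' := b) (by omega)
        (fun y _ _ hy => by
          have := hA.col _ _ _ hyA (ha ▸ hy); omega) (_root_.mem_skel.1 hs).2
      omega
    have : d (i + 1) < y' := by
      by_contra! hle
      have := hS.eq_or_eq_of_mem (i := i + 1) (by omega) hyA (by omega) (by omega) (by omega) hle
      omega
    omega
  refine ⟨hxα, ?_⟩
  by_contra! hlt
  have hs := hxy.1 i hi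
  obtain ⟨x', hx', hxA⟩ := exists_row_of_mem_skel hs
  obtain ⟨a, b, ha, hb⟩ := skel_pos hs
  rw [ha, hb] at hs
  have hxc' : c (i + 1) < x' := by
    by_contra! hle
    have e₁ := h.β_const (i + 1) (by omega) b (by omega) (by omega)
    have e₂ := h.β_const (i + 1) (by omega) (b + 1) (by omega) (by omega)
    have := row_line_down (A := A) (i := c (i + 1)) (i' := a) (j := b) (by omega)
      (fun x _ _ hx => by
        have := hA.row _ _ _ hxA (hb ▸ hx); omega) (_root_.mem_skel.1 hs).1
    omega
  have : c (i + 1 + 1) < x' := by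
    by_contra! hle
    have := hS.eq_or_eq_of_mem (i := i + 1) (by omega) hxA (by omega) hle (by omega) (by omega)
    omega
  omega

end Corners

/-- Moving the chain does not change the shapes along the right border. -/
theorem Shift.skelShape_slide (h : Shift r A c d) {b : ℕ} (hb : b < d 0) :
    skelShape (slide r A c d) (c r) b = skelShape A (c r) b := by
  induction r generalizing A c d with
  | zero =>
    have : slide 0 A c d = A := by ext p; simp [slide]
    rw [this]
  | succ r ih =>
    obtain ⟨α, β, hC⟩ := h.exists_corners
    ext n
    rcases n with _ | n
    · rw [skelShape_zero, skelShape_zero, hC.lis_slide hb, if_neg (hC.not_zone_last b), add_zero]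
    · rw [skelShape_succ, skelShape_succ]
      have := ih hC.shift_skel (by rw [hC.first]; exact hb)
      rw [hC.last] at this
      rw [← this]
      refine congrFun (skelShape_congr fun x y hx _ hy hyb => ?_) n
      obtain ⟨x, rfl⟩ := Nat.exists_eq_add_of_le' hx
      obtain ⟨y, rfl⟩ := Nat.exists_eq_add_of_le' hy
      exact hC.mem_skel_slide (by omega)

/-- The line through the last cell of the chain reaches the upper border in the `r`-th diagram. -/
theorem Shift.skelShape_ne (h : Shift (r + 1) A c d) {a b : ℕ} (ha : a + 1 = c (r + 1))
    (hb : b + 1 = d 0) : skelShape A (a + 1) b r ≠ skelShape A a b r := by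
  induction r generalizing A c d with
  | zero =>
    obtain ⟨α, β, hC⟩ := h.exists_corners
    have hl := hC.last
    have hs := h.step 0 (by omega)
    have e₁ := hC.α_val 0 (by omega)
    have e₂ := hC.α_const 0 (by omega) a (by simp only [zero_add] at *; omega) (by omega)
    simp only [zero_add] at *
    rw [hl, ← ha] at e₁
    have := col_line_up (A := A) (i := a) (j := d 1) (j' := b) (by omega)
      (fun y _ _ hy => by
        rw [ha] at hy
        have := h.rook.col _ _ _ hy (h.mem 0 (by omega))
        simp only [zero_add] at this
        omega)
      (fun y _ _ hy => hC.shift_skel.no_chain (fun _ => a + 1) (fun _ => y)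
        ⟨fun _ _ => hy, by omega⟩) (by omega)
    rw [skelShape_zero, skelShape_zero]
    omega
  | succ r ih =>
    obtain ⟨α, β, hC⟩ := h.exists_corners
    exact ih hC.shift_skel (by rw [hC.last, ha]) (by rw [hC.first, hb])

end core

section turn

variable {P : Set Cell} {r : ℕ} {c d : ℕ → ℕ}

/-- The cells `(c i, d i)`, `i ≤ r`, form the value-smallest chain of length `r + 1` of `P` in the
rectangle spanned by the corner `(c r, d 0)`. -/
structure MinChain (r : ℕ) (P : Set Cell) (c d : ℕ → ℕ) : Prop where
  rook : Rook P
  chain : Chain P (r + 1) c d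
  le_first : ∀ x y, Chain P (r + 1) x y → x r ≤ c r → d 0 ≤ y 0
  minimal : ∀ x y, Chain P (r + 1) x y → x r ≤ c r → y 0 = d 0 →
    ∀ i ≤ r, c i ≤ x i ∧ d i ≤ y i

/-- The result of moving the cells `(c i, d i)` to `(c i, d (i + 1))` cyclically. -/
def turn (r : ℕ) (P : Set Cell) (c d : ℕ → ℕ) : Set Cell :=
  {p | (p ∈ P ∧ ∀ i ≤ r, p ≠ (c i, d i)) ∨ (∃ i < r, p = (c i, d (i + 1))) ∨ p = (c r, d 0)}

lemma Chain.reverse {s : ℕ} {x y : ℕ → ℕ} (h : Chain (Prod.swap ⁻¹' P) (s + 1) x y) :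
    Chain P (s + 1) (fun j => y (s - j)) fun j => x (s - j) := by
  refine ⟨fun j hj => h.1 (s - j) (by omega), fun j hj => ?_⟩
  have := h.2 (s - (j + 1)) (by omega)
  rw [show s - (j + 1) + 1 = s - j by omega] at this
  exact this.symm

lemma Rook.lis_pos (hP : Rook P) {x y a b : ℕ} (h : (x, y) ∈ P) (hx : x ≤ a) (hy : y ≤ b) :
    0 < lis P a b := by
  obtain ⟨i, rfl⟩ := Nat.exists_eq_add_of_le' (hP.pos _ _ h).1
  obtain ⟨j, rfl⟩ := Nat.exists_eq_add_of_le' (hP.pos _ _ h).2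
  have := lis_succ_of_mem h
  have := lis_le_of_le (A := P) hx hy
  omega

lemma Rook.skelShape_pos_of_le (hP : Rook P) {a b m n : ℕ} (hnm : n ≤ m)
    (h : 0 < skelShape P a b m) : 0 < skelShape P a b n := by
  obtain ⟨x, y, hx, hy, hxy⟩ := exists_mem_of_lis_pos h
  obtain ⟨l, rfl⟩ := Nat.exists_eq_add_of_le hnm
  obtain ⟨y', hy', hxy'⟩ := exists_col_of_mem_iterate_skel hxy
  exact (hP.iterate_skel n).lis_pos hxy' hx (by omega)

namespace MinChain

lemma shift (h : MinChain r P c d) :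
    Shift r {p ∈ P | p.1 ≤ c r ∧ p.2 < d 0} c d where
  rook := ⟨fun x y hxy => h.rook.pos x y hxy.1, fun _ _ _ h₁ h₂ => h.rook.col _ _ _ h₁.1 h₂.1,
    fun _ _ _ h₁ h₂ => h.rook.row _ _ _ h₁.1 h₂.1⟩
  bound _ _ hxy := hxy.2
  one_le := ⟨(h.rook.pos _ _ (h.chain.1 0 (by omega))).1,
    (h.rook.pos _ _ (h.chain.1 r (by omega))).2⟩
  col_empty y hy := by
    have h₁ := h.rook.col _ _ _ hy.1 (h.chain.1 0 (by omega))
    have h₂ : y < d 0 := hy.2.2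
    omega
  step i hi := h.chain.2 i (by omega)
  mem i hi := ⟨h.chain.1 (i + 1) (by omega), (h.chain.le (show i + 1 ≤ r by omega) (by omega)).1,
    (h.chain.lt (show 0 < i + 1 by omega) (by omega)).2⟩
  no_chain x y hxy := by
    have h₁ := h.le_first x y (hxy.mono fun _ _ hm => hm.1) (hxy.1 r (by omega)).2.1
    have h₂ : y 0 < d 0 := (hxy.1 0 (by omega)).2.2
    omega
  minimal x y hxy hlt i hi := by
    have hxy' : Chain P r x y := hxy.mono fun _ _ hm => hm.1
    have h₀ : y 0 < d 0 := (hxy.1 0 (by omega)).2.2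
    have hr : x (r - 1) ≤ c r := (hxy.1 (r - 1) (by omega)).2.1
    have := h.minimal _ _ (hxy'.cons (h.chain.1 0 (by omega)) fun h0 => ⟨hlt h0, h₀⟩)
      (by simpa [show r ≠ 0 by omega] using hr) (by simp) (i + 1) (by omega)
    simpa using this

lemma shift_swap (h : MinChain r P c d) :
    Shift r (Prod.swap ⁻¹' {p ∈ P | p.1 < c r ∧ p.2 ≤ d 0}) (fun i => d (r - i))
      fun i => c (r - i) where
  rook := ⟨fun x y hxy => (h.rook.pos y x hxy.1).symm,
    fun _ _ _ h₁ h₂ => h.rook.row _ _ _ h₁.1 h₂.1, fun _ _ _ h₁ h₂ => h.rook.col _ _ _ h₁.1 h₂.1⟩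
  bound x y hxy := by
    simp only [Nat.sub_self, Nat.sub_zero]
    exact ⟨hxy.2.2, hxy.2.1⟩
  one_le := by
    simp only [Nat.sub_self, Nat.sub_zero]
    exact ⟨(h.rook.pos _ _ (h.chain.1 r (by omega))).2,
      (h.rook.pos _ _ (h.chain.1 0 (by omega))).1⟩
  col_empty y hy := by
    have h₁ := h.rook.row _ _ _ hy.1 (h.chain.1 r (by omega))
    have h₂ : y < c r := hy.2.1
    omega
  step i hi := by
    have := h.chain.2 (r - (i + 1)) (by omega)
    rw [show r - (i + 1) + 1 = r - i by omega] at this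
    exact this.symm
  mem i hi := ⟨h.chain.1 (r - (i + 1)) (by omega),
    (h.chain.lt (show r - (i + 1) < r by omega) (by omega)).1,
    (h.chain.le (Nat.zero_le _) (show r - (i + 1) < r + 1 by omega)).2⟩
  no_chain x y hxy := by
    have hxy' : Chain (Prod.swap ⁻¹' P) (r + 1) x y := hxy.mono fun _ _ hm => hm.1
    have h₁ : y 0 < c r := (hxy.1 0 (by omega)).2.1
    have h₂ : x r ≤ d 0 := (hxy.1 r (by omega)).2.2
    have h₃ := h.le_first _ _ hxy'.reverse (by simpa using h₁.le)
    have h₄ := h.minimal _ _ hxy'.reverse (by simpa using h₁.le) (by simp only [Nat.sub_zero] at *; omega) r le_rfl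
    simp only [Nat.sub_self] at h₄
    omega
  minimal x y hxy hlt i hi := by
    obtain ⟨r, rfl⟩ := Nat.exists_eq_add_of_le' (show 1 ≤ r by omega)
    have hxy' : Chain (Prod.swap ⁻¹' P) (r + 1) x y := hxy.mono fun _ _ hm => hm.1
    have h₁ : y 0 < c (r + 1) := (hxy.1 0 (by omega)).2.1
    have h₂ : x r ≤ d 0 := (hxy.1 r (by omega)).2.2
    have h₅ := hlt (by omega)
    have hch := hxy'.reverse.snoc (h.chain.1 (r + 1) (by omega)) fun _ => by
      simpa using ⟨h₁, h₅⟩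
    have h₃ := h.le_first _ _ hch (by simp)
    simp only [Nat.zero_lt_succ, if_true, Nat.sub_zero] at h₃
    have h₄ := h.minimal _ _ hch (by simp) (by simp only [Nat.zero_lt_succ, if_true, Nat.sub_zero]; omega)
      (r - i) (by omega)
    simp only [if_pos (show r - i < r + 1 by omega), show r - (r - i) = i by omega] at h₄
    rw [show r + 1 - (i + 1) = r - i by omega]
    exact h₄.symm

lemma mem_turn_iff (h : MinChain r P c d) {x y : ℕ} (hxy : c r < x ∨ d 0 < y) :
    (x, y) ∈ turn r P c d ↔ (x, y) ∈ P := by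
  have hle : ∀ i ≤ r, c i ≤ c r ∧ d i ≤ d 0 := fun i hi =>
    ⟨(h.chain.le hi (by omega)).1, (h.chain.le (Nat.zero_le i) (by omega)).2⟩
  constructor
  · rintro (⟨h₁, -⟩ | ⟨i, hi, he⟩ | he)
    · exact h₁
    · obtain ⟨rfl, rfl⟩ := Prod.mk.inj he
      have := hle i (by omega)
      have := hle (i + 1) (by omega)
      omega
    · obtain ⟨rfl, rfl⟩ := Prod.mk.inj he
      omega
  · refine fun hm => Or.inl ⟨hm, fun i hi he => ?_⟩
    obtain ⟨rfl, rfl⟩ := Prod.mk.inj he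
    have := hle i hi
    omega

lemma rook_turn (h : MinChain r P c d) : Rook (turn r P c d) := by
  have hne : ∀ i ≤ r, ∀ j ≤ r, c i = c j ∨ d i = d j → i = j := by
    intro i hi j hj he
    rcases lt_trichotomy i j with hij | hij | hij
    · have := h.chain.lt hij (by omega); omega
    · exact hij
    · have := h.chain.lt hij (by omega); omega
  have hshape : ∀ x y, (x, y) ∈ turn r P c d → ((x, y) ∈ P ∧ ∀ i ≤ r, x ≠ c i ∧ y ≠ d i) ∨
      ∃ i ≤ r, ∃ j ≤ r, x = c i ∧ y = d j ∧ ((i < r ∧ j = i + 1) ∨ (i = r ∧ j = 0)) := by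
    rintro x y (⟨h₁, h₂⟩ | ⟨i, hi, he⟩ | he)
    · refine Or.inl ⟨h₁, fun i hi => ⟨?_, ?_⟩⟩
      · rintro rfl
        exact h₂ i hi (by rw [h.rook.col _ _ _ h₁ (h.chain.1 i (by omega))])
      · rintro rfl
        exact h₂ i hi (by rw [h.rook.row _ _ _ h₁ (h.chain.1 i (by omega))])
    · obtain ⟨rfl, rfl⟩ := Prod.mk.inj he
      exact Or.inr ⟨i, hi.le, i + 1, hi, rfl, rfl, Or.inl ⟨hi, rfl⟩⟩
    · obtain ⟨rfl, rfl⟩ := Prod.mk.inj he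
      exact Or.inr ⟨r, le_rfl, 0, Nat.zero_le r, rfl, rfl, Or.inr ⟨rfl, rfl⟩⟩
  refine ⟨fun x y hxy => ?_, fun x y y' h₁ h₂ => ?_, fun x x' y h₁ h₂ => ?_⟩
  · rcases hshape x y hxy with ⟨h₁, -⟩ | ⟨i, hi, j, hj, rfl, rfl, -⟩
    · exact h.rook.pos _ _ h₁
    · exact ⟨(h.rook.pos _ _ (h.chain.1 i (by omega))).1,
        (h.rook.pos _ _ (h.chain.1 j (by omega))).2⟩
  · rcases hshape _ _ h₁ with ⟨h₁, k₁⟩ | ⟨i, hi, j, hj, rfl, rfl, hij⟩ <;>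
      rcases hshape _ _ h₂ with ⟨h₂, k₂⟩ | ⟨i', hi', j', hj', he, rfl, hij'⟩
    · exact h.rook.col _ _ _ h₁ h₂
    · exact ((k₁ i' hi').1 he).elim
    · exact ((k₂ i hi).1 rfl).elim
    · have := hne i hi i' hi' (Or.inl he)
      rw [show j = j' by omega]
  · rcases hshape _ _ h₁ with ⟨h₁, k₁⟩ | ⟨i, hi, j, hj, rfl, rfl, hij⟩ <;>
      rcases hshape _ _ h₂ with ⟨h₂, k₂⟩ | ⟨i', hi', j', hj', rfl, he, hij'⟩
    · exact h.rook.row _ _ _ h₁ h₂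
    · exact ((k₁ j' hj').2 he).elim
    · exact ((k₂ j hj).2 rfl).elim
    · have := hne j hj j' hj' (Or.inr he)
      rw [show i = i' by omega]

lemma skelShape_right (h : MinChain r P c d) {b : ℕ} (hb : b < d 0) :
    skelShape (turn r P c d) (c r) b = skelShape P (c r) b := by
  calc skelShape (turn r P c d) (c r) b
      = skelShape (slide r {p ∈ P | p.1 ≤ c r ∧ p.2 < d 0} c d) (c r) b := by
        refine skelShape_congr fun x y _ hx _ hy => ⟨?_, ?_⟩
        · rintro (⟨h₁, h₂⟩ | h₁ | he)
          · exact Or.inl ⟨⟨h₁, hx, by omega⟩, fun i hi => h₂ (i + 1) hi⟩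
          · exact Or.inr h₁
          · obtain ⟨rfl, rfl⟩ := Prod.mk.inj he
            omega
        · rintro (⟨⟨h₁, -⟩, h₂⟩ | h₁)
          · refine Or.inl ⟨h₁, fun i hi he => ?_⟩
            rcases i with _ | i
            · have := (Prod.mk.inj he).2; omega
            · exact h₂ i hi he
          · exact Or.inr (Or.inl h₁)
    _ = skelShape {p ∈ P | p.1 ≤ c r ∧ p.2 < d 0} (c r) b := h.shift.skelShape_slide hb
    _ = skelShape P (c r) b :=
        skelShape_congr fun x y _ hx _ hy => ⟨fun h => h.1, fun h => ⟨h, hx, by omega⟩⟩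

lemma skelShape_up (h : MinChain r P c d) {a : ℕ} (ha : a < c r) :
    skelShape (turn r P c d) a (d 0) = skelShape P a (d 0) := by
  have key := h.shift_swap.skelShape_slide (b := a) (by simpa using ha)
  simp only [Nat.sub_self] at key
  calc skelShape (turn r P c d) a (d 0)
      = skelShape (Prod.swap ⁻¹' turn r P c d) (d 0) a := (skelShape_swap _ _ _).symm
    _ = _ := by
        refine skelShape_congr fun x y _ hx _ hy => ⟨?_, ?_⟩
        · rintro (⟨h₁, h₂⟩ | ⟨i, hi, he⟩ | he)
          · refine Or.inl ⟨⟨h₁, by simp only [Prod.swap_prod_mk]; omega, hx⟩, fun i hi he => h₂ (r - (i + 1)) (by omega) ?_⟩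
            rw [he]; rfl
          · obtain ⟨rfl, rfl⟩ := Prod.mk.inj he
            refine Or.inr ⟨r - (i + 1), by omega, ?_⟩
            simp only [Prod.mk.injEq]
            exact ⟨congrArg d (by omega), congrArg c (by omega)⟩
          · obtain ⟨rfl, rfl⟩ := Prod.mk.inj he
            omega
        · rintro (⟨⟨h₁, -⟩, h₂⟩ | ⟨i, hi, he⟩)
          · refine Or.inl ⟨h₁, fun i hi he => ?_⟩
            obtain ⟨rfl, rfl⟩ := Prod.mk.inj he
            have : i ≠ r := by rintro rfl; omega
            refine h₂ (r - (i + 1)) (by omega) ?_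
            simp only [Prod.mk.injEq]
            exact ⟨congrArg d (by omega), congrArg c (by omega)⟩
          · obtain ⟨rfl, rfl⟩ := Prod.mk.inj he
            refine Or.inr (Or.inl ⟨r - (i + 1), by omega, ?_⟩)
            simp only [Prod.swap_prod_mk, Prod.mk.injEq, true_and]
            exact congrArg d (by omega)
    _ = _ := key
    _ = skelShape {p ∈ P | p.1 < c r ∧ p.2 ≤ d 0} a (d 0) := skelShape_swap _ _ _
    _ = skelShape P a (d 0) :=
        skelShape_congr fun x y _ hx _ hy => ⟨fun h => h.1, fun h => ⟨h, by simp only; omega, hy⟩⟩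

lemma skelShape_right_eq_zero (h : MinChain r P c d) {b : ℕ} (hb : b < d 0) :
    skelShape P (c r) b r = 0 := by
  by_contra hne
  obtain ⟨u, v, huv, h₁, h₂⟩ := h.rook.exists_chain_of_skelShape_pos (Nat.pos_of_ne_zero hne)
  have := h.le_first u v huv h₂
  omega

lemma skelShape_up_eq_zero (h : MinChain r P c d) {a : ℕ} (ha : a < c r) :
    skelShape P a (d 0) r = 0 := by
  by_contra hne
  obtain ⟨u, v, huv, h₁, h₂⟩ := h.rook.exists_chain_of_skelShape_pos (Nat.pos_of_ne_zero hne)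
  have h₃ := h.le_first u v huv (by omega)
  have := h.minimal u v huv (by omega) (by omega) r le_rfl
  omega

lemma skelShape_ne (h : MinChain (r + 1) P c d) {a b : ℕ} (ha : a + 1 = c (r + 1))
    (hb : b + 1 = d 0) : skelShape P (a + 1) b r ≠ skelShape P a b r := by
  have key := h.shift.skelShape_ne ha hb
  have e : ∀ a', a' ≤ a + 1 → skelShape {p ∈ P | p.1 ≤ c (r + 1) ∧ p.2 < d 0} a' b =
      skelShape P a' b := fun a' ha' =>
    skelShape_congr fun x y _ hx _ hy =>
      ⟨fun h => h.1, fun h => ⟨h, by simp only; omega, by simp only; omega⟩⟩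
  rwa [e _ le_rfl, e _ (by omega)] at key

end MinChain

lemma gdakRule_corner {r : ℕ} {f g : ℕ → ℕ} {b : Bool} (hr : g r ≠ f r)
    (huniq : ∀ n, n ≠ r → g n = f n) (hpos : ∀ n ≤ r, f n ≠ 0) (hzero : ∀ n, r < n → f n = 0) :
    gdakRule (r + 2) f g f b = gdakRule (r + 2) f f f true := by
  have hgf : g ≠ f := fun e => hr (by rw [e])
  have h₁ : gdakRule (r + 2) f f f true = fun n => f n + if n = 0 then 1 else 0 := by
    simp [gdakRule]
  rw [h₁]
  unfold gdakRule
  dsimp only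
  rw [if_neg (by simp), if_pos hgf, diffIdx_eq hr huniq, if_pos]
  · ext n
    rcases n with _ | n
    · simp
    · by_cases hn : n = r
      · subst hn; simp [hzero]
      · simp [hn]
  · refine ⟨fun n hn => ?_, fun n hn => ?_⟩
    · by_cases hnr : n ≤ r
      · have := hpos n hnr; omega
      · rw [if_pos (by omega)]; omega
    · rw [hzero n (by omega), if_neg (by omega)]

/-- Turning the value-smallest chain preserves the output of the modified algorithm on the
boundary of the rectangle spanned by the chain and outside of it. -/
theorem MinChain.gdak_turn {Q Q' : Finset Cell} (h : MinChain (r + 1) (Q : Set Cell) c d)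
    (hQ' : (Q' : Set Cell) = turn (r + 1) (Q : Set Cell) c d) {a b : ℕ}
    (hab : c (r + 1) ≤ a ∨ d 0 ≤ b) :
    gda (gdakRule (r + 2)) Q a b = gda (gdakRule (r + 2)) Q' a b := by
  have hR' : Rook (Q' : Set Cell) := hQ' ▸ h.rook_turn
  have right : ∀ b < d 0, gda (gdakRule (r + 2)) Q (c (r + 1)) b =
      skelShape (Q : Set Cell) (c (r + 1)) b ∧ gda (gdakRule (r + 2)) Q' (c (r + 1)) b =
      skelShape (Q : Set Cell) (c (r + 1)) b := fun b hb => by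
    have h₀ := h.skelShape_right_eq_zero hb
    have h₁ := h.skelShape_right hb
    rw [← hQ'] at h₁
    refine ⟨gdak_eq_skelShape (by omega) h.rook _ _ h₀, ?_⟩
    rw [← h₁]
    exact gdak_eq_skelShape (by omega) hR' _ _ (by rw [h₁]; exact h₀)
  have up : ∀ a < c (r + 1), gda (gdakRule (r + 2)) Q a (d 0) =
      skelShape (Q : Set Cell) a (d 0) ∧ gda (gdakRule (r + 2)) Q' a (d 0) =
      skelShape (Q : Set Cell) a (d 0) := fun a ha => by
    have h₀ := h.skelShape_up_eq_zero ha
    have h₁ := h.skelShape_up ha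
    rw [← hQ'] at h₁
    refine ⟨gdak_eq_skelShape (by omega) h.rook _ _ h₀, ?_⟩
    rw [← h₁]
    exact gdak_eq_skelShape (by omega) hR' _ _ (by rw [h₁]; exact h₀)
  have corner : gda (gdakRule (r + 2)) Q (c (r + 1)) (d 0) =
      gda (gdakRule (r + 2)) Q' (c (r + 1)) (d 0) := by
    obtain ⟨a, ha⟩ := Nat.exists_eq_add_of_le' (h.rook.pos _ _ (h.chain.1 (r + 1) (by omega))).1
    obtain ⟨b, hb⟩ := Nat.exists_eq_add_of_le' (h.rook.pos _ _ (h.chain.1 0 (by omega))).2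
    have hR := right b (by omega)
    have hU := up a (by omega)
    have sR := h.skelShape_right (b := b) (by omega)
    have sU := h.skelShape_up (a := a) (by omega)
    have hz := h.skelShape_right_eq_zero (b := b) (by omega)
    have hz' : skelShape (Q : Set Cell) a b (r + 1) = 0 :=
      Nat.le_zero.1 (hz ▸ skelShape_le_of_le (by omega) le_rfl _)
    have hne := h.skelShape_ne ha.symm hb.symm
    have hm : (a + 1, b + 1) ∈ (Q' : Set Cell) := by
      rw [hQ', ← ha, ← hb]; exact Or.inr (Or.inr rfl)
    have hm' : (a + 1, b + 1) ∈ Q' := hm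
    rw [← hQ', ha] at sR
    rw [← hQ', hb] at sU
    rw [ha] at hR hz
    rw [hb] at hU
    have e₁ := hR'.skelShape_col_eq_of_mem hm
    have e₂ := hR'.skelShape_row_eq_of_mem hm
    have e₃ : skelShape (Q : Set Cell) a (b + 1) = skelShape (Q : Set Cell) (a + 1) b := by
      rw [← sU, ← sR, e₁, e₂]
    have e₄ : gda (gdakRule (r + 2)) Q' a b = skelShape (Q : Set Cell) (a + 1) b := by
      rw [← sR, e₁]
      refine gdak_eq_skelShape (by omega) hR' _ _ ?_
      rw [← e₁, sR]
      exact hz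
    rw [ha, hb, gda, gda, hR.1, hR.2, hU.1, hU.2, e₃, e₄, decide_eq_true hm',
      gdak_eq_skelShape (k := r + 2) (by omega) h.rook a b hz']
    refine gdakRule_corner hne.symm (fun n hn => ?_) (fun n hn => ?_) fun n hn => ?_
    · by_contra hc
      exact hn (h.rook.skelShape_ne_unique (Ne.symm hc) hne)
    · have hle : skelShape (Q : Set Cell) a b r ≤ skelShape (Q : Set Cell) (a + 1) b r :=
        skelShape_le_of_le (by omega) le_rfl r
      have hpos : 0 < skelShape (Q : Set Cell) (a + 1) b r := by omega
      exact (h.rook.skelShape_pos_of_le hn hpos).ne'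
    · by_contra hc
      have := h.rook.skelShape_pos_of_le (n := r + 1) hn (Nat.pos_of_ne_zero hc)
      omega
  induction a generalizing b with
  | zero => rw [gda, gda]
  | succ a iha =>
    induction b with
    | zero => rw [gda, gda]
    | succ b ihb =>
      by_cases hout : c (r + 1) < a + 1 ∨ d 0 < b + 1
      · have hm : (a + 1, b + 1) ∈ Q ↔ (a + 1, b + 1) ∈ Q' := by
          rw [← Finset.mem_coe, ← Finset.mem_coe, hQ', h.mem_turn_iff hout]
        rw [gda, gda, iha (by omega), iha (by omega), ihb (by omega), decide_eq_decide.2 hm]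
      · by_cases ha : a + 1 = c (r + 1)
        · by_cases hb : b + 1 = d 0
          · rw [ha, hb]; exact corner
          · rw [ha, (right _ (by omega)).1, (right _ (by omega)).2]
        · have hb : b + 1 = d 0 := by omega
          rw [hb, (up _ (by omega)).1, (up _ (by omega)).2]

end turn

section minimal

variable {P : Set Cell} {r : ℕ} {c d : ℕ → ℕ}

lemma Chain.not_cross (h₀ : ∀ x y, Chain P (r + 1) x y → x r ≤ c r → d 0 ≤ y 0)
    {x y u v : ℕ → ℕ} (h : Chain P (r + 1) x y) (h' : Chain P (r + 1) u v) (hu : u r ≤ c r)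
    (hy : y 0 = d 0) {i : ℕ} (hi : i ≤ r) (hxu : x i < u i) : y i ≤ v i := by
  by_contra! hvy
  have hs := h.splice h' (m := i + 1) (l := i) (by omega) (by omega) hxu hvy
  rw [show i + 1 + (r + 1 - i) = r + 1 + 1 by omega] at hs
  have h₁ := h₀ _ _ hs.drop (by
    simp only [if_neg (show ¬ r + 1 < i + 1 by omega)]
    rwa [show r + 1 - (i + 1) + i = r by omega])
  have h₂ := (hs.2 0 (by omega)).2
  simp only [if_pos (show 0 < i + 1 by omega)] at h₁ h₂
  omega

/-- A chain which is lexicographically minimal by rows is minimal entry by entry. -/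
lemma MinChain.of_lex (hP : Rook P) (h : Chain P (r + 1) c d)
    (hlex : ∀ x y, Chain P (r + 1) x y → x r ≤ c r → y 0 ≤ d 0 →
      (∀ i ≤ r, d i = y i) ∨ ∃ i ≤ r, d i < y i ∧ ∀ j < i, d j = y j) :
    MinChain r P c d := by
  have h₀ : ∀ x y, Chain P (r + 1) x y → x r ≤ c r → d 0 ≤ y 0 := by
    intro x y hxy hx
    by_contra! hy
    rcases hlex x y hxy hx hy.le with he | ⟨i, -, hi, he⟩
    · exact hy.ne' (he 0 (by omega))
    · rcases i.eq_zero_or_pos with rfl | hpos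
      · omega
      · exact hy.ne' (he 0 hpos)
  refine ⟨hP, h, h₀, fun x y hxy hx hy => ?_⟩
  have hcmp : ∀ i ≤ r, (c i ≤ x i ∧ d i ≤ y i) ∨ (x i ≤ c i ∧ y i ≤ d i) := by
    intro i hi
    rcases lt_trichotomy (x i) (c i) with hlt | he | hlt
    · exact Or.inr ⟨hlt.le, hxy.not_cross h₀ h le_rfl hy hi hlt⟩
    · have := hP.col _ _ _ (h.1 i (by omega)) (he ▸ hxy.1 i (by omega))
      omega
    · exact Or.inl ⟨hlt.le, h.not_cross h₀ hxy hx rfl hi hlt⟩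
  have hmin : Chain P (r + 1) (fun i => min (c i) (x i)) fun i => min (d i) (y i) := by
    refine ⟨fun i hi => ?_, fun i hi => ?_⟩
    · rcases hcmp i (by omega) with ⟨h₁, h₂⟩ | ⟨h₁, h₂⟩
      · simp only [min_eq_left h₁, min_eq_left h₂]; exact h.1 i hi
      · simp only [min_eq_right h₁, min_eq_right h₂]; exact hxy.1 i hi
    · have h₁ := h.2 i hi
      have h₂ := hxy.2 i hi
      dsimp only
      omega
  have hd : ∀ i ≤ r, d i ≤ y i := by
    rcases hlex _ _ hmin (min_le_left _ _) (min_le_left _ _) with he | ⟨i, -, hi, -⟩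
    · exact fun i hi => he i hi ▸ min_le_right _ _
    · exact absurd hi (not_lt.2 (min_le_left _ _))
  intro i hi
  refine ⟨?_, hd i hi⟩
  rcases hcmp i hi with h₁ | h₁
  · exact h₁.1
  · have he : d i = y i := le_antisymm (hd i hi) h₁.2
    exact (hP.row _ _ _ (h.1 i (by omega)) (he ▸ hxy.1 i (by omega))).le

end minimal

section placement

variable {F P : Finset Cell}

lemma IsPlacement.rook (hP : IsPlacement F P) (hF : IsFerrers F) : Rook (P : Set Cell) where
  pos _ _ h := ⟨(hF _ (hP.1 h)).1, (hF _ (hP.1 h)).2.1⟩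
  col _ _ _ h h' := congrArg Prod.snd (hP.2.1 _ h _ h' rfl)
  row _ _ _ h h' := congrArg Prod.fst (hP.2.2 _ h _ h' rfl)

lemma Chain.isDecOcc (hF : IsFerrers F) {r a b : ℕ} {x y : ℕ → ℕ}
    (h : Chain (P : Set Cell) (r + 1) x y) (hP : Rook (P : Set Cell)) (hab : (a, b) ∈ F)
    (hx : x r ≤ a) (hy : y 0 ≤ b) :
    IsDecOcc F P (r + 1) fun i => (x i, y i) := by
  refine ⟨⟨fun i => h.1 i i.2, fun i j hij => h.lt hij j.2⟩, a, b, fun p hp => ?_, fun i => ?_⟩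
  · simp only [Rect, Finset.mem_product, Finset.mem_Icc] at hp
    exact (hF _ hab).2.2 p hp.1.1 hp.2.1 hp.1.2 hp.2.2
  · have h₁ := hP.pos _ _ (h.1 i i.2)
    have h₂ := (h.le (Nat.lt_succ_iff.1 i.2) (by omega)).1
    have h₃ := (h.le (Nat.zero_le i) i.2).2
    simp only [Rect, Finset.mem_product, Finset.mem_Icc]
    omega

/-- The columns of an occurrence of a pattern, as a sequence. -/
def occCol {k : ℕ} (D : Fin (k + 1) → Cell) (i : ℕ) : ℕ := (D (Fin.ofNat (k + 1) i)).1

/-- The rows of an occurrence of a pattern, as a sequence. -/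
def occRow {k : ℕ} (D : Fin (k + 1) → Cell) (i : ℕ) : ℕ := (D (Fin.ofNat (k + 1) i)).2

lemma occ_eq {k : ℕ} (D : Fin (k + 1) → Cell) (i : Fin (k + 1)) :
    D i = (occCol D i, occRow D i) := by
  simp [occCol, occRow]

lemma IsDecOcc.chain {r : ℕ} {D : Fin (r + 1) → Cell} (h : IsDecOcc F P (r + 1) D) :
    Chain (P : Set Cell) (r + 1) (occCol D) (occRow D) := by
  refine ⟨fun j hj => ?_, fun j hj => ?_⟩
  · exact occ_eq D ⟨j, hj⟩ ▸ h.1.1 ⟨j, hj⟩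
  · have := h.1.2 ⟨j, by omega⟩ ⟨j + 1, hj⟩ (Nat.lt_succ_self j)
    rwa [occ_eq D ⟨j, _⟩, occ_eq D ⟨j + 1, _⟩] at this

lemma IsDecOcc.corner_mem {r : ℕ} {D : Fin (r + 1) → Cell} (h : IsDecOcc F P (r + 1) D) :
    (occCol D r, occRow D 0) ∈ F := by
  obtain ⟨-, a, b, hR, hD⟩ := h
  have h₁ := hD (Fin.last r)
  have h₂ := hD 0
  rw [occ_eq D] at h₁ h₂
  apply hR
  simp only [Rect, Finset.mem_product, Finset.mem_Icc, Fin.val_last, Fin.val_zero] at h₁ h₂ ⊢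
  exact ⟨h₁.1, h₂.2⟩

lemma IsMinOcc.minChain {r : ℕ} {D : Fin (r + 1) → Cell} (h : IsMinOcc F P (r + 1) D)
    (hF : IsFerrers F) (hP : Rook (P : Set Cell)) :
    MinChain r (P : Set Cell) (occCol D) (occRow D) := by
  refine MinChain.of_lex hP h.1.chain fun x y hxy hx hy => ?_
  rcases h.2 _ (hxy.isDecOcc hF hP h.1.corner_mem hx hy) with he | ⟨i, hi, he⟩
  · refine Or.inl fun i hi => ?_
    have := he ⟨i, by omega⟩
    rwa [occ_eq D] at this
  · rw [occ_eq D] at hi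
    refine Or.inr ⟨i, by omega, hi, fun j hj => ?_⟩
    have := he ⟨j, by omega⟩ hj
    rwa [occ_eq D] at this

lemma coe_phiStep {r : ℕ} (D : Fin (r + 1) → Cell) :
    (phiStep (r + 1) D P : Set Cell) = turn r (P : Set Cell) (occCol D) (occRow D) := by
  have hcyc : ∀ i : Fin (r + 1), ((D i).1, (D (cyc (r + 1) i)).2) =
      (occCol D i, occRow D (i + 1)) := fun i => by
    rw [occ_eq D i]; rfl
  have hlast : occRow D (r + 1) = occRow D 0 := by
    simp [occRow, Fin.ofNat]
  ext p
  simp only [phiStep, turn, Finset.coe_union, Finset.coe_sdiff, Finset.coe_image,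
    Finset.coe_univ, Set.image_univ, Set.mem_union, Set.mem_sdiff, Set.mem_range,
    Set.mem_ofPred_eq, hcyc, not_exists]
  refine or_congr (and_congr_right fun _ => ⟨fun h i hi he => ?_, fun h i he => ?_⟩)
    ⟨?_, ?_⟩
  · exact h ⟨i, by omega⟩ ((occ_eq D _).trans he.symm)
  · exact h i (by omega) (he.symm.trans (occ_eq D i))
  · rintro ⟨i, rfl⟩
    rcases (Nat.lt_succ_iff.1 i.2).lt_or_eq with hi | hi
    · exact Or.inl ⟨i, hi, rfl⟩
    · exact Or.inr (by rw [hi, hlast])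
  · rintro (⟨i, hi, rfl⟩ | rfl)
    · exact ⟨⟨i, by omega⟩, rfl⟩
    · exact ⟨Fin.last r, by rw [Fin.val_last, hlast]⟩

lemma IsMinOcc.isPlacement_phiStep {r : ℕ} {D : Fin (r + 1) → Cell}
    (h : IsMinOcc F P (r + 1) D) (hF : IsFerrers F) (hP : IsPlacement F P) :
    IsPlacement F (phiStep (r + 1) D P) := by
  have hm := h.minChain hF (hP.rook hF)
  have hR := hm.rook_turn
  rw [← coe_phiStep] at hR
  refine ⟨fun p hp => ?_, fun p hp q hq he => ?_, fun p hp q hq he => ?_⟩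
  · have hp' : p ∈ (phiStep (r + 1) D P : Set Cell) := hp
    rw [coe_phiStep] at hp'
    rcases hp' with hp' | ⟨i, hi, rfl⟩ | rfl
    · exact hP.1 hp'.1
    · have h₁ := hR.pos _ _ hp
      exact (hF _ h.1.corner_mem).2.2 _ h₁.1 h₁.2 (hm.chain.le hi.le (by omega)).1
        (hm.chain.le (Nat.zero_le (i + 1)) (by omega)).2
    · exact h.1.corner_mem
  · obtain ⟨p₁, p₂⟩ := p
    obtain ⟨q₁, q₂⟩ := q
    obtain rfl : p₁ = q₁ := he
    rw [hR.col _ _ _ hp hq]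
  · obtain ⟨p₁, p₂⟩ := p
    obtain ⟨q₁, q₂⟩ := q
    obtain rfl : p₂ = q₂ := he
    rw [hR.row _ _ _ hp hq]

lemma IsPlacement.phi (hF : IsFerrers F) (hP : IsPlacement F P) (r : ℕ) :
    IsPlacement F (phi F (r + 1) P) := by
  unfold _root_.phi
  split_ifs with h
  · exact h.choose_spec.isPlacement_phiStep hF hP
  · exact hP

lemma IsPlacement.gdak_phi (hF : IsFerrers F) (hP : IsPlacement F P) (r : ℕ) {p : Cell}
    (hp : BorderCorner F p) :
    gda (gdakRule (r + 2)) (_root_.phi F (r + 2) P) p.1 p.2 =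
      gda (gdakRule (r + 2)) P p.1 p.2 := by
  unfold _root_.phi
  split_ifs with h
  · have hm := h.choose_spec.minChain hF (hP.rook hF)
    refine (hm.gdak_turn (coe_phiStep _) ?_).symm
    by_contra! hlt
    exact hp.2 ((hF _ h.choose_spec.1.corner_mem).2.2 _ (by simp) (by simp) hlt.1 hlt.2)
  · rfl

lemma IsPlacement.gdak_eq_gda (hF : IsFerrers F) (hP : IsPlacement F P) {r : ℕ}
    (h : ¬ ∃ D : Fin (r + 1) → Cell, IsDecOcc F P (r + 1) D) {p : Cell} (hp : p ∈ F) :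
    gda (gdakRule (r + 1)) P p.1 p.2 = gda gdaRule P p.1 p.2 := by
  have hR := hP.rook hF
  rw [gda_eq_skelShape hR]
  refine gdak_eq_skelShape (by omega) hR _ _ ?_
  by_contra hne
  obtain ⟨u, v, huv, hv, hu⟩ := hR.exists_chain_of_skelShape_pos (Nat.pos_of_ne_zero hne)
  exact h ⟨_, huv.isDecOcc hF hR hp hu hv⟩

end placement

/-- **Main Theorem.** Fix `k ≥ 2`. For any rook placement `P` on a Ferrers board `F`,
the sequence of partitions along the right/up border of `F` produced by `GDA_k` applied
to `P` equals the one produced by `GDA` applied to `φ*(P)`: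
`seq_k(P,F) = seq(φ*(P),F)`. -/
theorem seqk_eq_seq_phiStar (k : ℕ) (hk : 2 ≤ k) (F P Q : Finset Cell)
    (hF : IsFerrers F) (hP : IsPlacement F P) (hQ : IsPhiStar F k P Q) :
    ∀ c : Cell, BorderCorner F c →
      gda (gdakRule k) P c.1 c.2 = gda gdaRule Q c.1 c.2 := by
  obtain ⟨r, rfl⟩ := Nat.exists_eq_add_of_le' hk
  obtain ⟨⟨n, rfl⟩, hdec⟩ := hQ
  intro p hp
  have key : ∀ n, IsPlacement F ((phi F (r + 2))^[n] P) ∧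
      gda (gdakRule (r + 2)) ((phi F (r + 2))^[n] P) p.1 p.2 =
        gda (gdakRule (r + 2)) P p.1 p.2 := by
    intro n
    induction n with
    | zero => exact ⟨hP, rfl⟩
    | succ n ih =>
      rw [Function.iterate_succ_apply']
      exact ⟨ih.1.phi hF (r + 1), (ih.1.gdak_phi hF r hp).trans ih.2⟩
  rw [← (key n).2]
  exact (key n).1.gdak_eq_gda hF hdec hp.1
end

section
/- Corollary: Fix k ≥ 2 in the definition of φ*. For any rook placement P on a Ferrers board F, φ*(P') = (φ*(P))', where P' denotes the inverse placement of P on the conjugate board F'. -/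
open scoped Classical

/-- The inverse (conjugate/transpose) of a set of cells: reflect across the SW–NE
diagonal, `(i,j) ↦ (j,i)`. -/
def transposeP (P : Finset Cell) : Finset Cell := P.image fun p => (p.2, p.1)

/-- A rook placement on the positive quadrant, as a relation between columns and rows. -/
structure IsRook (Q : ℕ → ℕ → Prop) : Prop where
  pos : ∀ {x y}, Q x y → 0 < x ∧ 0 < y
  col_inj : ∀ {x y y'}, Q x y → Q x y' → y = y'
  row_inj : ∀ {x₁ x₂ y}, Q x₁ y → Q x₂ y → x₁ = x₂

/-- `K` is the skeleton of `Q`: the set of cells where a horizontal ray going right from a rook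
of `Q` meets a vertical ray going up from a rook of `Q`, both rays being stopped there. -/
def IsSkeleton (Q K : ℕ → ℕ → Prop) : Prop :=
  ∀ x y, K x y ↔ (∃ x₀ < x, Q x₀ y) ∧ (∃ y₀ < y, Q x y₀) ∧
    (∀ x₁ < x, ¬ K x₁ y) ∧ ∀ y₁ < y, ¬ K x y₁

/-- The skeleton of a placement. -/
def skeleton (Q : ℕ → ℕ → Prop) (x y : ℕ) : Prop :=
  (∃ x₀ < x, Q x₀ y) ∧ (∃ y₀ < y, Q x y₀) ∧
    (∀ x₁, x₁ < x → ¬ skeleton Q x₁ y) ∧ ∀ y₁, y₁ < y → ¬ skeleton Q x y₁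
termination_by x + y

/-- A decreasing chain of `k` cells `(c i, d i)`, `i < k`, of the placement `Q`. -/
def IsDecChain (k : ℕ) (Q : ℕ → ℕ → Prop) (c d : ℕ → ℕ) : Prop :=
  (∀ i < k, Q (c i) (d i)) ∧ ∀ i, i + 1 < k → c i < c (i + 1) ∧ d (i + 1) < d i

/-- A chain which is coordinatewise smallest among all chains of the same length in `Q`, where
`Q` lies in the rectangle spanned by the chain. -/
structure IsMinChain (k : ℕ) (Q : ℕ → ℕ → Prop) (c d : ℕ → ℕ) : Prop where
  chain : IsDecChain k Q c d
  min : ∀ e f, IsDecChain k Q e f → ∀ i < k, c i ≤ e i ∧ d i ≤ f i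
  bound : ∀ {x y}, Q x y → x ≤ c (k - 1) ∧ y ≤ d 0

/-- Move the rooks of a chain down to the row of their successors, dropping the last column
and the first row of the chain. -/
def rotate (k : ℕ) (c d : ℕ → ℕ) (Q : ℕ → ℕ → Prop) (x y : ℕ) : Prop :=
  (Q x y ∧ ∀ i < k, ¬ (x = c i ∧ y = d i)) ∨ ∃ i, i + 1 < k ∧ x = c i ∧ y = d (i + 1)

/-- The local rule of the growth diagram, computing the labels on the right and top edges of a
cell from the labels `v`, `h` on its left and bottom edges. -/
noncomputable def cellRule (f : ℕ → ℕ) (p : Prop) (v h : ℕ) : ℕ × ℕ :=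
  if p then (1, 1) else if v = h ∧ v ≠ 0 then (f v, f v) else (v, h)

/-- The labels on the right and top edges of the cell `(x, y)` in the growth diagram of `Q`. -/
noncomputable def growth (f : ℕ → ℕ) (Q : ℕ → ℕ → Prop) : ℕ → ℕ → ℕ × ℕ
  | 0, _ => (0, 0)
  | _ + 1, 0 => (0, 0)
  | x + 1, y + 1 =>
    cellRule f (Q (x + 1) (y + 1)) (growth f Q x (y + 1)).1 (growth f Q (x + 1) y).2
termination_by x y => x + y

/-- The successor on labels, with `m` followed by `1`. -/
def wrapSucc (m v : ℕ) : ℕ := if v = m then 1 else v + 1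

section Growth

variable {f : ℕ → ℕ} {Q : ℕ → ℕ → Prop}

theorem growth_zero_left (y : ℕ) : growth f Q 0 y = (0, 0) := by rw [growth]

theorem growth_zero_right (x : ℕ) : growth f Q x 0 = (0, 0) := by cases x <;> rw [growth]

theorem growth_succ (x y : ℕ) : growth f Q (x + 1) (y + 1) =
    cellRule f (Q (x + 1) (y + 1)) (growth f Q x (y + 1)).1 (growth f Q (x + 1) y).2 := by
  rw [growth]

theorem cellRule_swap (p : Prop) (v h : ℕ) : (cellRule f p v h).swap = cellRule f p h v := by
  unfold cellRule
  split_ifs <;> grind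

theorem growth_flip (x y : ℕ) : growth f (flip Q) y x = (growth f Q x y).swap := by
  induction hn : x + y using Nat.strong_induction_on generalizing x y with
  | _ n ih =>
    rcases x with _ | x
    · simp [growth_zero_left, growth_zero_right]
    rcases y with _ | y
    · simp [growth_zero_left, growth_zero_right]
    rw [growth_succ, growth_succ, cellRule_swap, ih _ (by omega) (x + 1) y rfl,
      ih _ (by omega) x (y + 1) rfl]
    rfl

theorem growth_congr {Q' : ℕ → ℕ → Prop} (x y : ℕ)
    (h : ∀ x' y', x' ≤ x → y' ≤ y → (Q x' y' ↔ Q' x' y')) :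
    growth f Q x y = growth f Q' x y := by
  induction hn : x + y using Nat.strong_induction_on generalizing x y with
  | _ n ih =>
    rcases x with _ | x
    · simp [growth_zero_left]
    rcases y with _ | y
    · simp [growth_zero_right]
    rw [growth_succ, growth_succ, ih _ (by omega) (x + 1) y (by grind) rfl,
      ih _ (by omega) x (y + 1) (by grind) rfl, propext (h _ _ le_rfl le_rfl)]

theorem growth_wrap_eq {m : ℕ} (x y : ℕ)
    (h : ∀ x' y', x' ≤ x → y' ≤ y →
      (growth Nat.succ Q x' y').1 ≤ m ∧ (growth Nat.succ Q x' y').2 ≤ m) :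
    growth (wrapSucc m) Q x y = growth Nat.succ Q x y := by
  induction hn : x + y using Nat.strong_induction_on generalizing x y with
  | _ n ih =>
    rcases x with _ | x
    · simp [growth_zero_left]
    rcases y with _ | y
    · simp [growth_zero_right]
    have := h _ _ le_rfl le_rfl
    rw [growth_succ] at this
    rw [growth_succ, growth_succ, ih _ (by omega) (x + 1) y (by grind) rfl,
      ih _ (by omega) x (y + 1) (by grind) rfl]
    unfold cellRule wrapSucc at *
    grind

theorem growth_eq_zero (hQ : IsRook Q) (hf : ∀ v, v ≠ 0 → f v ≠ 0) (x y : ℕ) :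
    ((growth f Q x y).1 = 0 ↔ ∀ x₀ ≤ x, ¬ Q x₀ y) ∧
      ((growth f Q x y).2 = 0 ↔ ∀ y₀ ≤ y, ¬ Q x y₀) := by
  induction hn : x + y using Nat.strong_induction_on generalizing x y with
  | _ n ih =>
    have hp : ∀ x y, Q x y → 0 < x ∧ 0 < y := fun _ _ => hQ.pos
    rcases x with _ | x
    · simp [growth_zero_left]; grind
    rcases y with _ | y
    · simp [growth_zero_right]; grind
    have h1 := ih _ (by omega) x (y + 1) rfl
    have h2 := ih _ (by omega) (x + 1) y rfl
    have e1 : (∀ x₀ ≤ x + 1, ¬ Q x₀ (y + 1)) ↔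
        ¬ Q (x + 1) (y + 1) ∧ ∀ x₀ ≤ x, ¬ Q x₀ (y + 1) := by grind
    have e2 : (∀ y₀ ≤ y + 1, ¬ Q (x + 1) y₀) ↔
        ¬ Q (x + 1) (y + 1) ∧ ∀ y₀ ≤ y, ¬ Q (x + 1) y₀ := by grind
    rw [growth_succ, e1, e2, ← h1.1, ← h2.2]
    unfold cellRule
    split_ifs <;> grind

end Growth

section Skeleton

variable {Q K : ℕ → ℕ → Prop}

theorem isSkeleton_skeleton (Q : ℕ → ℕ → Prop) : IsSkeleton Q (skeleton Q) := by
  intro x y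
  rw [skeleton]

theorem IsRook.flip (hQ : IsRook Q) : IsRook (flip Q) :=
  ⟨fun h => (hQ.pos h).symm, fun h h' => hQ.row_inj h h', fun h h' => hQ.col_inj h h'⟩

theorem IsSkeleton.flip (h : IsSkeleton Q K) : IsSkeleton (flip Q) (flip K) := by
  intro x y
  obtain ⟨h₁, h₂⟩ := h y x
  exact ⟨fun hk => let ⟨a, b, c, d⟩ := h₁ hk; ⟨b, a, d, c⟩,
    fun ⟨a, b, c, d⟩ => h₂ ⟨b, a, d, c⟩⟩

theorem IsSkeleton.isRook (h : IsSkeleton Q K) : IsRook K where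
  pos {x y} hK := by
    obtain ⟨⟨_, h1, _⟩, ⟨_, h2, _⟩, _⟩ := (h x y).1 hK
    omega
  col_inj {x y y'} h1 h2 := by
    by_contra hne
    rcases Nat.lt_or_gt_of_ne hne with hlt | hlt
    · exact ((h _ _).1 h2).2.2.2 _ hlt h1
    · exact ((h _ _).1 h1).2.2.2 _ hlt h2
  row_inj {x x' y} h1 h2 := by
    by_contra hne
    rcases Nat.lt_or_gt_of_ne hne with hlt | hlt
    · exact ((h _ _).1 h2).2.2.1 _ hlt h1
    · exact ((h _ _).1 h1).2.2.1 _ hlt h2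

/-- The labels of a placement are those of its skeleton, increased by one wherever a rook has
been met. -/
theorem growth_skeleton (hQ : IsRook Q) (h : IsSkeleton Q K) (x y : ℕ) :
    growth Nat.succ Q x y =
      (if ∃ x₀ ≤ x, Q x₀ y then (growth Nat.succ K x y).1 + 1 else 0,
       if ∃ y₀ ≤ y, Q x y₀ then (growth Nat.succ K x y).2 + 1 else 0) := by
  have hK := h.isRook
  have hz := growth_eq_zero hK (f := Nat.succ) (fun v _ => Nat.succ_ne_zero v)
  induction hn : x + y using Nat.strong_induction_on generalizing x y with
  | _ n ih =>
    rcases x with _ | x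
    · have : ∀ y, ¬ Q 0 y := fun y hy => by simpa using hQ.pos hy
      simp [growth_zero_left, this]
    rcases y with _ | y
    · have : ∀ x, ¬ Q x 0 := fun y hy => by simpa using hQ.pos hy
      simp [growth_zero_right, this]
    rw [growth_succ, growth_succ, ih _ (by omega) (x + 1) y rfl, ih _ (by omega) x (y + 1) rfl]
    have e1 : (∃ x₀ ≤ x + 1, Q x₀ (y + 1)) ↔ Q (x + 1) (y + 1) ∨ ∃ x₀ ≤ x, Q x₀ (y + 1) := by
      grind
    have e2 : (∃ y₀ ≤ y + 1, Q (x + 1) y₀) ↔ Q (x + 1) (y + 1) ∨ ∃ y₀ ≤ y, Q (x + 1) y₀ := by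
      grind
    have hs := h (x + 1) (y + 1)
    simp only [Nat.lt_succ_iff] at hs
    rw [← (hz x (y + 1)).1, ← (hz (x + 1) y).2] at hs
    have n1 : ¬ (∃ x₀ ≤ x, Q x₀ (y + 1)) → (growth Nat.succ K x (y + 1)).1 = 0 := by
      intro hn
      rw [(hz x (y + 1)).1]
      intro x₀ hx hk
      obtain ⟨⟨x', hx', hq⟩, -⟩ := (h _ _).1 hk
      exact hn ⟨x', by omega, hq⟩
    have n2 : ¬ (∃ y₀ ≤ y, Q (x + 1) y₀) → (growth Nat.succ K (x + 1) y).2 = 0 := by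
      intro hn
      rw [(hz (x + 1) y).2]
      intro x₀ hx hk
      obtain ⟨-, ⟨x', hx', hq⟩, -⟩ := (h _ _).1 hk
      exact hn ⟨x', by omega, hq⟩
    have q1 : Q (x + 1) (y + 1) → ¬ ∃ x₀ ≤ x, Q x₀ (y + 1) := by
      rintro hq ⟨x', hx', hq'⟩
      have := hQ.row_inj hq hq'
      omega
    have q2 : Q (x + 1) (y + 1) → ¬ ∃ y₀ ≤ y, Q (x + 1) y₀ := by
      rintro hq ⟨x', hx', hq'⟩
      have := hQ.col_inj hq hq'
      omega
    simp only [e1, e2]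
    generalize (growth Nat.succ K x (y + 1)).1 = v at *
    generalize (growth Nat.succ K (x + 1) y).2 = w at *
    unfold cellRule
    by_cases hq : Q (x + 1) (y + 1) <;> by_cases hA : ∃ x₀ ≤ x, Q x₀ (y + 1) <;>
      by_cases hB : ∃ y₀ ≤ y, Q (x + 1) y₀ <;>
      simp only [hq, hA, hB, hs, true_and, false_and, and_false, if_true, if_false,
        or_true, or_false] at * <;>
      grind

end Skeleton

section Chain

variable {Q K : ℕ → ℕ → Prop} {k : ℕ} {c d : ℕ → ℕ}

theorem IsDecChain.lt (h : IsDecChain k Q c d) {i j : ℕ} (hij : i < j) (hj : j < k) :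
    c i < c j ∧ d j < d i := by
  induction j, hij using Nat.le_induction with
  | base => exact h.2 i hj
  | succ j _ ih =>
    have := ih (by omega)
    have := h.2 j hj
    omega

theorem IsDecChain.flip (h : IsDecChain k Q c d) :
    IsDecChain k (flip Q) (fun i => d (k - 1 - i)) (fun i => c (k - 1 - i)) := by
  refine ⟨fun i hi => h.1 _ (by omega), fun i hi => ?_⟩
  have := h.2 (k - 1 - (i + 1)) (by omega)
  rw [show k - 1 - (i + 1) + 1 = k - 1 - i by omega] at this
  exact this.symm

/-- Replacing one cell of a chain by another cell between its neighbours. -/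
theorem IsDecChain.update (h : IsDecChain k Q c d) {i x y : ℕ} (hQ : Q x y)
    (h₀ : 0 < i → c (i - 1) < x ∧ y < d (i - 1))
    (h₁ : i + 1 < k → x < c (i + 1) ∧ d (i + 1) < y) :
    IsDecChain k Q (Function.update c i x) (Function.update d i y) := by
  refine ⟨fun j hj => ?_, fun j hj => ?_⟩
  · have := h.1 j hj
    by_cases hji : j = i
    · subst hji; simpa using hQ
    · simpa [hji] using this
  · have := h.2 j hj
    by_cases hji : j = i
    · subst hji; simpa using h₁ hj
    · by_cases hji' : j + 1 = i
      · subst hji'; simpa using h₀ (by omega)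
      · simpa [hji, hji'] using this

/-- If all chains of length `k` start in the same row, then there is a smallest one. -/
theorem exists_min_chain {D : ℕ} (hk : 0 < k) (hne : ∃ c d, IsDecChain k Q c d)
    (htop : ∀ c d, IsDecChain k Q c d → d 0 = D) :
    ∃ c d, IsDecChain k Q c d ∧ ∀ e f, IsDecChain k Q e f → ∀ i < k, c i ≤ e i ∧ d i ≤ f i := by
  have hex : ∃ n c d, IsDecChain k Q c d ∧ ∑ i ∈ Finset.range k, (c i + d i) = n := by
    obtain ⟨c, d, h⟩ := hne
    exact ⟨_, c, d, h, rfl⟩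
  obtain ⟨c, d, h, hsum⟩ := Nat.find_spec hex
  have hmin := fun n => Nat.find_min' hex (m := n)
  rw [← hsum] at hmin
  have crossing : ∀ c d e f, IsDecChain k Q c d → IsDecChain k Q e f → ∀ i < k,
      ¬ (c i < e i ∧ f i < d i) := by
    intro c d e f h h' i hi hlt
    rcases Nat.eq_zero_or_pos i with rfl | hpos
    · have := htop _ _ h
      have := htop _ _ h'
      omega
    have hg : IsDecChain k Q (fun j => if j < i then c (j + 1) else e j)
        (fun j => if j < i then d (j + 1) else f j) := by
      refine ⟨fun j hj => ?_, fun j hj => ?_⟩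
      · by_cases hji : j < i
        · simpa [hji] using h.1 (j + 1) (by omega)
        · simpa [hji] using h'.1 j hj
      · rcases lt_trichotomy (j + 1) i with hji | hji | hji
        · simpa [hji, show j < i by omega] using h.2 (j + 1) (by omega)
        · subst hji
          simpa using hlt
        · simpa [show ¬ j < i by omega, show ¬ j + 1 < i by omega] using h'.2 j hj
    have h1 := htop _ _ hg
    have h2 := htop _ _ h
    have h3 := h.2 0 (by omega)
    simp only [hpos, if_true, zero_add] at h1 h3
    omega
  refine ⟨c, d, h, fun e f h' => ?_⟩
  have hmeet : IsDecChain k Q (fun i => min (c i) (e i)) (fun i => min (d i) (f i)) := by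
    refine ⟨fun i hi => ?_, fun i hi => ?_⟩
    · have h1 := crossing _ _ _ _ h h' i hi
      have h2 := crossing _ _ _ _ h' h i hi
      have q1 := h.1 i hi
      have q2 := h'.1 i hi
      dsimp only
      rcases lt_trichotomy (c i) (e i) with hc | hc | hc
      · rw [min_eq_left hc.le, min_eq_left (by omega)]; exact q1
      · rcases le_total (d i) (f i) with hd | hd
        · rw [min_eq_left hc.le, min_eq_left hd]; exact q1
        · rw [min_eq_right hc.ge, min_eq_right hd]; exact q2
      · rw [min_eq_right hc.le, min_eq_right (by omega)]; exact q2
    · have := h.2 i hi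
      have := h'.2 i hi
      dsimp only
      omega
  by_contra! hcon
  obtain ⟨i, hi, hlt⟩ := hcon
  have := hmin _ ⟨_, _, hmeet, rfl⟩
  refine this.not_gt (Finset.sum_lt_sum (fun j _ => by omega) ⟨i, by simpa using hi, ?_⟩)
  omega

theorem IsSkeleton.exists_between (h : IsSkeleton Q K) {s t x y : ℕ} (h₁ : K s t) (h₂ : K x y)
    (hx : s < x) (hy : y < t) : ∃ p q, Q p q ∧ s ≤ p ∧ p < x ∧ y ≤ q ∧ q < t := by
  have hK := h.isRook
  obtain ⟨-, ⟨y₀, hy₀, hb⟩, -⟩ := (h s t).1 h₁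
  obtain ⟨⟨x₀, hx₀, ha⟩, -⟩ := (h x y).1 h₂
  by_cases c1 : y ≤ y₀
  · exact ⟨s, y₀, hb, le_rfl, hx, c1, hy₀⟩
  by_cases c2 : s ≤ x₀
  · exact ⟨x₀, y, ha, c2, hx₀, le_rfl, hy⟩
  exfalso
  have h3 := h s y
  have : ¬ K s y := fun hk => hy.ne (hK.col_inj hk h₁)
  refine this (h3.2 ⟨⟨x₀, by omega, ha⟩, ⟨y₀, by omega, hb⟩, fun x₁ hx₁ hk => ?_,
    fun y₁ hy₁ hk => ?_⟩)
  · have := hK.row_inj hk h₂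
    omega
  · have := hK.col_inj hk h₁
    omega

theorem IsSkeleton.exists_chain (h : IsSkeleton Q K) (hk : 0 < k) (hc : IsDecChain k K c d) :
    ∃ e f, IsDecChain (k + 1) Q e f ∧ f 0 = d 0 ∧ e k = c (k - 1) ∧
      ∀ i < k, e i < c i ∧ f (i + 1) < d i := by
  have key : ∀ i, ∃ p q, i ≤ k → Q p q ∧ (0 < i → c (i - 1) ≤ p ∧ q < d (i - 1)) ∧
      (i < k → p < c i ∧ d i ≤ q) ∧ (i = 0 → q = d 0) ∧ (i = k → p = c (k - 1)) := by
    intro i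
    rcases Nat.eq_zero_or_pos i with rfl | hi
    · obtain ⟨⟨x₀, hx₀, ha⟩, -⟩ := (h _ _).1 (hc.1 0 hk)
      exact ⟨x₀, d 0, fun _ => ⟨ha, by omega, fun _ => ⟨hx₀, le_rfl⟩, fun _ => rfl, by omega⟩⟩
    rcases lt_trichotomy i k with hik | rfl | hik
    · have hlt := hc.2 (i - 1) (by omega)
      have h1 := hc.1 (i - 1) (by omega)
      have h2 := hc.1 i hik
      rw [Nat.sub_add_cancel hi] at hlt
      obtain ⟨p, q, hpq, b1, b2, b3, b4⟩ := h.exists_between h1 h2 hlt.1 hlt.2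
      exact ⟨p, q, fun _ => ⟨hpq, fun _ => ⟨b1, b4⟩, fun _ => ⟨b2, b3⟩, by omega, by omega⟩⟩
    · obtain ⟨-, ⟨y₀, hy₀, hb⟩, -⟩ := (h _ _).1 (hc.1 (i - 1) (by omega))
      exact ⟨c (i - 1), y₀, fun _ => ⟨hb, fun _ => ⟨le_rfl, hy₀⟩, by omega, by omega,
        fun _ => rfl⟩⟩
    · exact ⟨0, 0, by omega⟩
  choose e f hef using key
  refine ⟨e, f, ⟨fun i hi => (hef i (by omega)).1, fun i hi => ?_⟩,
    (hef 0 (by omega)).2.2.2.1 rfl, (hef k le_rfl).2.2.2.2 rfl, fun i hi => ?_⟩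
  all_goals
    have h1 := (hef i (by omega)).2.2.1 (by omega)
    have h2 := (hef (i + 1) (by omega)).2.1 (by omega)
    rw [Nat.add_sub_cancel] at h2
    omega

theorem IsSkeleton.exists_mem_box (hQ : IsRook Q) (h : IsSkeleton Q K)
    (hc : IsDecChain (k + 1) Q c d) {i : ℕ} (hi : i < k) :
    ∃ x y, K x y ∧ c i < x ∧ x ≤ c (i + 1) ∧ d (i + 1) < y ∧ y ≤ d i := by
  have hlt := hc.2 i (by omega)
  have h1 := hc.1 i (by omega)
  have h2 := hc.1 (i + 1) (by omega)
  by_cases hk : K (c (i + 1)) (d i)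
  · exact ⟨_, _, hk, hlt.1, le_rfl, hlt.2, le_rfl⟩
  have h3 := mt (h (c (i + 1)) (d i)).2 hk
  by_cases hr : ∀ x₁ < c (i + 1), ¬ K x₁ (d i)
  · by_cases hs : ∀ y₁ < d i, ¬ K (c (i + 1)) y₁
    · exact absurd ⟨⟨_, hlt.1, h1⟩, ⟨_, hlt.2, h2⟩, hr, hs⟩ h3
    push Not at hs
    obtain ⟨y, hy, hK⟩ := hs
    obtain ⟨-, ⟨y₀, hy₀, hb⟩, -⟩ := (h _ _).1 hK
    rw [hQ.col_inj hb h2] at hy₀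
    exact ⟨_, y, hK, hlt.1, le_rfl, hy₀, hy.le⟩
  · push Not at hr
    obtain ⟨x, hx, hK⟩ := hr
    obtain ⟨⟨x₀, hx₀, ha⟩, -⟩ := (h _ _).1 hK
    rw [hQ.row_inj ha h1] at hx₀
    exact ⟨x, _, hK, hx₀, hx.le, hlt.2, le_rfl⟩

/-- The minimal chain of the skeleton interlaces the minimal chain of the placement. -/
theorem IsMinChain.exists_skeleton (hQ : IsRook Q) (h : IsSkeleton Q K) (hk : 0 < k)
    (hc : IsMinChain (k + 1) Q c d) :
    ∃ c' d', IsMinChain k K c' d' ∧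
      (∀ i < k, c i < c' i ∧ c' i ≤ c (i + 1) ∧ d (i + 1) < d' i ∧ d' i ≤ d i) ∧
      d' 0 = d 0 ∧ c' (k - 1) = c k := by
  have hbound : ∀ {x y}, K x y → x ≤ c k ∧ y ≤ d 0 := by
    intro x y hK
    obtain ⟨⟨_, _, h1⟩, ⟨_, _, h2⟩, _⟩ := (h _ _).1 hK
    exact ⟨(hc.bound h2).1, (hc.bound h1).2⟩
  have key : ∀ i, ∃ x y, i < k → K x y ∧ c i < x ∧ x ≤ c (i + 1) ∧ d (i + 1) < y ∧ y ≤ d i := by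
    intro i
    by_cases hi : i < k
    · obtain ⟨x, y, hxy⟩ := h.exists_mem_box hQ hc.chain hi
      exact ⟨x, y, fun _ => hxy⟩
    · exact ⟨0, 0, fun h => absurd h hi⟩
  choose e f hef using key
  have hchain : IsDecChain k K e f := by
    refine ⟨fun i hi => (hef i hi).1, fun i hi => ?_⟩
    have := hef i (by omega)
    have := hef (i + 1) hi
    omega
  have lower : ∀ e f, IsDecChain k K e f →
      f 0 = d 0 ∧ e (k - 1) = c k ∧ ∀ i < k, c i < e i ∧ d (i + 1) < f i := by
    intro e f hef
    obtain ⟨p, q, hpq, h0, h1, h2⟩ := h.exists_chain hk hef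
    have hm := hc.min p q hpq
    refine ⟨?_, ?_, fun i hi => ?_⟩
    · have := hm 0 (by omega)
      have := hbound (hef.1 0 hk)
      omega
    · have := hm k (by omega)
      have := hbound (hef.1 (k - 1) (by omega))
      omega
    · have := hm i (by omega)
      have := hm (i + 1) (by omega)
      have := h2 i hi
      omega
  obtain ⟨c', d', hc', hmin⟩ := exists_min_chain (D := d 0) hk ⟨e, f, hchain⟩
    (fun e f hef => (lower e f hef).1)
  have hl := lower c' d' hc'
  refine ⟨c', d', ⟨hc', hmin, fun {x y} hxy => ?_⟩, fun i hi => ?_, hl.1, hl.2.1⟩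
  · rw [hl.1, hl.2.1]
    exact hbound hxy
  · have := hl.2.2 i hi
    have := hmin e f hchain i hi
    have := hef i hi
    omega

end Chain

section Rotate

variable {Q K : ℕ → ℕ → Prop} {k : ℕ} {c d c' d' : ℕ → ℕ}

/-- A chain of a placement and a chain of its skeleton which interlace and are locally minimal. -/
structure Interlaced (k : ℕ) (Q K : ℕ → ℕ → Prop) (c d c' d' : ℕ → ℕ) : Prop where
  pos : 0 < k
  rook : IsRook Q
  skel : IsSkeleton Q K
  chain : IsDecChain (k + 1) Q c d
  chain' : IsDecChain k K c' d'
  box : ∀ i < k, c i < c' i ∧ c' i ≤ c (i + 1) ∧ d (i + 1) < d' i ∧ d' i ≤ d i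
  top : d' 0 = d 0
  right : c' (k - 1) = c k
  le_of_between : ∀ {x y i}, i ≤ k → Q x y → (0 < i → c (i - 1) < x ∧ y < d (i - 1)) →
    (i < k → x < c (i + 1) ∧ d (i + 1) < y) → c i ≤ x ∧ d i ≤ y
  le_of_mem_box : ∀ {x y i}, i < k → K x y → c i < x → x ≤ c (i + 1) → d (i + 1) < y → y ≤ d i →
    c' i ≤ x ∧ d' i ≤ y

theorem IsMinChain.exists_interlaced (hQ : IsRook Q) (h : IsSkeleton Q K) (hk : 0 < k)
    (hc : IsMinChain (k + 1) Q c d) :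
    ∃ c' d', IsMinChain k K c' d' ∧ Interlaced k Q K c d c' d' := by
  obtain ⟨c', d', hc', hbox, htop, hright⟩ := hc.exists_skeleton hQ h hk
  refine ⟨c', d', hc', hk, hQ, h, hc.chain, hc'.chain, hbox, htop, hright, ?_, ?_⟩
  · intro x y i hi hxy h0 h1
    have := hc.min _ _ (hc.chain.update hxy h0 fun h => h1 (by omega)) i (by omega)
    simpa using this
  · intro x y i hi hxy b1 b2 b3 b4
    have := hc'.min _ _ (hc'.chain.update hxy (i := i) (fun h => ?_) fun h => ?_) i hi
    · simpa using this
    · have := hbox (i - 1) (by omega)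
      rw [Nat.sub_add_cancel h] at this
      omega
    · have := hbox (i + 1) h
      omega

theorem Interlaced.flip (H : Interlaced k Q K c d c' d') :
    Interlaced k (flip Q) (flip K) (fun i => d (k - i)) (fun i => c (k - i))
      (fun i => d' (k - 1 - i)) (fun i => c' (k - 1 - i)) where
  pos := H.pos
  rook := H.rook.flip
  skel := H.skel.flip
  chain := H.chain.flip
  chain' := H.chain'.flip
  box i hi := by
    have := H.box (k - 1 - i) (by omega)
    rw [show k - 1 - i + 1 = k - i by omega] at this
    simp only [show k - (i + 1) = k - 1 - i by omega]
    tauto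
  top := H.right
  right := by
    have := H.pos
    simpa using H.top
  le_of_between {x y i} hi hQ h0 h1 := by
    have := H.le_of_between (i := k - i) (by omega) hQ (fun h => ?_) (fun h => ?_)
    · exact this.symm
    · have := h1 (by omega)
      rw [show k - (i + 1) = k - i - 1 by omega] at this
      exact this.symm
    · have := h0 (by omega)
      rw [show k - (i - 1) = k - i + 1 by omega] at this
      exact this.symm
  le_of_mem_box {x y i} hi hK b1 b2 b3 b4 := by
    simp only [show k - (i + 1) = k - 1 - i by omega, show k - i = k - 1 - i + 1 by omega] at *
    exact (H.le_of_mem_box (by omega) hK b3 b4 b1 b2).symm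

theorem rotate_flip (x y : ℕ) :
    rotate k (fun i => d (k - 1 - i)) (fun i => c (k - 1 - i)) (flip Q) y x ↔
      rotate k c d Q x y := by
  refine or_congr (and_congr Iff.rfl ⟨fun h i hi hxy => ?_, fun h i hi hxy => ?_⟩)
    ⟨fun ⟨i, hi, hy, hx⟩ => ?_, fun ⟨i, hi, hx, hy⟩ => ?_⟩
  · refine h (k - 1 - i) (by omega) ?_
    dsimp only
    rw [show k - 1 - (k - 1 - i) = i by omega]
    exact hxy.symm
  · exact h _ (by omega) hxy.symm
  · refine ⟨k - 1 - (i + 1), by omega, hx, ?_⟩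
    rwa [show k - 1 - (i + 1) + 1 = k - 1 - i by omega]
  · refine ⟨k - 1 - (i + 1), by omega, ?_, ?_⟩
    · dsimp only
      rwa [show k - 1 - (k - 1 - (i + 1)) = i + 1 by omega]
    · dsimp only
      rwa [show k - 1 - (k - 1 - (i + 1) + 1) = i by omega]

namespace Interlaced

theorem index_eq (H : Interlaced k Q K c d c' d') {i j : ℕ} (hi : i < k) (hj : j < k)
    (h : d' j = d (i + 1)) : j = i + 1 := by
  have h1 := H.box j hj
  rcases lt_trichotomy j (i + 1) with hlt | heq | hgt
  · rcases Nat.lt_or_ge (j + 1) (i + 1) with h2 | h2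
    · have := (H.chain.lt h2 (by omega)).2
      omega
    · have : j + 1 = i + 1 := by omega
      rw [this] at h1
      omega
  · exact heq
  · have := (H.chain.lt hgt (by omega)).2
    omega

theorem exists_rook_left (H : Interlaced k Q K c d c' d') {i : ℕ} (hi : i < k) :
    ∃ x₀ ≤ c i, Q x₀ (d' i) := by
  obtain ⟨⟨x₀, hx₀, hq⟩, -⟩ := (H.skel _ _).1 (H.chain'.1 i hi)
  refine ⟨x₀, ?_, hq⟩
  by_contra hlt
  have hb := H.box i hi
  have hl := H.chain.2 i (by omega)
  have hne : d' i ≠ d i := by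
    intro he
    rw [he] at hq
    have := H.rook.row_inj hq (H.chain.1 i (by omega))
    omega
  have := H.le_of_between (i := i) (by omega) hq (fun h => ?_) (fun _ => by omega)
  · omega
  · have := H.chain.2 (i - 1) (by omega)
    rw [Nat.sub_add_cancel h] at this
    omega

theorem exists_rook_below (H : Interlaced k Q K c d c' d') {i : ℕ} (hi : i < k) :
    ∃ y₀ ≤ d (i + 1), Q (c' i) y₀ := by
  have := H.flip.exists_rook_left (i := k - 1 - i) (by omega)
  rwa [show k - (k - 1 - i) = i + 1 by omega, show k - 1 - (k - 1 - i) = i by omega] at this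

theorem eq_or_eq (H : Interlaced k Q K c d c' d') {i : ℕ} (hi : i + 1 < k) :
    c' i = c (i + 1) ∨ d' (i + 1) = d (i + 1) := by
  by_contra! hne
  have hK := H.skel.isRook
  have b0 := H.box i (by omega)
  have b1 := H.box (i + 1) hi
  have l0 := H.chain.2 i (by omega)
  have l1 := H.chain.2 (i + 1) (by omega)
  have l' := H.chain'.2 i hi
  have q1 := H.chain.1 (i + 1) (by omega)
  obtain ⟨x', hx', hq⟩ := H.exists_rook_left hi
  obtain ⟨z, hz, hr⟩ := H.exists_rook_below (i := i) (by omega)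
  have hx'' : x' ≠ c (i + 1) := by
    rintro rfl
    exact hne.2 (H.rook.col_inj hq q1)
  have hz' : z ≠ d (i + 1) := by
    rintro rfl
    exact hne.1 (H.rook.row_inj hr q1)
  have hx3 : x' ≤ c i := by
    by_contra hlt
    have := H.le_of_between (i := i + 1) (by omega) hq (fun _ => by simp; omega)
      (fun _ => by omega)
    omega
  have hz3 : z ≤ d (i + 1 + 1) := by
    by_contra hlt
    have := H.le_of_between (i := i + 1) (by omega) hr (fun _ => by simp; omega)
      (fun _ => by omega)
    omega
  have hn : ¬ K (c' i) (d' (i + 1)) := fun hk => by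
    have := hK.col_inj hk (H.chain'.1 i (by omega))
    omega
  refine hn ((H.skel _ _).2 ⟨⟨x', by omega, hq⟩, ⟨z, by omega, hr⟩, fun x₁ hx₁ hk => ?_,
    fun y₁ hy₁ hk => ?_⟩)
  · have := hK.row_inj hk (H.chain'.1 (i + 1) hi)
    omega
  · have := hK.col_inj hk (H.chain'.1 i (by omega))
    omega

/-- No row between `d (i + 1)` and `d' i` is active on the left of the column `c i`. -/
theorem row_inactive (H : Interlaced k Q K c d c' d') {i y : ℕ} (hi : i < k)
    (hy : d (i + 1) < y) (hy' : y < d' i) (hQ : ∃ x₀ < c i, Q x₀ y)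
    (hn : ∀ x₁ < c i, ¬ K x₁ y) : False := by
  have hK := H.skel.isRook
  have b0 := H.box i hi
  obtain ⟨x₀, hx₀, hq⟩ := hQ
  obtain ⟨z, hz, hr⟩ := H.exists_rook_below hi
  have hne : ¬ K (c' i) y := fun hk => by
    have := hK.col_inj hk (H.chain'.1 i hi)
    omega
  refine hne ((H.skel _ _).2 ⟨⟨x₀, by omega, hq⟩, ⟨z, by omega, hr⟩, fun x₁ hx₁ hk => ?_,
    fun y₁ hy₁ hk => ?_⟩)
  · rcases lt_trichotomy x₁ (c i) with hlt | rfl | hgt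
    · exact hn _ hlt hk
    · obtain ⟨-, ⟨y₀, hy₀, hs⟩, -⟩ := (H.skel _ _).1 hk
      have := H.rook.col_inj hs (H.chain.1 i (by omega))
      omega
    · have := H.le_of_mem_box hi hk hgt (by omega) hy (by omega)
      omega
  · have := hK.col_inj hk (H.chain'.1 i hi)
    omega

theorem col_inactive (H : Interlaced k Q K c d c' d') {i x : ℕ} (hi : i < k)
    (hx : c i < x) (hx' : x < c' i) (hQ : ∃ y₀ < d (i + 1), Q x y₀)
    (hn : ∀ y₁ < d (i + 1), ¬ K x y₁) : False := by
  have := H.flip.row_inactive (i := k - 1 - i) (y := x) (by omega)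
  rw [show k - (k - 1 - i) = i + 1 by omega, show k - 1 - (k - 1 - i) = i by omega,
    show k - (k - 1 - i + 1) = i by omega] at this
  exact this hx hx' hQ hn

/-- A row which is active after rotating is either an active row of the original placement, or the
bottom row of one of the rectangles spanned by a cell of the chain and one of the skeleton. -/
theorem row_active (H : Interlaced k Q K c d c' d') {x y : ℕ}
    (hQ : ∃ x₀ < x, rotate (k + 1) c d Q x₀ y) (hn : ∀ x₁ < x, ¬ rotate k c' d' K x₁ y) :
    ((∃ x₀ < x, Q x₀ y) ∧ (∀ x₁ < x, ¬ K x₁ y) ∧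
      ∀ i < k, y = d' i → ¬ (c i < x ∧ x ≤ c' i)) ∨
    ∃ i < k, y = d (i + 1) ∧ c i < x ∧ x ≤ c' i := by
  obtain ⟨x₀, hx₀, ⟨hq, hnD⟩ | ⟨i, hi, rfl, rfl⟩⟩ := hQ
  · have hnd : ∀ i < k + 1, y ≠ d i := by
      rintro i hi rfl
      exact hnD i hi ⟨H.rook.row_inj hq (H.chain.1 i hi), rfl⟩
    left
    refine ⟨⟨x₀, hx₀, hq⟩, fun x₁ hx₁ hk => ?_, fun i hi hy hx => ?_⟩
    · by_cases hD : ∃ j < k, x₁ = c' j ∧ y = d' j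
      · obtain ⟨j, hj, rfl, rfl⟩ := hD
        rcases j with _ | j
        · exact hnd 0 (by omega) H.top
        · have := H.chain'.2 j hj
          exact hn (c' j) (by omega) (Or.inr ⟨j, hj, rfl, rfl⟩)
      · push Not at hD
        exact hn x₁ hx₁ (Or.inl ⟨hk, fun j hj h => hD j hj h.1 h.2⟩)
    · rcases i with _ | i
      · exact hnd 0 (by omega) (hy.trans H.top)
      · have := H.box i (by omega)
        exact hn (c' i) (by omega) (Or.inr ⟨i, hi, rfl, hy⟩)
  · have hik : i < k := by omega
    by_cases hx : x ≤ c' i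
    · exact Or.inr ⟨i, hik, rfl, hx₀, hx⟩
    have hnD : ¬ (i + 1 < k ∧ d' (i + 1) = d (i + 1)) := fun h =>
      hn (c' i) (by omega) (Or.inr ⟨i, h.1, rfl, h.2.symm⟩)
    have hcc : c' i = c (i + 1) := by
      rcases Nat.lt_or_ge (i + 1) k with hlt | hge
      · rcases H.eq_or_eq hlt with h | h
        · exact h
        · exact absurd ⟨hlt, h⟩ hnD
      · have := H.right
        rwa [show k - 1 = i by omega, show k = i + 1 by omega] at this
    have hnd' : ∀ j < k, d (i + 1) ≠ d' j := by
      intro j hj he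
      obtain rfl := H.index_eq hik hj he.symm
      exact hnD ⟨hj, he.symm⟩
    refine Or.inl ⟨⟨c (i + 1), by omega, H.chain.1 _ (by omega)⟩, fun x₁ hx₁ hk => ?_,
      fun j hj he => absurd he (hnd' j hj)⟩
    exact hn x₁ hx₁ (Or.inl ⟨hk, fun j hj h => hnd' j hj h.2⟩)

theorem col_active (H : Interlaced k Q K c d c' d') {x y : ℕ}
    (hQ : ∃ y₀ < y, rotate (k + 1) c d Q x y₀) (hn : ∀ y₁ < y, ¬ rotate k c' d' K x y₁) :
    ((∃ y₀ < y, Q x y₀) ∧ (∀ y₁ < y, ¬ K x y₁) ∧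
      ∀ i < k, x = c' i → ¬ (d (i + 1) < y ∧ y ≤ d' i)) ∨
    ∃ i < k, x = c i ∧ d (i + 1) < y ∧ y ≤ d' i := by
  have := H.flip.row_active (x := y) (y := x)
    (by obtain ⟨y₀, h0, h1⟩ := hQ; exact ⟨y₀, h0, (rotate_flip _ _).2 h1⟩)
    (fun y₁ h0 h1 => hn y₁ h0 ((rotate_flip _ _).1 h1))
  rcases this with ⟨h1, h2, h3⟩ | ⟨i, hi, h1, h2⟩
  · refine Or.inl ⟨h1, h2, fun i hi hx => ?_⟩
    have := h3 (k - 1 - i) (by omega)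
    rw [show k - (k - 1 - i) = i + 1 by omega, show k - 1 - (k - 1 - i) = i by omega] at this
    exact this hx
  · refine Or.inr ⟨k - 1 - i, by omega, ?_, ?_⟩
    · rwa [show k - (i + 1) = k - 1 - i by omega] at h1
    · rwa [show k - i = k - 1 - i + 1 by omega] at h2

end Interlaced

theorem IsRook.isRook_rotate (hQ : IsRook Q) (hc : IsDecChain k Q c d) :
    IsRook (rotate k c d Q) where
  pos {x y} h := by
    rcases h with ⟨h, -⟩ | ⟨i, hi, rfl, rfl⟩
    · exact hQ.pos h
    · exact ⟨(hQ.pos (hc.1 i (by omega))).1, (hQ.pos (hc.1 (i + 1) hi)).2⟩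
  col_inj {x y y'} h h' := by
    rcases h with ⟨h, hD⟩ | ⟨i, hi, rfl, rfl⟩ <;> rcases h' with ⟨h', hD'⟩ | ⟨j, hj, hx, rfl⟩
    · exact hQ.col_inj h h'
    · subst hx
      exact absurd ⟨rfl, hQ.col_inj h (hc.1 j (by omega))⟩ (hD j (by omega))
    · exact absurd ⟨rfl, hQ.col_inj h' (hc.1 i (by omega))⟩ (hD' i (by omega))
    · rcases lt_trichotomy i j with hlt | rfl | hlt
      · have := hc.lt hlt (by omega); omega
      · rfl
      · have := hc.lt hlt (by omega); omega
  row_inj {x x' y} h h' := by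
    rcases h with ⟨h, hD⟩ | ⟨i, hi, rfl, rfl⟩ <;> rcases h' with ⟨h', hD'⟩ | ⟨j, hj, rfl, hy⟩
    · exact hQ.row_inj h h'
    · subst hy
      exact absurd ⟨hQ.row_inj h (hc.1 (j + 1) hj), rfl⟩ (hD (j + 1) hj)
    · exact absurd ⟨hQ.row_inj h' (hc.1 (i + 1) hi), rfl⟩ (hD' (i + 1) hi)
    · rcases lt_trichotomy i j with hlt | rfl | hlt
      · have := hc.lt (show i + 1 < j + 1 by omega) hj; omega
      · rfl
      · have := hc.lt (show j + 1 < i + 1 by omega) hi; omega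

theorem Interlaced.exists_rotate_left (H : Interlaced k Q K c d c' d') {x y : ℕ}
    (h : rotate k c' d' K x y) : ∃ x₀ < x, rotate (k + 1) c d Q x₀ y := by
  have keep : ∀ x₀, Q x₀ y → (∀ i < k + 1, y ≠ d i) → rotate (k + 1) c d Q x₀ y :=
    fun x₀ hq hn => Or.inl ⟨hq, fun i hi h => hn i hi h.2⟩
  rcases h with ⟨hk, hD⟩ | ⟨i, hi, rfl, rfl⟩
  · obtain ⟨⟨x₀, hx₀, hq⟩, -⟩ := (H.skel _ _).1 hk
    by_cases hd : ∃ i < k + 1, y = d i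
    · obtain ⟨i, hi, rfl⟩ := hd
      obtain rfl := H.rook.row_inj hq (H.chain.1 i hi)
      rcases i with _ | i
      · have h0 := H.chain'.1 0 H.pos
        rw [H.top] at h0
        exact absurd ⟨H.skel.isRook.row_inj hk h0, H.top.symm⟩ (hD 0 H.pos)
      · have := H.chain.2 i hi
        exact ⟨c i, by omega, Or.inr ⟨i, hi, rfl, rfl⟩⟩
    · push Not at hd
      exact ⟨x₀, hx₀, keep x₀ hq hd⟩
  · have hb := H.box i (by omega)
    by_cases he : d' (i + 1) = d (i + 1)
    · exact ⟨c i, hb.1, Or.inr ⟨i, by omega, rfl, he⟩⟩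
    have hcc : c' i = c (i + 1) := (H.eq_or_eq hi).resolve_right he
    obtain ⟨x₀, hx₀, hq⟩ := H.exists_rook_left hi
    have hb' := H.box (i + 1) hi
    have hne : ∀ j < k + 1, d' (i + 1) ≠ d j := by
      rintro j hj hj'
      rcases j with _ | j
      · have := (H.chain.lt (show 0 < i + 1 by omega) (by omega)).2
        omega
      · obtain rfl : i = j := by simpa using H.index_eq (by omega) hi hj'
        exact he hj'
    refine ⟨x₀, lt_of_le_of_ne (by omega) ?_, keep x₀ hq hne⟩
    rintro rfl
    rw [hcc] at hq
    exact he (H.rook.col_inj hq (H.chain.1 _ (by omega)))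

theorem Interlaced.exists_rotate_below (H : Interlaced k Q K c d c' d') {x y : ℕ}
    (h : rotate k c' d' K x y) : ∃ y₀ < y, rotate (k + 1) c d Q x y₀ := by
  obtain ⟨y₀, h0, h1⟩ := H.flip.exists_rotate_left ((rotate_flip x y).2 h)
  exact ⟨y₀, h0, (rotate_flip _ _).1 h1⟩

/-- Taking the skeleton commutes with rotating. -/
theorem Interlaced.isSkeleton_rotate (H : Interlaced k Q K c d c' d') :
    IsSkeleton (rotate (k + 1) c d Q) (rotate k c' d' K) := by
  intro x y
  have hR := H.skel.isRook.isRook_rotate H.chain'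
  constructor
  · intro h
    refine ⟨H.exists_rotate_left h, H.exists_rotate_below h, fun x₁ hx₁ h' => ?_,
      fun y₁ hy₁ h' => ?_⟩
    · exact hx₁.ne (hR.row_inj h' h)
    · exact hy₁.ne (hR.col_inj h' h)
  · rintro ⟨h1, h2, h3, h4⟩
    rcases H.row_active h1 h3 with ⟨r1, r2, r3⟩ | ⟨i, hi, rfl, hx, hx'⟩ <;>
      rcases H.col_active h2 h4 with ⟨s1, s2, s3⟩ | ⟨j, hj, he, hy, hy'⟩
    · refine Or.inl ⟨(H.skel _ _).2 ⟨r1, s1, r2, s2⟩, ?_⟩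
      rintro i hi ⟨rfl, rfl⟩
      exact r3 i hi rfl ⟨(H.box i hi).1, le_rfl⟩
    · subst he
      rcases hy'.lt_or_eq with hlt | rfl
      · exact (H.row_inactive hj hy hlt r1 r2).elim
      have hne : d' j ≠ d j := by
        intro he
        rw [he] at r1
        obtain ⟨x₀, hx₀, hq⟩ := r1
        exact hx₀.ne (H.rook.row_inj hq (H.chain.1 j (by omega)))
      rcases j with _ | j
      · exact absurd H.top hne
      · exact Or.inr ⟨j, hj, ((H.eq_or_eq hj).resolve_right hne).symm, rfl⟩
    · rcases hx'.lt_or_eq with hlt | rfl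
      · exact (H.col_inactive hi hx hlt s1 s2).elim
      have hne : c' i ≠ c (i + 1) := by
        intro he
        rw [he] at s1
        obtain ⟨y₀, hy₀, hq⟩ := s1
        exact hy₀.ne (H.rook.col_inj hq (H.chain.1 (i + 1) (by omega)))
      have hik : i + 1 < k := by
        by_contra hge
        have := H.right
        rw [show k - 1 = i by omega, show k = i + 1 by omega] at this
        exact hne this
      exact Or.inr ⟨i, hik, rfl, ((H.eq_or_eq hik).resolve_left hne).symm⟩
    · have hb := H.box i hi
      have hb' := H.box j hj
      obtain rfl : j = i + 1 := by
        rcases lt_trichotomy j (i + 1) with hlt | heq | hgt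
        · have : c j ≤ c i := by
            rcases Nat.lt_or_ge j i with h | h
            · exact (H.chain.lt h (by omega)).1.le
            · rw [show j = i by omega]
          omega
        · exact heq
        · have := (H.chain.lt hgt (by omega)).1
          omega
      exact Or.inr ⟨i, hj, by omega, by omega⟩

end Rotate

section Boundary

variable {Q K : ℕ → ℕ → Prop} {k : ℕ} {c d : ℕ → ℕ}

theorem IsDecChain.exists_rotate_row (hc : IsDecChain (k + 1) Q c d) {y : ℕ} (hy : y ≠ d 0) :
    (∃ x₀ ≤ c k, rotate (k + 1) c d Q x₀ y) ↔ ∃ x₀ ≤ c k, Q x₀ y := by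
  have hle : ∀ i ≤ k, c i ≤ c k := by
    intro i hi
    rcases hi.lt_or_eq with h | rfl
    · exact (hc.lt h (by omega)).1.le
    · exact le_rfl
  constructor
  · rintro ⟨x, hx, ⟨hq, -⟩ | ⟨i, hi, rfl, rfl⟩⟩
    · exact ⟨x, hx, hq⟩
    · exact ⟨c (i + 1), hle _ (by omega), hc.1 _ hi⟩
  · rintro ⟨x, hx, hq⟩
    by_cases hD : ∃ i < k + 1, x = c i ∧ y = d i
    · obtain ⟨i, hi, rfl, rfl⟩ := hD
      rcases i with _ | i
      · exact absurd rfl hy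
      · exact ⟨c i, hle _ (by omega), Or.inr ⟨i, hi, rfl, rfl⟩⟩
    · push Not at hD
      exact ⟨x, hx, Or.inl ⟨hq, fun i hi h => hD i hi h.1 h.2⟩⟩

theorem IsDecChain.exists_rotate_col (hc : IsDecChain (k + 1) Q c d) {x : ℕ} (hx : x ≠ c k) :
    (∃ y₀ ≤ d 0, rotate (k + 1) c d Q x y₀) ↔ ∃ y₀ ≤ d 0, Q x y₀ := by
  have := hc.flip.exists_rotate_row (y := x) (by simpa using hx)
  have key : ∀ y, rotate (k + 1) (fun i => d (k - i)) (fun i => c (k - i)) (_root_.flip Q) y x ↔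
      rotate (k + 1) c d Q x y := rotate_flip x
  simpa only [add_tsub_cancel_right, Nat.sub_self, Nat.sub_zero, key, _root_.flip] using this

theorem IsMinChain.growth_boundary (hQ : IsRook Q) (hc : IsMinChain (k + 1) Q c d) :
    (∀ x ≤ c k, ∀ y ≤ d 0, ¬ (x = c k ∧ y = d 0) →
      (growth Nat.succ Q x y).1 ≤ k ∧ (growth Nat.succ Q x y).2 ≤ k) ∧
    growth Nat.succ Q (c k) (d 0) = (k + 1, k + 1) ∧
    (∀ x y, (growth Nat.succ (rotate (k + 1) c d Q) x y).1 ≤ k ∧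
      (growth Nat.succ (rotate (k + 1) c d Q) x y).2 ≤ k) ∧
    (∀ y < d 0, (growth Nat.succ (rotate (k + 1) c d Q) (c k) y).1 =
      (growth Nat.succ Q (c k) y).1) ∧
    ∀ x < c k, (growth Nat.succ (rotate (k + 1) c d Q) x (d 0)).2 =
      (growth Nat.succ Q x (d 0)).2 := by
  induction k generalizing Q c d with
  | zero =>
    have hz := growth_eq_zero hQ (f := Nat.succ) (fun v _ => Nat.succ_ne_zero v)
    have hR : ∀ x y, ¬ rotate (0 + 1) c d Q x y := by
      rintro x y (⟨hq, hD⟩ | ⟨i, hi, -⟩)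
      · have := hc.bound hq
        have := hc.min (fun _ => x) (fun _ => y) ⟨fun _ _ => hq, fun i hi => by omega⟩ 0 (by omega)
        exact hD 0 (by omega) (by simp at *; omega)
      · omega
    have hz' := growth_eq_zero (Q := rotate (0 + 1) c d Q) ⟨fun h => (hR _ _ h).elim,
      fun h => (hR _ _ h).elim, fun h => (hR _ _ h).elim⟩
      (f := Nat.succ) (fun v _ => Nat.succ_ne_zero v)
    simp only [hR, not_false_eq_true, implies_true, iff_true] at hz'
    have hmin : ∀ x y, Q x y → x = c 0 ∧ y = d 0 := by
      intro x y hq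
      by_contra hn
      refine hR x y (Or.inl ⟨hq, fun i hi h => ?_⟩)
      obtain rfl : i = 0 := by omega
      exact hn h
    have hq := hc.chain.1 0 (by omega)
    have hpos := hQ.pos hq
    have hl : ∀ x ≤ c 0, ∀ y ≤ d 0, ¬ (x = c 0 ∧ y = d 0) →
        (growth Nat.succ Q x y).1 = 0 ∧ (growth Nat.succ Q x y).2 = 0 := by
      intro x hx y hy hn
      rw [(hz x y).1, (hz x y).2]
      refine ⟨fun x₀ hx₀ h => ?_, fun y₀ hy₀ h => ?_⟩ <;>
      · have := hmin _ _ h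
        omega
    refine ⟨fun x hx y hy hn => by have := hl x hx y hy hn; omega, ?_,
      fun x y => by have := hz' x y; omega,
      fun y hy => ?_, fun x hx => ?_⟩
    · obtain ⟨a, ha⟩ := Nat.exists_eq_succ_of_ne_zero hpos.1.ne'
      obtain ⟨b, hb⟩ := Nat.exists_eq_succ_of_ne_zero hpos.2.ne'
      rw [ha, hb] at hq ⊢
      rw [growth_succ, cellRule, if_pos hq]
    · rw [(hz' _ _).1, (hl _ le_rfl _ hy.le (by omega)).1]
    · rw [(hz' _ _).2, (hl _ hx.le _ le_rfl (by omega)).2]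
  | succ k ih =>
    have hs := isSkeleton_skeleton Q
    obtain ⟨c', d', hc', H⟩ := hc.exists_interlaced hQ hs (by omega)
    have hK := hs.isRook
    have hR := hQ.isRook_rotate hc.chain
    have hs' := H.isSkeleton_rotate
    have e1 : c' k = c (k + 1) := H.right
    have e2 : d' 0 = d 0 := H.top
    have i1 : ∃ x₀ ≤ c (k + 1), Q x₀ (d 0) :=
      ⟨c 0, (hc.chain.lt (show 0 < k + 1 by omega) (by omega)).1.le, hc.chain.1 0 (by omega)⟩
    have i2 : ∃ y₀ ≤ d 0, Q (c (k + 1)) y₀ :=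
      ⟨d (k + 1), (hc.chain.lt (show 0 < k + 1 by omega) (by omega)).2.le,
        hc.chain.1 _ (by omega)⟩
    obtain ⟨h1, h2, h3, h4, h5⟩ := ih hK hc'
    rw [e1, e2] at h1 h2
    rw [e1] at h4 h5
    rw [e2] at h4 h5
    have g := growth_skeleton hQ hs
    have g' := growth_skeleton hR hs'
    refine ⟨fun x hx y hy hn => ?_, ?_, fun x y => ?_, fun y hy => ?_, fun x hx => ?_⟩
    · have := h1 x hx y hy hn
      rw [g]
      dsimp only
      split_ifs <;> omega
    · simp only [g, h2, i1, i2, if_true]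
    · have := h3 x y
      rw [g']
      dsimp only
      split_ifs <;> omega
    · rw [g, g']
      simp only [hc.chain.exists_rotate_row hy.ne, h4 y hy]
    · rw [g, g']
      simp only [hc.chain.exists_rotate_col hx.ne, h5 x hx]

/-- A large label on a cell comes from a long chain in its rectangle. -/
theorem exists_chain_of_le_growth (hQ : IsRook Q) {m x y : ℕ}
    (h : m + 1 ≤ (growth Nat.succ Q x y).1 ∨ m + 1 ≤ (growth Nat.succ Q x y).2) :
    ∃ c d, IsDecChain (m + 1) Q c d ∧ c m ≤ x ∧ d 0 ≤ y := by
  induction m generalizing Q with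
  | zero =>
    have : ∃ x₀ y₀, Q x₀ y₀ ∧ x₀ ≤ x ∧ y₀ ≤ y := by
      have hz := growth_eq_zero hQ (f := Nat.succ) (fun v _ => Nat.succ_ne_zero v) x y
      by_contra! hn
      have h1 := hz.1.2 fun x₀ hx hq => by have := hn x₀ y hq hx; omega
      have h2 := hz.2.2 fun y₀ hy hq => by have := hn x y₀ hq le_rfl; omega
      omega
    obtain ⟨x₀, y₀, hq, hx, hy⟩ := this
    exact ⟨fun _ => x₀, fun _ => y₀, ⟨fun _ _ => hq, fun i hi => by omega⟩, hx, hy⟩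
  | succ m ih =>
    have hs := isSkeleton_skeleton Q
    rw [growth_skeleton hQ hs] at h
    obtain ⟨c', d', hc', hx, hy⟩ := ih hs.isRook (by
      dsimp only at h
      split_ifs at h <;> omega)
    obtain ⟨c, d, hc, h1, h2, -⟩ := hs.exists_chain (by omega) hc'
    exact ⟨c, d, hc, h2.le.trans hx, h1.le.trans hy⟩

end Boundary

section WrappedGrowth

variable {P P' : ℕ → ℕ → Prop} {m C D : ℕ} {c d : ℕ → ℕ}

/-- The placement obtained from `P` by rotating a chain cyclically. -/
def rotateCyclic (m : ℕ) (c d : ℕ → ℕ) (P : ℕ → ℕ → Prop) (x y : ℕ) : Prop :=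
  rotate (m + 1) c d P x y ∨ (x = c m ∧ y = d 0)

theorem IsRook.restrict (hP : IsRook P) : IsRook fun x y => P x y ∧ x ≤ C ∧ y ≤ D :=
  ⟨fun h => hP.pos h.1, fun h h' => hP.col_inj h.1 h'.1, fun h h' => hP.row_inj h.1 h'.1⟩

theorem growth_rotateCyclic_boundary (hP : IsRook P) (hm : 1 ≤ m)
    (hc : IsMinChain (m + 1) (fun x y => P x y ∧ x ≤ c m ∧ y ≤ d 0) c d) :
    (∀ y ≤ d 0, (growth (wrapSucc m) P (c m) y).1 =
      (growth (wrapSucc m) (rotateCyclic m c d P) (c m) y).1) ∧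
    ∀ x ≤ c m, (growth (wrapSucc m) P x (d 0)).2 =
      (growth (wrapSucc m) (rotateCyclic m c d P) x (d 0)).2 := by
  obtain ⟨h1, h2, h3, h4, h5⟩ := hc.growth_boundary hP.restrict
  have hPQ : ∀ x ≤ c m, ∀ y ≤ d 0, ¬ (x = c m ∧ y = d 0) → growth (wrapSucc m) P x y =
      growth Nat.succ (fun x y => P x y ∧ x ≤ c m ∧ y ≤ d 0) x y := by
    intro x hx y hy hn
    rw [← growth_wrap_eq (m := m) x y fun x' y' hx' hy' =>
      h1 x' (by omega) y' (by omega) (by omega)]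
    refine growth_congr x y fun x' y' hx' hy' => ?_
    exact (and_iff_left ⟨by omega, by omega⟩).symm
  have hPR : ∀ x ≤ c m, ∀ y ≤ d 0, ¬ (x = c m ∧ y = d 0) →
      growth (wrapSucc m) (rotateCyclic m c d P) x y =
      growth Nat.succ (rotate (m + 1) c d fun x y => P x y ∧ x ≤ c m ∧ y ≤ d 0) x y := by
    intro x hx y hy hn
    rw [← growth_wrap_eq (m := m) x y fun x' y' hx' hy' => h3 x' y']
    refine growth_congr x y fun x' y' hx' hy' => ?_
    have a1 : x' ≤ c m := by omega
    have a2 : y' ≤ d 0 := by omega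
    have a3 : ¬ (x' = c m ∧ y' = d 0) := by omega
    simp only [rotateCyclic, rotate, a1, a2, a3, and_true, or_false]
  have hcorner : growth (wrapSucc m) P (c m) (d 0) =
      growth (wrapSucc m) (rotateCyclic m c d P) (c m) (d 0) := by
    have hpos := hP.pos (hc.chain.1 m (by omega)).1
    have hpos' := hP.pos (hc.chain.1 0 (by omega)).1
    obtain ⟨a, ha⟩ := Nat.exists_eq_succ_of_ne_zero hpos.1.ne'
    obtain ⟨b, hb⟩ := Nat.exists_eq_succ_of_ne_zero hpos'.2.ne'
    have l1 := h1 a (by omega) (d 0) le_rfl (by omega)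
    have l2 := h1 (c m) le_rfl b (by omega) (by omega)
    have hR : rotateCyclic m c d P (c m) (d 0) := Or.inr ⟨rfl, rfl⟩
    have e1 := hPQ a (by omega) (d 0) le_rfl (by omega)
    have e2 := hPQ (c m) le_rfl b (by omega) (by omega)
    generalize (fun x y => P x y ∧ x ≤ c m ∧ y ≤ d 0) = Q at *
    rw [ha] at h2 hR l2 e2 ⊢
    rw [hb] at h2 hR l1 e1 ⊢
    rw [growth_succ, growth_succ (Q := rotateCyclic m c d P), e1, e2]
    rw [growth_succ] at h2
    unfold cellRule wrapSucc at *
    grind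
  refine ⟨fun y hy => ?_, fun x hx => ?_⟩
  · rcases hy.lt_or_eq with hlt | rfl
    · rw [hPQ _ le_rfl _ hy (by omega), hPR _ le_rfl _ hy (by omega), h4 _ hlt]
    · rw [hcorner]
  · rcases hx.lt_or_eq with hlt | rfl
    · rw [hPQ _ hx _ le_rfl (by omega), hPR _ hx _ le_rfl (by omega), h5 _ hlt]
    · rw [hcorner]

theorem growth_rotateCyclic (hP : IsRook P) (hm : 1 ≤ m)
    (hc : IsMinChain (m + 1) (fun x y => P x y ∧ x ≤ c m ∧ y ≤ d 0) c d) (x y : ℕ) :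
    (c m ≤ x ∨ d 0 < y → (growth (wrapSucc m) P x y).1 =
      (growth (wrapSucc m) (rotateCyclic m c d P) x y).1) ∧
    (d 0 ≤ y ∨ c m < x → (growth (wrapSucc m) P x y).2 =
      (growth (wrapSucc m) (rotateCyclic m c d P) x y).2) := by
  obtain ⟨h1, h2⟩ := growth_rotateCyclic_boundary hP hm hc
  induction hn : x + y using Nat.strong_induction_on generalizing x y with
  | _ n ih =>
    rcases x with _ | x
    · simp [growth_zero_left]
    rcases y with _ | y
    · simp [growth_zero_right]
    by_cases hin : x + 1 ≤ c m ∧ y + 1 ≤ d 0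
    · refine ⟨fun h => ?_, fun h => ?_⟩
      · have h' : x + 1 = c m := by omega
        rw [h']
        exact h1 _ hin.2
      · have h' : y + 1 = d 0 := by omega
        rw [h']
        exact h2 _ hin.1
    · have hiff : P (x + 1) (y + 1) = rotateCyclic m c d P (x + 1) (y + 1) := by
        have hb : ∀ i < m + 1, c i ≤ c m ∧ d i ≤ d 0 := fun i hi => (hc.chain.1 i hi).2
        refine propext ⟨fun h => Or.inl (Or.inl ⟨h, fun i hi he => ?_⟩), ?_⟩
        · have := hb i hi
          omega
        · rintro ((⟨h, -⟩ | ⟨i, hi, hx, hy⟩) | h)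
          · exact h
          · have := hb i (by omega)
            have := hb (i + 1) (by omega)
            omega
          · omega
      have i1 := (ih _ (by omega) x (y + 1) rfl).1 (by omega)
      have i2 := (ih _ (by omega) (x + 1) y rfl).2 (by omega)
      rw [growth_succ, growth_succ, hiff, i1, i2]
      simp

theorem IsRook.isRook_rotateCyclic (hP : IsRook P) (hc : IsDecChain (m + 1) P c d) :
    IsRook (rotateCyclic m c d P) := by
  have hR := hP.isRook_rotate hc
  have hcol : ∀ y, ¬ rotate (m + 1) c d P (c m) y := by
    rintro y (⟨h, hD⟩ | ⟨i, hi, hx, rfl⟩)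
    · exact hD m (by omega) ⟨rfl, hP.col_inj h (hc.1 m (by omega))⟩
    · have := (hc.lt (show i < m by omega) (by omega)).1
      omega
  have hrow : ∀ x, ¬ rotate (m + 1) c d P x (d 0) := by
    rintro x (⟨h, hD⟩ | ⟨i, hi, rfl, hy⟩)
    · exact hD 0 (by omega) ⟨hP.row_inj h (hc.1 0 (by omega)), rfl⟩
    · have := (hc.lt (show 0 < i + 1 by omega) (by omega)).2
      omega
  refine ⟨?_, ?_, ?_⟩
  · rintro x y (h | ⟨rfl, rfl⟩)
    · exact hR.pos h
    · exact ⟨(hP.pos (hc.1 m (by omega))).1, (hP.pos (hc.1 0 (by omega))).2⟩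
  · rintro x y y' (h | ⟨rfl, rfl⟩) (h' | ⟨hx, rfl⟩)
    · exact hR.col_inj h h'
    · exact absurd (hx ▸ h) (hcol y)
    · exact absurd h' (hcol _)
    · rfl
  · rintro x x' y (h | ⟨rfl, rfl⟩) (h' | ⟨rfl, hy⟩)
    · exact hR.row_inj h h'
    · exact absurd (hy ▸ h) (hrow x)
    · exact absurd h' (hrow _)
    · rfl

theorem cellRule_succ_inj {p p' : Prop} {v h v' h' : ℕ} (hp : p → v = 0 ∧ h = 0)
    (hp' : p' → v' = 0 ∧ h' = 0) (he : cellRule Nat.succ p v h = cellRule Nat.succ p' v' h') :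
    (p ↔ p') ∧ v = v' ∧ h = h' := by
  unfold cellRule at he
  grind

end WrappedGrowth

section Board

variable {F P R : Finset Cell} {m : ℕ} {c d : ℕ → ℕ}

theorem IsPlacement.isRook (hF : IsFerrers F) (hP : IsPlacement F P) :
    IsRook fun x y => (x, y) ∈ P where
  pos h := let h' := hF _ (hP.1 h); ⟨h'.1, h'.2.1⟩
  col_inj h h' := congrArg Prod.snd (hP.2.1 _ h _ h' rfl)
  row_inj h h' := congrArg Prod.fst (hP.2.2 _ h _ h' rfl)

theorem exists_eq_fin (S : Fin (m + 1) → Cell) :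
    ∃ c d : ℕ → ℕ, S = fun i : Fin (m + 1) => (c i, d i) := by
  refine ⟨fun i => (S (Fin.ofNat (m + 1) i)).1, fun i => (S (Fin.ofNat (m + 1) i)).2, ?_⟩
  funext i
  simp

theorem isDecOcc_iff (hF : IsFerrers F) (hP : P ⊆ F) :
    IsDecOcc F P (m + 1) (fun i => (c i, d i)) ↔
      IsDecChain (m + 1) (fun x y => (x, y) ∈ P) c d ∧ (c m, d 0) ∈ F := by
  constructor
  · rintro ⟨⟨h1, h2⟩, a, b, hab, h3⟩
    refine ⟨⟨fun i hi => h1 ⟨i, hi⟩, fun i hi => h2 ⟨i, by omega⟩ ⟨i + 1, hi⟩ (by simp)⟩, hab ?_⟩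
    have := h3 ⟨m, by omega⟩
    have := h3 ⟨0, by omega⟩
    simp only [Rect, Finset.mem_product] at *
    tauto
  · rintro ⟨h, hC⟩
    refine ⟨⟨fun i => h.1 i i.2, fun i j hij => h.lt hij j.2⟩, c m, d 0, fun q hq => ?_,
      fun i => ?_⟩
    · simp only [Rect, Finset.mem_product, Finset.mem_Icc] at hq
      exact (hF _ hC).2.2 q hq.1.1 hq.2.1 hq.1.2 hq.2.2
    · have h0 := hF _ (hP (h.1 i i.2))
      simp only [Rect, Finset.mem_product, Finset.mem_Icc]
      refine ⟨⟨h0.1, ?_⟩, h0.2.1, ?_⟩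
      · rcases (Nat.le_of_lt_succ i.2).lt_or_eq with hlt | heq
        · exact (h.lt hlt (by omega)).1.le
        · rw [heq]
      · rcases Nat.eq_zero_or_pos i.1 with heq | hlt
        · rw [heq]
        · exact (h.lt hlt i.2).2.le

theorem IsMinOcc.isMinChain (hF : IsFerrers F) (hP : IsPlacement F P)
    (h : IsMinOcc F P (m + 1) fun i => (c i, d i)) :
    IsMinChain (m + 1) (fun x y => (x, y) ∈ P ∧ x ≤ c m ∧ y ≤ d 0) c d := by
  obtain ⟨hocc, hmin⟩ := h
  obtain ⟨hc, hC⟩ := (isDecOcc_iff hF hP.1).1 hocc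
  have hrook := hP.isRook hF
  have hc' : IsDecChain (m + 1) (fun x y => (x, y) ∈ P ∧ x ≤ c m ∧ y ≤ d 0) c d := by
    refine ⟨fun i hi => ⟨hc.1 i hi, ?_, ?_⟩, hc.2⟩
    · rcases (Nat.le_of_lt_succ hi).lt_or_eq with hlt | rfl
      · exact (hc.lt hlt (by omega)).1.le
      · exact le_rfl
    · rcases Nat.eq_zero_or_pos i with rfl | hlt
      · exact le_rfl
      · exact (hc.lt hlt hi).2.le
  have hlex : ∀ e f, IsDecChain (m + 1) (fun x y => (x, y) ∈ P ∧ x ≤ c m ∧ y ≤ d 0) e f →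
      rowLexLE (m + 1) (fun i => (c i, d i)) fun i => (e i, f i) := by
    intro e f he
    refine hmin _ ((isDecOcc_iff hF hP.1).2 ⟨⟨fun i hi => (he.1 i hi).1, he.2⟩, ?_⟩)
    have hm := he.1 m (by omega)
    have h0 := he.1 0 (by omega)
    exact (hF _ hC).2.2 _ (hrook.pos hm.1).1 (hrook.pos h0.1).2 hm.2.1 h0.2.2
  obtain ⟨e, f, he, hle⟩ := exists_min_chain (D := d 0) (Nat.succ_pos m) ⟨c, d, hc'⟩ (by
    intro e f he
    have h0 := (he.1 0 (by omega)).2.2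
    rcases hlex e f he with h | ⟨i, hi, hj⟩
    · exact (h 0).symm
    · rcases Nat.eq_zero_or_pos i.1 with h | h
      · dsimp only at hi
        rw [h] at hi
        omega
      · exact (hj 0 h).symm)
  have hd : ∀ i < m + 1, d i = f i := by
    rcases hlex e f he with h | ⟨i, hi, -⟩
    · exact fun i hi => h ⟨i, hi⟩
    · have := (hle c d hc' i i.2).2
      dsimp only at hi
      omega
  have hcc : ∀ i < m + 1, c i = e i := fun i hi => by
    have h1 := (he.1 i hi).1
    rw [← hd i hi] at h1
    exact hrook.row_inj (hc.1 i hi) h1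
  refine ⟨hc', fun a b hab i hi => ?_, fun h => h.2⟩
  rw [hcc i hi, hd i hi]
  exact hle a b hab i hi

theorem mem_phiStep {x y : ℕ} : (x, y) ∈ phiStep (m + 1) (fun i => (c i, d i)) P ↔
    rotateCyclic m c d (fun x y => (x, y) ∈ P) x y := by
  have hcyc : ∀ i < m, (i + 1) % (m + 1) = i + 1 := fun i hi => Nat.mod_eq_of_lt (by omega)
  simp only [phiStep, rotateCyclic, rotate, cyc, Finset.mem_union, Finset.mem_sdiff,
    Finset.mem_image, Finset.mem_univ, true_and, Prod.mk.injEq, or_assoc]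
  refine or_congr (and_congr Iff.rfl ⟨fun h i hi hxy => h ⟨⟨i, hi⟩, hxy.1.symm, hxy.2.symm⟩,
    fun h ⟨i, hx, hy⟩ => h i i.2 ⟨hx.symm, hy.symm⟩⟩) ⟨?_, ?_⟩
  · rintro ⟨i, rfl, rfl⟩
    rcases (Nat.le_of_lt_succ i.2).lt_or_eq with hlt | heq
    · exact Or.inl ⟨i, by omega, rfl, by rw [hcyc _ hlt]⟩
    · exact Or.inr ⟨by rw [heq], by rw [heq, Nat.mod_self]⟩
  · rintro (⟨i, hi, rfl, rfl⟩ | ⟨rfl, rfl⟩)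
    · exact ⟨⟨i, by omega⟩, rfl, by simp only [hcyc i (by omega)]⟩
    · exact ⟨⟨m, by omega⟩, rfl, by simp only [Nat.mod_self]⟩

/-- The growth diagrams of `P` and `R` carry the same labels on the outer boundary of `F`. -/
def BoundaryAgree (m : ℕ) (F P R : Finset Cell) : Prop :=
  ∀ x y, (x, y) ∈ F →
    ((x + 1, y) ∉ F → (growth (wrapSucc m) (fun x y => (x, y) ∈ P) x y).1 =
      (growth (wrapSucc m) (fun x y => (x, y) ∈ R) x y).1) ∧
    ((x, y + 1) ∉ F → (growth (wrapSucc m) (fun x y => (x, y) ∈ P) x y).2 =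
      (growth (wrapSucc m) (fun x y => (x, y) ∈ R) x y).2)

theorem isPlacement_phi_and_boundaryAgree (hF : IsFerrers F) (hm : 1 ≤ m)
    (hP : IsPlacement F P) :
    IsPlacement F (phi F (m + 1) P) ∧ BoundaryAgree m F P (phi F (m + 1) P) := by
  unfold phi
  split_ifs with h
  swap
  · exact ⟨hP, fun x y _ => ⟨fun _ => rfl, fun _ => rfl⟩⟩
  have hmin := h.choose_spec
  obtain ⟨c, d, hD⟩ := exists_eq_fin h.choose
  rw [hD] at hmin ⊢
  have hrook := hP.isRook hF
  obtain ⟨hc, hC⟩ := (isDecOcc_iff hF hP.1).1 hmin.1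
  have hmc := hmin.isMinChain hF hP
  have hrook' := hrook.isRook_rotateCyclic hc
  have hpos := hF _ hC
  refine ⟨⟨?_, ?_, ?_⟩, ?_⟩
  · rintro ⟨x, y⟩ hxy
    rcases mem_phiStep.1 hxy with (⟨h, -⟩ | ⟨i, hi, rfl, rfl⟩) | ⟨rfl, rfl⟩
    · exact hP.1 h
    · have h1 := hmc.chain.1 i (by omega)
      have h2 := hmc.chain.1 (i + 1) hi
      exact hpos.2.2 _ (hrook.pos h1.1).1 (hrook.pos h2.1).2 h1.2.1 h2.2.2
    · exact hC
  · rintro ⟨x, y⟩ h ⟨x', y'⟩ h' he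
    obtain rfl : x = x' := he
    rw [hrook'.col_inj (mem_phiStep.1 h) (mem_phiStep.1 h')]
  · rintro ⟨x, y⟩ h ⟨x', y'⟩ h' he
    obtain rfl : y = y' := he
    rw [hrook'.row_inj (mem_phiStep.1 h) (mem_phiStep.1 h')]
  · intro x y hxy
    have hg := growth_rotateCyclic hrook hm hmc x y
    have hle : ∀ x y, 1 ≤ x → 1 ≤ y → (x, y) ∉ F → c m < x ∨ d 0 < y := by
      intro x y hx hy hn
      by_contra! hle
      exact hn (hpos.2.2 _ hx hy hle.1 hle.2)
    have hxy' := hF _ hxy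
    simp only [mem_phiStep]
    refine ⟨fun hn => hg.1 ?_, fun hn => hg.2 ?_⟩
    · have := hle _ _ (by omega) hxy'.2.1 hn
      omega
    · have := hle _ _ hxy'.1 (by omega) hn
      omega

theorem isPlacement_iterate_phi_and_boundaryAgree (hF : IsFerrers F) (hm : 1 ≤ m)
    (hP : IsPlacement F P) (n : ℕ) :
    IsPlacement F ((phi F (m + 1))^[n] P) ∧ BoundaryAgree m F P ((phi F (m + 1))^[n] P) := by
  induction n with
  | zero => exact ⟨hP, fun x y _ => ⟨fun _ => rfl, fun _ => rfl⟩⟩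
  | succ n ih =>
    rw [Function.iterate_succ_apply']
    obtain ⟨h1, h2⟩ := isPlacement_phi_and_boundaryAgree hF hm ih.1
    exact ⟨h1, fun x y h => ⟨fun hn => ((ih.2 x y h).1 hn).trans ((h2 x y h).1 hn),
      fun hn => ((ih.2 x y h).2 hn).trans ((h2 x y h).2 hn)⟩⟩

theorem growth_le_of_not_exists_isDecOcc (hF : IsFerrers F) (hP : IsPlacement F P)
    (h : ¬ ∃ D : Fin (m + 1) → Cell, IsDecOcc F P (m + 1) D) {x y : ℕ} (hxy : (x, y) ∈ F) :
    (growth Nat.succ (fun x y => (x, y) ∈ P) x y).1 ≤ m ∧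
      (growth Nat.succ (fun x y => (x, y) ∈ P) x y).2 ≤ m := by
  by_contra hn
  have hrook := hP.isRook hF
  obtain ⟨c, d, hc, hx, hy⟩ := exists_chain_of_le_growth hrook (m := m) (x := x) (y := y)
    (by omega)
  exact h ⟨_, (isDecOcc_iff hF hP.1).2 ⟨hc, (hF _ hxy).2.2 _ (hrook.pos (hc.1 m (by omega))).1
    (hrook.pos (hc.1 0 (by omega))).2 hx hy⟩⟩

theorem growth_wrap_eq_of_not_exists_isDecOcc (hF : IsFerrers F) (hP : IsPlacement F P)
    (h : ¬ ∃ D : Fin (m + 1) → Cell, IsDecOcc F P (m + 1) D) {x y : ℕ} (hxy : (x, y) ∈ F) :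
    growth (wrapSucc m) (fun x y => (x, y) ∈ P) x y =
      growth Nat.succ (fun x y => (x, y) ∈ P) x y := by
  refine growth_wrap_eq x y fun x' y' hx hy => ?_
  rcases x' with _ | x'
  · simp [growth_zero_left]
  rcases y' with _ | y'
  · simp [growth_zero_right]
  exact growth_le_of_not_exists_isDecOcc hF hP h ((hF _ hxy).2.2 _ (by simp) (by simp) hx hy)

theorem eq_of_boundaryAgree (hF : IsFerrers F) (hP : IsPlacement F P) (hR : IsPlacement F R)
    (hPn : ¬ ∃ D : Fin (m + 1) → Cell, IsDecOcc F P (m + 1) D)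
    (hRn : ¬ ∃ D : Fin (m + 1) → Cell, IsDecOcc F R (m + 1) D)
    (h : BoundaryAgree m F P R) : P = R := by
  have zero : ∀ {P}, IsPlacement F P → ∀ x y, (x + 1, y + 1) ∈ P →
      (growth Nat.succ (fun x y => (x, y) ∈ P) x (y + 1)).1 = 0 ∧
        (growth Nat.succ (fun x y => (x, y) ∈ P) (x + 1) y).2 = 0 := by
    intro P hP x y hxy
    have hrook := hP.isRook hF
    have hz := growth_eq_zero hrook (f := Nat.succ) (fun v _ => Nat.succ_ne_zero v)
    rw [(hz _ _).1, (hz _ _).2]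
    refine ⟨fun x₀ hx hq => ?_, fun y₀ hy hq => ?_⟩
    · have := hrook.row_inj hq hxy
      omega
    · have := hrook.col_inj hq hxy
      omega
  have step : ∀ x y, growth Nat.succ (fun x y => (x, y) ∈ P) (x + 1) (y + 1) =
      growth Nat.succ (fun x y => (x, y) ∈ R) (x + 1) (y + 1) →
      ((x + 1, y + 1) ∈ P ↔ (x + 1, y + 1) ∈ R) ∧
      (growth Nat.succ (fun x y => (x, y) ∈ P) x (y + 1)).1 =
        (growth Nat.succ (fun x y => (x, y) ∈ R) x (y + 1)).1 ∧
      (growth Nat.succ (fun x y => (x, y) ∈ P) (x + 1) y).2 =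
        (growth Nat.succ (fun x y => (x, y) ∈ R) (x + 1) y).2 := by
    intro x y he
    rw [growth_succ, growth_succ] at he
    exact cellRule_succ_inj (zero hP x y) (zero hR x y) he
  have key : ∀ n x y, (x, y) ∈ F → (F.sup fun p => p.1 + p.2) < x + y + n →
      growth Nat.succ (fun x y => (x, y) ∈ P) x y =
        growth Nat.succ (fun x y => (x, y) ∈ R) x y := by
    intro n
    induction n with
    | zero =>
      intro x y hxy hlt
      have : x + y ≤ F.sup fun p => p.1 + p.2 := Finset.le_sup (f := fun p : Cell => p.1 + p.2) hxy
      omega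
    | succ n ih =>
      intro x y hxy hlt
      obtain ⟨hx, hy, -⟩ := hF _ hxy
      obtain ⟨x, rfl⟩ := Nat.exists_eq_succ_of_ne_zero (show x ≠ 0 from Nat.one_le_iff_ne_zero.1 hx)
      obtain ⟨y, rfl⟩ := Nat.exists_eq_succ_of_ne_zero (show y ≠ 0 from Nat.one_le_iff_ne_zero.1 hy)
      have hb := h _ _ hxy
      rw [growth_wrap_eq_of_not_exists_isDecOcc hF hP hPn hxy,
        growth_wrap_eq_of_not_exists_isDecOcc hF hR hRn hxy] at hb
      refine Prod.ext ?_ ?_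
      · by_cases hin : (x + 1 + 1, y + 1) ∈ F
        · exact (step _ _ (ih _ _ hin (by omega))).2.1
        · exact hb.1 hin
      · by_cases hin : (x + 1, y + 1 + 1) ∈ F
        · exact (step _ _ (ih _ _ hin (by omega))).2.2
        · exact hb.2 hin
  have hiff : ∀ x y, (x, y) ∈ F → ((x, y) ∈ P ↔ (x, y) ∈ R) := by
    intro x y hxy
    have hk := key _ x y hxy (by omega : _ < x + y + ((F.sup fun p => p.1 + p.2) + 1))
    obtain ⟨hx, hy, -⟩ := hF _ hxy
    obtain ⟨x, rfl⟩ := Nat.exists_eq_succ_of_ne_zero (show x ≠ 0 from Nat.one_le_iff_ne_zero.1 hx)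
    obtain ⟨y, rfl⟩ := Nat.exists_eq_succ_of_ne_zero (show y ≠ 0 from Nat.one_le_iff_ne_zero.1 hy)
    exact (step x y hk).1
  ext ⟨x, y⟩
  exact ⟨fun h => (hiff x y (hP.1 h)).1 h, fun h => (hiff x y (hR.1 h)).2 h⟩

theorem mem_transposeP {x y : ℕ} : (x, y) ∈ transposeP P ↔ (y, x) ∈ P := by
  simp [transposeP]

theorem transposeP_transposeP (P : Finset Cell) : transposeP (transposeP P) = P := by
  ext ⟨x, y⟩
  rw [mem_transposeP, mem_transposeP]

theorem IsFerrers.transposeP (hF : IsFerrers F) : IsFerrers (transposeP F) := by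
  rintro ⟨x, y⟩ h
  obtain ⟨h1, h2, h3⟩ := hF _ (mem_transposeP.1 h)
  exact ⟨h2, h1, fun q q1 q2 q3 q4 => mem_transposeP.2 (h3 (q.2, q.1) q2 q1 q4 q3)⟩

theorem IsPlacement.transposeP (hP : IsPlacement F P) :
    IsPlacement (transposeP F) (transposeP P) := by
  refine ⟨?_, ?_, ?_⟩
  · rintro ⟨x, y⟩ h
    exact mem_transposeP.2 (hP.1 (mem_transposeP.1 h))
  · rintro ⟨x, y⟩ h ⟨x', y'⟩ h' he
    have := hP.2.2 _ (mem_transposeP.1 h) _ (mem_transposeP.1 h') he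
    simp_all
  · rintro ⟨x, y⟩ h ⟨x', y'⟩ h' he
    have := hP.2.1 _ (mem_transposeP.1 h) _ (mem_transposeP.1 h') he
    simp_all

theorem BoundaryAgree.transposeP (h : BoundaryAgree m F P R) :
    BoundaryAgree m (transposeP F) (transposeP P) (transposeP R) := by
  have hg : ∀ P x y, growth (wrapSucc m) (fun x y => (x, y) ∈ _root_.transposeP P) x y =
      (growth (wrapSucc m) (fun x y => (x, y) ∈ P) y x).swap := by
    intro P x y
    rw [← growth_flip]
    simp only [mem_transposeP]
    rfl
  intro x y hxy
  rw [mem_transposeP] at hxy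
  simp only [hg, Prod.fst_swap, Prod.snd_swap]
  simp only [mem_transposeP]
  exact (h y x hxy).symm

theorem exists_isDecOcc_transposeP (hF : IsFerrers F) (hP : P ⊆ F)
    (h : ∃ D : Fin (m + 1) → Cell, IsDecOcc F P (m + 1) D) :
    ∃ D : Fin (m + 1) → Cell, IsDecOcc (transposeP F) (transposeP P) (m + 1) D := by
  obtain ⟨D, hD⟩ := h
  obtain ⟨c, d, rfl⟩ := exists_eq_fin D
  obtain ⟨hc, hC⟩ := (isDecOcc_iff hF hP).1 hD
  refine ⟨_, (isDecOcc_iff (c := fun i => d (m - i)) (d := fun i => c (m - i)) hF.transposeP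
    ?_).2 ⟨?_, ?_⟩⟩
  · rintro ⟨x, y⟩ h
    exact mem_transposeP.2 (hP (mem_transposeP.1 h))
  · have := hc.flip
    simp only [mem_transposeP]
    exact this
  · simpa [mem_transposeP] using hC

end Board

/-- **Corollary.** Fix `k ≥ 2`. For any rook placement `P` on a Ferrers board `F`,
`φ*(P') = (φ*(P))'`, where `P'` is the inverse placement on the conjugate board `F'`. -/
theorem phiStar_inverse (k : ℕ) (hk : 2 ≤ k) (F P Q R : Finset Cell)
    (hF : IsFerrers F) (hP : IsPlacement F P)
    (hQ : IsPhiStar F k P Q)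
    (hR : IsPhiStar (transposeP F) k (transposeP P) R) :
    R = transposeP Q := by
  obtain ⟨m, rfl⟩ := Nat.exists_eq_succ_of_ne_zero (show k ≠ 0 by omega)
  obtain ⟨⟨n, rfl⟩, hQn⟩ := hQ
  obtain ⟨⟨l, rfl⟩, hRn⟩ := hR
  have hm : 1 ≤ m := by omega
  obtain ⟨p1, a1⟩ := isPlacement_iterate_phi_and_boundaryAgree hF hm hP n
  obtain ⟨p2, a2⟩ :=
    isPlacement_iterate_phi_and_boundaryAgree hF.transposeP hm hP.transposeP l
  refine eq_of_boundaryAgree hF.transposeP p2 p1.transposeP hRn (fun h => hQn ?_) ?_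
  · have := exists_isDecOcc_transposeP hF.transposeP p1.transposeP.1 h
    rwa [transposeP_transposeP, transposeP_transposeP] at this
  · have b := a1.transposeP
    exact fun x y h => ⟨fun hn => ((a2 x y h).1 hn).symm.trans ((b x y h).1 hn),
      fun hn => ((a2 x y h).2 hn).symm.trans ((b x y h).2 hn)⟩
end
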